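/- arXiv:math/0508245 — 5 statements merged into one kernel-verified Lean document; each statement's English description precedes it below -/
import Mathlib

section
/- Let μ₁ and μ₂ be Borel probability measures on ℝ with reciprocal Cauchy transforms F_{μ₁} and F_{μ₂}. Then for every z ∈ ℂ⁺ there exist unique points z₁ ∈ ℂ⁺ and z₂ ∈ ℂ⁺ such that z = z₁ + z₂ − F_{μ₂}(z₂) and z = z₁ + z₂ − F_{μ₁}(z₁). -/
open MeasureTheory Complex Filter Set

/-- Open upper half-plane. -/
def upperHalf : Set ℂ := {z : ℂ | 0 < z.im}

/-- Cauchy transform of a Borel measure on ℝ. -/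
noncomputable def cauchyG (μ : Measure ℝ) (z : ℂ) : ℂ := ∫ t, (z - (t : ℂ))⁻¹ ∂μ

/-- Reciprocal Cauchy transform. -/
noncomputable def recF (μ : Measure ℝ) (z : ℂ) : ℂ := (cauchyG μ z)⁻¹

/-- The class 𝓕 of reciprocal Cauchy transforms of Borel probability measures on ℝ
(membership only depends on the values on the upper half-plane). -/
def classF (f : ℂ → ℂ) : Prop :=
  ∃ μ : Measure ℝ, IsProbabilityMeasure μ ∧ ∀ z ∈ upperHalf, f z = recF μ z

/-! ### Measure part -/

lemma g_im (a : ℂ) (t : ℝ) : ((a - (t : ℂ))⁻¹).im = -a.im * ‖(a - (t : ℂ))⁻¹‖ ^ 2 := by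
  rw [Complex.inv_im, norm_inv, inv_pow, Complex.sq_norm]
  simp [div_eq_mul_inv]

lemma sub_real_ne {a : ℂ} (ha : 0 < a.im) (t : ℝ) : a - (t : ℂ) ≠ 0 := by
  intro h
  have := congrArg Complex.im h
  simp at this
  linarith

lemma g_norm_le {a : ℂ} (ha : 0 < a.im) (t : ℝ) : ‖(a - (t : ℂ))⁻¹‖ ≤ (a.im)⁻¹ := by
  rw [norm_inv]
  apply inv_anti₀ ha
  have := Complex.abs_im_le_norm (a - (t : ℂ))
  simp only [Complex.sub_im, Complex.ofReal_im, sub_zero] at this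
  exact (le_abs_self _).trans this

lemma g_cont {a : ℂ} (ha : 0 < a.im) : Continuous fun t : ℝ => (a - (t : ℂ))⁻¹ :=
  Continuous.inv₀ (by fun_prop) (sub_real_ne ha)

lemma bdd_int {E : Type*} [NormedAddCommGroup E] (μ : Measure ℝ) [IsProbabilityMeasure μ]
    [SecondCountableTopologyEither ℝ E]
    {f : ℝ → E} (hf : Continuous f) (C : ℝ) (hC : ∀ t, ‖f t‖ ≤ C) : Integrable f μ :=
  Integrable.of_bound hf.aestronglyMeasurable C (Eventually.of_forall hC)

lemma int_fsub {E : Type*} [NormedAddCommGroup E] {μ : Measure ℝ} {f g : ℝ → E}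
    (hf : Integrable f μ) (hg : Integrable g μ) : Integrable (fun t => f t - g t) μ :=
  hf.sub hg

lemma g_int (μ : Measure ℝ) [IsProbabilityMeasure μ] {a : ℂ} (ha : 0 < a.im) :
    Integrable (fun t : ℝ => (a - (t : ℂ))⁻¹) μ :=
  bdd_int μ (g_cont ha) _ (g_norm_le ha)

lemma gg_int (μ : Measure ℝ) [IsProbabilityMeasure μ] {a b : ℂ} (ha : 0 < a.im) (hb : 0 < b.im) :
    Integrable (fun t : ℝ => (a - (t : ℂ))⁻¹ * (b - (t : ℂ))⁻¹) μ := by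
  refine bdd_int μ ((g_cont ha).mul (g_cont hb)) ((a.im)⁻¹ * (b.im)⁻¹) fun t => ?_
  rw [norm_mul]
  have := inv_pos.2 ha
  exact mul_le_mul (g_norm_le ha t) (g_norm_le hb t) (norm_nonneg _) this.le

lemma gsq_int (μ : Measure ℝ) [IsProbabilityMeasure μ] {a : ℂ} (ha : 0 < a.im) :
    Integrable (fun t : ℝ => ‖(a - (t : ℂ))⁻¹‖ ^ 2) μ := by
  refine bdd_int μ ((g_cont ha).norm.pow 2) ((a.im)⁻¹ ^ 2) fun t => ?_
  rw [norm_pow, norm_norm]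
  exact pow_le_pow_left₀ (norm_nonneg _) (g_norm_le ha t) 2

noncomputable def nN (μ : Measure ℝ) (a : ℂ) : ℝ := ∫ t, ‖(a - (t : ℂ))⁻¹‖ ^ 2 ∂μ

lemma nN_pos (μ : Measure ℝ) [IsProbabilityMeasure μ] {a : ℂ} (ha : 0 < a.im) : 0 < nN μ a := by
  unfold nN
  have hpos : ∀ t : ℝ, 0 < ‖(a - (t : ℂ))⁻¹‖ ^ 2 := fun t => by
    have := inv_ne_zero (sub_real_ne ha t)
    positivity
  rw [integral_pos_iff_support_of_nonneg (fun t => (hpos t).le) (gsq_int μ ha)]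
  have : Function.support (fun t : ℝ => ‖(a - (t : ℂ))⁻¹‖ ^ 2) = univ := by
    ext t; simp only [Function.mem_support, mem_univ, iff_true]; exact (hpos t).ne'
  rw [this]; simp

lemma G_im (μ : Measure ℝ) [IsProbabilityMeasure μ] {a : ℂ} (ha : 0 < a.im) :
    (cauchyG μ a).im = -a.im * nN μ a := by
  unfold cauchyG nN
  have := integral_im (g_int μ ha)
  simp only [RCLike.im_to_complex] at this
  rw [← this, ← integral_const_mul]
  exact integral_congr_ae (Eventually.of_forall fun t => g_im a t)

lemma G_ne (μ : Measure ℝ) [IsProbabilityMeasure μ] {a : ℂ} (ha : 0 < a.im) :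
    cauchyG μ a ≠ 0 := by
  intro h
  have h2 := G_im μ ha
  rw [h] at h2
  have := mul_pos ha (nN_pos μ ha)
  simp at h2
  rcases h2 with h2 | h2
  · linarith
  · linarith [nN_pos μ ha]

lemma G_sub (μ : Measure ℝ) [IsProbabilityMeasure μ] {a b : ℂ} (ha : 0 < a.im) (hb : 0 < b.im) :
    cauchyG μ a - cauchyG μ b = (b - a) * ∫ t, (a - (t : ℂ))⁻¹ * (b - (t : ℂ))⁻¹ ∂μ := by
  unfold cauchyG
  rw [← integral_sub (g_int μ ha) (g_int μ hb), ← integral_const_mul]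
  refine integral_congr_ae (Eventually.of_forall fun t => ?_)
  have h1 := sub_real_ne ha t
  have h2 := sub_real_ne hb t
  simp only
  field_simp
  ring

noncomputable def hH (μ : Measure ℝ) (a : ℂ) : ℂ := recF μ a - a

noncomputable def hh (μ : Measure ℝ) (a : ℂ) (t : ℝ) : ℂ := (a - (t : ℂ))⁻¹ * (cauchyG μ a)⁻¹ - 1

lemma hh_cont (μ : Measure ℝ) {a : ℂ} (ha : 0 < a.im) : Continuous (hh μ a) :=
  ((g_cont ha).mul continuous_const).sub continuous_const

lemma hh_bdd (μ : Measure ℝ) {a : ℂ} (ha : 0 < a.im) : ∃ C, ∀ t, ‖hh μ a t‖ ≤ C := by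
  refine ⟨(a.im)⁻¹ * ‖(cauchyG μ a)⁻¹‖ + 1, fun t => ?_⟩
  unfold hh
  refine (norm_sub_le _ _).trans ?_
  rw [norm_mul, norm_one]
  gcongr
  exact g_norm_le ha t

lemma hh_memLp (μ : Measure ℝ) [IsProbabilityMeasure μ] {a : ℂ} (ha : 0 < a.im) (p) :
    MemLp (hh μ a) p μ := by
  obtain ⟨C, hC⟩ := hh_bdd μ ha
  exact MemLp.of_bound (hh_cont μ ha).aestronglyMeasurable C (Eventually.of_forall hC)

lemma hH_sub (μ : Measure ℝ) [IsProbabilityMeasure μ] {a b : ℂ} (ha : 0 < a.im) (hb : 0 < b.im) :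
    hH μ a - hH μ b = (a - b) * ∫ t, hh μ a t * hh μ b t ∂μ := by
  have h1 : ∫ t, hh μ a t * hh μ b t ∂μ =
      (∫ t, (a - (t : ℂ))⁻¹ * (b - (t : ℂ))⁻¹ ∂μ) * ((cauchyG μ a)⁻¹ * (cauchyG μ b)⁻¹) - 1 := by
    have e : ∀ t, hh μ a t * hh μ b t =
      ((a - (t : ℂ))⁻¹ * (b - (t : ℂ))⁻¹) * ((cauchyG μ a)⁻¹ * (cauchyG μ b)⁻¹)
        - (a - (t : ℂ))⁻¹ * (cauchyG μ a)⁻¹ - (b - (t : ℂ))⁻¹ * (cauchyG μ b)⁻¹ + 1 := by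
      intro t; unfold hh; ring
    simp_rw [e]
    have i1 := (gg_int μ ha hb).mul_const ((cauchyG μ a)⁻¹ * (cauchyG μ b)⁻¹)
    have i2 := (g_int μ ha).mul_const (cauchyG μ a)⁻¹
    have i3 := (g_int μ hb).mul_const (cauchyG μ b)⁻¹
    rw [integral_add (int_fsub (int_fsub i1 i2) i3) (integrable_const _), integral_sub (int_fsub i1 i2) i3,
      integral_sub i1 i2, integral_mul_const, integral_mul_const, integral_mul_const]
    change _ - cauchyG μ a * _ - cauchyG μ b * _ + _ = _
    rw [mul_inv_cancel₀ (G_ne μ ha), mul_inv_cancel₀ (G_ne μ hb)]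
    simp
  have h2 := G_sub μ ha hb
  have ga := G_ne μ ha
  have gb := G_ne μ hb
  rw [h1]
  unfold hH recF
  generalize (∫ t, (a - (t : ℂ))⁻¹ * (b - (t : ℂ))⁻¹ ∂μ) = J at *
  field_simp
  linear_combination (-1 : ℂ) * h2

lemma F_im (μ : Measure ℝ) [IsProbabilityMeasure μ] {a : ℂ} (ha : 0 < a.im) :
    (recF μ a).im = a.im * nN μ a * (‖cauchyG μ a‖ ^ 2)⁻¹ := by
  unfold recF
  rw [Complex.inv_im, G_im μ ha, Complex.sq_norm]
  ring

lemma hH_im (μ : Measure ℝ) [IsProbabilityMeasure μ] {a : ℂ} (ha : 0 < a.im) :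
    (hH μ a).im = a.im * ∫ t, ‖hh μ a t‖ ^ 2 ∂μ := by
  have e : ∀ t, ‖hh μ a t‖ ^ 2 = ‖(a - (t : ℂ))⁻¹‖ ^ 2 * (‖cauchyG μ a‖ ^ 2)⁻¹
      - 2 * ((a - (t : ℂ))⁻¹ * (cauchyG μ a)⁻¹).re + 1 := by
    intro t; unfold hh
    rw [← inv_pow, ← norm_inv, ← mul_pow, ← norm_mul, Complex.sq_norm, Complex.sq_norm,
      Complex.normSq_sub]
    simp
    ring
  have i1 := (gsq_int μ ha).mul_const (‖cauchyG μ a‖ ^ 2)⁻¹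
  have i2 := (g_int μ ha).mul_const (cauchyG μ a)⁻¹
  have i3 : Integrable (fun t : ℝ => 2 * ((a - (t : ℂ))⁻¹ * (cauchyG μ a)⁻¹).re) μ :=
    i2.re.const_mul 2
  have h3 : ∫ t, ((a - (t : ℂ))⁻¹ * (cauchyG μ a)⁻¹).re ∂μ = 1 := by
    have := integral_re i2
    simp only [RCLike.re_to_complex] at this
    rw [this, integral_mul_const]
    change (cauchyG μ a * _).re = _
    rw [mul_inv_cancel₀ (G_ne μ ha)]; simp
  simp_rw [e]
  rw [integral_add (int_fsub i1 i3) (integrable_const _), integral_sub i1 i3, integral_mul_const,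
    integral_const_mul, h3]
  change _ = a.im * (nN μ a * _ - _ + _)
  unfold hH
  rw [Complex.sub_im, F_im μ ha]
  simp
  ring

lemma hH_im_nonneg (μ : Measure ℝ) [IsProbabilityMeasure μ] {a : ℂ} (ha : 0 < a.im) :
    0 ≤ (hH μ a).im := by
  rw [hH_im μ ha]
  exact mul_nonneg ha.le (integral_nonneg fun t => by positivity)

lemma hH_pick (μ : Measure ℝ) [IsProbabilityMeasure μ] {a b : ℂ} (ha : 0 < a.im) (hb : 0 < b.im) :
    ‖hH μ a - hH μ b‖ ^ 2 * (a.im * b.im) ≤ ‖a - b‖ ^ 2 * ((hH μ a).im * (hH μ b).im) := by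
  have cs : ‖∫ t, hh μ a t * hh μ b t ∂μ‖ ^ 2 ≤
      (∫ t, ‖hh μ a t‖ ^ 2 ∂μ) * ∫ t, ‖hh μ b t‖ ^ 2 ∂μ := by
    have h := integral_mul_norm_le_Lp_mul_Lq (μ := μ) (f := hh μ a) (g := hh μ b)
      Real.HolderConjugate.two_two (hh_memLp μ ha _) (hh_memLp μ hb _)
    have h0 : ‖∫ t, hh μ a t * hh μ b t ∂μ‖ ≤ ∫ t, ‖hh μ a t‖ * ‖hh μ b t‖ ∂μ := by
      refine (norm_integral_le_integral_norm _).trans_eq ?_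
      simp_rw [norm_mul]
    have h1 := h0.trans h
    simp only [Real.rpow_two, ← Real.sqrt_eq_rpow] at h1
    have pa : 0 ≤ ∫ t, ‖hh μ a t‖ ^ 2 ∂μ := integral_nonneg fun t => by positivity
    have pb : 0 ≤ ∫ t, ‖hh μ b t‖ ^ 2 ∂μ := integral_nonneg fun t => by positivity
    have h2 := pow_le_pow_left₀ (norm_nonneg _) h1 2
    rwa [mul_pow, Real.sq_sqrt pa, Real.sq_sqrt pb] at h2
  rw [hH_sub μ ha hb, hH_im μ ha, hH_im μ hb, norm_mul, mul_pow]
  have : 0 ≤ ‖a - b‖ ^ 2 * (a.im * b.im) := by positivity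
  nlinarith [mul_le_mul_of_nonneg_left cs this]

lemma hH_cont (μ : Measure ℝ) [IsProbabilityMeasure μ] {a : ℂ} (ha : 0 < a.im) :
    ContinuousAt (hH μ) a := by
  have hG : ContinuousAt (cauchyG μ) a := by
    unfold cauchyG
    have hnhds : ∀ᶠ x : ℂ in nhds a, a.im / 2 < x.im :=
      Complex.continuous_im.continuousAt.eventually (lt_mem_nhds (by linarith))
    refine continuousAt_of_dominated (bound := fun _ => (a.im / 2)⁻¹) ?_ ?_ (integrable_const _) ?_
    · filter_upwards [hnhds] with x hx
      exact (g_cont (by linarith)).aestronglyMeasurable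
    · filter_upwards [hnhds] with x hx
      refine Eventually.of_forall fun t => (g_norm_le (by linarith) t).trans ?_
      exact inv_anti₀ (by linarith) hx.le
    · refine Eventually.of_forall fun t => ?_
      exact ContinuousAt.inv₀ (by fun_prop) (sub_real_ne ha t)
  exact (hG.inv₀ (G_ne μ ha)).sub continuousAt_id

lemma hH_asymp (μ : Measure ℝ) [IsProbabilityMeasure μ] {ε : ℝ} (hε : 0 < ε) :
    ∀ᶠ s : ℝ in atTop, (hH μ (s * I)).im ≤ ε * s := by
  have lim : Tendsto (fun s : ℝ => ∫ t, s ^ 2 * ‖((s : ℂ) * I - (t : ℂ))⁻¹‖ ^ 2 ∂μ) atTop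
      (nhds (∫ _t : ℝ, (1 : ℝ) ∂μ)) := by
    have nrm : ∀ s t : ℝ, ‖((s : ℂ) * I - (t : ℂ))⁻¹‖ ^ 2 = (s ^ 2 + t ^ 2)⁻¹ := by
      intro s t
      rw [norm_inv, inv_pow, Complex.sq_norm, Complex.normSq_apply]
      simp
      ring
    simp_rw [nrm]
    refine tendsto_integral_filter_of_dominated_convergence (fun _ => (1 : ℝ)) ?_ ?_
      (integrable_const _) ?_
    · filter_upwards with s
      exact (by fun_prop : Measurable fun t : ℝ => s ^ 2 * (s ^ 2 + t ^ 2)⁻¹).aestronglyMeasurable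
    · filter_upwards with s
      refine Eventually.of_forall fun t => ?_
      rw [Real.norm_of_nonneg (by positivity), ← div_eq_mul_inv]
      exact div_le_one_of_le₀ (by nlinarith [sq_nonneg t]) (by positivity)
    · refine Eventually.of_forall fun t => ?_
      have h1 : Tendsto (fun s : ℝ => (1 + t ^ 2 * (s⁻¹) ^ 2)⁻¹) atTop
          (nhds ((1 + t ^ 2 * 0 ^ 2)⁻¹)) :=
        Tendsto.inv₀ (((tendsto_inv_atTop_zero.pow 2).const_mul _).const_add _) (by simp)
      simp only [ne_eq, OfNat.ofNat_ne_zero, not_false_eq_true, zero_pow, mul_zero, add_zero,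
        inv_one] at h1
      refine h1.congr' ?_
      filter_upwards [eventually_gt_atTop 0] with s hs
      have : s ^ 2 + t ^ 2 ≠ 0 := by positivity
      field_simp
  simp only [integral_const, probReal_univ, smul_eq_mul, mul_one] at lim
  have h1 : (1 + ε)⁻¹ < 1 := inv_lt_one_of_one_lt₀ (by linarith)
  filter_upwards [lim.eventually (lt_mem_nhds h1), eventually_gt_atTop 0] with s hs hs0
  rw [integral_const_mul] at hs
  change _ < s ^ 2 * nN μ (s * I) at hs
  have him : ((s : ℂ) * I).im = s := by simp
  have hpos : 0 < ((s : ℂ) * I).im := by rw [him]; exact hs0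
  have hN := nN_pos μ hpos
  have hGim := G_im μ hpos
  have hF := F_im μ hpos
  rw [him] at hGim hF
  have hle := Complex.abs_im_le_norm (cauchyG μ (s * I))
  rw [hGim, neg_mul, abs_neg, abs_of_pos (by positivity)] at hle
  unfold hH
  rw [Complex.sub_im, hF, him]
  set N := nN μ (s * I)
  have h2 : (‖cauchyG μ (s * I)‖ ^ 2)⁻¹ ≤ ((s * N) ^ 2)⁻¹ :=
    inv_anti₀ (by positivity) (pow_le_pow_left₀ (by positivity) hle 2)
  have h3 : s * N * (‖cauchyG μ (s * I)‖ ^ 2)⁻¹ ≤ s * N * ((s * N) ^ 2)⁻¹ :=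
    mul_le_mul_of_nonneg_left h2 (by positivity)
  have h4 : s * N * ((s * N) ^ 2)⁻¹ = s * (s ^ 2 * N)⁻¹ := by field_simp
  have h5 : (s ^ 2 * N)⁻¹ ≤ 1 + ε := by
    rw [inv_le_comm₀ (by positivity) (by positivity)]; exact hs.le
  nlinarith [mul_le_mul_of_nonneg_left h5 hs0.le]

/-! ### Hyperbolic part -/

noncomputable def dD (a b : ℂ) : ℝ := ‖a - b‖ ^ 2 / (a.im * b.im)

structure Good (c : ℝ) (f : ℂ → ℂ) : Prop where
  pos : 0 < c
  lower : ∀ a : ℂ, 0 < a.im → c ≤ (f a).im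
  pick : ∀ a b : ℂ, 0 < a.im → 0 < b.im →
    ‖f a - f b‖ ^ 2 * (a.im * b.im) ≤ ‖a - b‖ ^ 2 * (((f a).im - c) * ((f b).im - c))
  cont : ∀ a : ℂ, 0 < a.im → ContinuousAt f a

lemma good_hH (μ : Measure ℝ) [IsProbabilityMeasure μ] (z : ℂ) (hz : 0 < z.im) :
    Good z.im (fun w => z + hH μ w) where
  pos := hz
  lower a ha := by
    have := hH_im_nonneg μ ha
    simp only [Complex.add_im]; linarith
  pick a b ha hb := by
    have := hH_pick μ ha hb
    simpa using this
  cont a ha := continuousAt_const.add (hH_cont μ ha)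

lemma Good.im_pos {c : ℝ} {f : ℂ → ℂ} (h : Good c f) {a : ℂ} (ha : 0 < a.im) : 0 < (f a).im :=
  h.pos.trans_le (h.lower a ha)

lemma Good.lt {c : ℝ} {f : ℂ → ℂ} (h : Good c f) {a b : ℂ} (ha : 0 < a.im) (hb : 0 < b.im)
    (hab : a ≠ b) : dD (f a) (f b) < dD a b := by
  have hc := h.pos
  have h1 := h.lower a ha
  have h2 := h.lower b hb
  have hp := h.pick a b ha hb
  have hpa := h.im_pos ha
  have hpb := h.im_pos hb
  unfold dD
  rw [div_lt_div_iff₀ (by positivity) (by positivity)]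
  refine hp.trans_lt ?_
  have : 0 < ‖a - b‖ := norm_pos_iff.2 (sub_ne_zero.2 hab)
  apply mul_lt_mul_of_pos_left _ (by positivity)
  nlinarith

lemma dD_self (a : ℂ) : dD a a = 0 := by simp [dD]

lemma Good.le {c : ℝ} {f : ℂ → ℂ} (h : Good c f) {a b : ℂ} (ha : 0 < a.im) (hb : 0 < b.im) :
    dD (f a) (f b) ≤ dD a b := by
  by_cases hab : a = b
  · subst hab; simp [dD_self]
  · exact (h.lt ha hb hab).le

lemma dD_nonneg {a b : ℂ} (ha : 0 < a.im) (hb : 0 < b.im) : 0 ≤ dD a b := by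
  unfold dD; positivity

/-- the composed map moves some point down -/
lemma exists_down {c : ℝ} {f g : ℂ → ℂ} (hf : Good c f) (hg : Good c g) {s : ℝ} (hs : 0 < s)
    (hfs : (f (s * I)).im ≤ s / 10) (hgs : (g (s * I)).im ≤ s / 10) :
    ∃ p : ℂ, 0 < p.im ∧ (g (f p)).im < p.im := by
  by_contra! hcon
  have hc := hf.pos
  set b := f (s * I) with hb
  set d := g (s * I) with hd
  set K := 2 * ‖b - s * I‖ ^ 2 with hK
  have hK0 : 0 ≤ K := by positivity
  have hims : ((s : ℂ) * I).im = s := by simp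
  have hsI : 0 < ((s : ℂ) * I).im := by rw [hims]; exact hs
  have hbpos : 0 < b.im := hf.im_pos hsI
  have hdpos : 0 < d.im := hg.im_pos hsI
  have hKc : 0 ≤ K / c := by positivity
  obtain ⟨y, hy⟩ : ∃ y : ℝ, y = s + 2 * d.im + K / c + 1 := ⟨_, rfl⟩
  have hy0 : 0 < y := by rw [hy]; positivity
  have hys : s ≤ y := by linarith
  have himy : ((y : ℂ) * I).im = y := by simp
  have hyI : 0 < ((y : ℂ) * I).im := by rw [himy]; exact hy0
  have hU := hcon _ hyI
  rw [himy] at hU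
  have p1 := hf.le hyI hsI
  have hvc := hf.lower _ hyI
  have hvpos := hf.im_pos hyI
  have p2 := hg.le hvpos hsI
  have hupos := hg.im_pos hvpos
  rw [← hb] at p1
  rw [← hd] at p2
  set v := f (y * I) with hv
  set u := g v with hu
  unfold dD at p1 p2
  rw [div_le_div_iff₀ (by positivity) (by positivity), hims] at p1 p2
  rw [himy] at p1
  have hn : ‖(y : ℂ) * I - s * I‖ = y - s := by
    rw [← sub_mul, norm_mul, Complex.norm_I, mul_one, ← Complex.ofReal_sub, Complex.norm_real,
      Real.norm_of_nonneg (by linarith)]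
  rw [hn] at p1
  -- first estimate
  have e1 : ‖v - b‖ ^ 2 ≤ y * v.im / 10 := by
    have h1 : (y - s) ^ 2 * (v.im * b.im) ≤ y ^ 2 * (v.im * (s / 10)) := by
      have : (y - s) ^ 2 ≤ y ^ 2 := pow_le_pow_left₀ (by linarith) (by linarith) 2
      gcongr
    have h2 := p1.trans h1
    have h3 : 0 < y * s := by positivity
    refine le_of_mul_le_mul_right (h2.trans_eq ?_) h3
    ring
  have e2 : ‖v - s * I‖ ^ 2 ≤ y * v.im / 5 + K := by
    have h1 : ‖v - s * I‖ ≤ ‖v - b‖ + ‖b - s * I‖ := norm_sub_le_norm_sub_add_norm_sub _ _ _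
    have h2 := pow_le_pow_left₀ (norm_nonneg _) h1 2
    nlinarith [sq_nonneg (‖v - b‖ - ‖b - s * I‖)]
  have e3 : ‖u - d‖ ^ 2 * v.im ≤ ‖v - s * I‖ ^ 2 * u.im / 10 := by
    have h1 : ‖v - s * I‖ ^ 2 * (u.im * d.im) ≤ ‖v - s * I‖ ^ 2 * (u.im * (s / 10)) := by gcongr
    refine le_of_mul_le_mul_right ((p2.trans h1).trans_eq' ?_ |>.trans_eq ?_) hs <;> ring
  have e4 : ‖u - d‖ ^ 2 ≤ u.im / 10 * (y / 5 + K / c) := by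
    have h1 : K ≤ K / c * v.im := by
      calc K = K / c * c := by field_simp
        _ ≤ _ := by gcongr
    have h2 : ‖v - s * I‖ ^ 2 ≤ v.im * (y / 5 + K / c) := by linarith
    have h3 : ‖v - s * I‖ ^ 2 * u.im / 10 ≤ (v.im * (y / 5 + K / c)) * u.im / 10 := by gcongr
    refine le_of_mul_le_mul_right ((e3.trans h3).trans_eq ?_) hvpos
    ring
  have e5 : (u.im - d.im) ^ 2 ≤ ‖u - d‖ ^ 2 := by
    have := Complex.abs_im_le_norm (u - d)
    rw [Complex.sub_im] at this
    rw [← sq_abs]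
    exact pow_le_pow_left₀ (abs_nonneg _) this 2
  have e6 : (u.im / 2) ^ 2 ≤ (u.im - d.im) ^ 2 := pow_le_pow_left₀ (by linarith) (by linarith) 2
  have e7 : u.im / 4 ≤ (y / 5 + K / c) / 10 := by
    refine le_of_mul_le_mul_right ?_ hupos
    linarith
  linarith

lemma fixed_unique {c : ℝ} {f g : ℂ → ℂ} (hf : Good c f) (hg : Good c g) {a b : ℂ}
    (ha : 0 < a.im) (hb : 0 < b.im) (h1 : g (f a) = a) (h2 : g (f b) = b) : a = b := by
  by_contra hab
  have h := (hg.le (hf.im_pos ha) (hf.im_pos hb)).trans_lt (hf.lt ha hb hab)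
  rw [h1, h2] at h
  exact lt_irrefl _ h

lemma fixed_exists {c : ℝ} {f g : ℂ → ℂ} (hf : Good c f) (hg : Good c g) {p : ℂ}
    (hp : 0 < p.im) (hdown : (g (f p)).im < p.im) : ∃ w : ℂ, 0 < w.im ∧ g (f w) = w := by
  have hc := hf.pos
  set T : ℂ → ℂ := fun w => g (f w) with hT
  have Tpos : ∀ w : ℂ, 0 < w.im → 0 < (T w).im := fun w hw => hg.im_pos (hf.im_pos hw)
  have Tlow : ∀ w : ℂ, 0 < w.im → c ≤ (T w).im := fun w hw => hg.lower _ (hf.im_pos hw)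
  have Tle : ∀ a b : ℂ, 0 < a.im → 0 < b.im → dD (T a) (T b) ≤ dD a b := fun a b ha hb =>
    (hg.le (hf.im_pos ha) (hf.im_pos hb)).trans (hf.le ha hb)
  have Tlt : ∀ a b : ℂ, 0 < a.im → 0 < b.im → a ≠ b → dD (T a) (T b) < dD a b :=
    fun a b ha hb hab => (hg.le (hf.im_pos ha) (hf.im_pos hb)).trans_lt (hf.lt ha hb hab)
  have Tcont : ∀ a : ℂ, 0 < a.im → ContinuousAt T a := fun a ha =>
    ContinuousAt.comp (g := g) (hg.cont _ (hf.im_pos ha)) (hf.cont a ha)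
  set w : ℕ → ℂ := fun n => T^[n] (T p) with hw
  have wsucc : ∀ n, w (n + 1) = T (w n) := fun n => Function.iterate_succ_apply' _ _ _
  have wlow : ∀ n, c ≤ (w n).im := by
    intro n
    induction n with
    | zero => exact Tlow p hp
    | succ k ih => rw [wsucc]; exact Tlow _ (hc.trans_le ih)
  have wpos : ∀ n, 0 < (w n).im := fun n => hc.trans_le (wlow n)
  set e : ℕ → ℝ := fun n => dD (w n) p with he
  by_cases htend : Tendsto e atTop atTop
  · exfalso
    have hq := Tpos p hp
    -- the norms tend to infinity, with infinitely many records
    have key : ∀ R : ℝ, ∃ n, R ≤ ‖w n‖ ∧ e n ≤ e (n + 1) ∧ R ≤ ‖w (n + 1)‖ := by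
      intro R
      have hR : ∀ᶠ n in atTop, R ≤ ‖w n‖ := by
        filter_upwards [htend.eventually_gt_atTop ((R + ‖p‖) ^ 2 / (c * p.im))] with n hn
        by_contra! hlt
        refine absurd hn (not_lt.2 ?_)
        simp only [he, dD]
        have h1 : ‖w n - p‖ ≤ R + ‖p‖ := (norm_sub_le _ _).trans (by linarith)
        have := wlow n
        gcongr
      obtain ⟨N, hN⟩ := eventually_atTop.1 hR
      by_contra! hcon
      have hdec : ∀ n, N ≤ n → e n ≤ e N := by
        intro n hn
        induction n, hn using Nat.le_induction with
        | base => exact le_rfl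
        | succ k hk ih =>
          by_contra! hlt
          have := hcon k (hN k hk) (ih.trans hlt.le)
          linarith [hN (k + 1) (by omega)]
      obtain ⟨n, hn1, hn2⟩ := ((htend.eventually_gt_atTop (e N)).and (eventually_ge_atTop N)).exists
      linarith [hdec n hn2]
    have key2 : ∀ R : ℝ, ∃ X : ℝ, R ≤ X ∧ ‖T p‖ ≤ X ∧
        (X - ‖T p‖) ^ 2 * p.im ≤ (X + ‖p‖) ^ 2 * (T p).im := by
      intro R
      obtain ⟨n, -, h1, h2⟩ := key (max R ‖T p‖)
      refine ⟨‖w (n + 1)‖, (le_max_left _ _).trans h2, (le_max_right _ _).trans h2, ?_⟩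
      have h3 : dD (w (n + 1)) (T p) ≤ dD (w (n + 1)) p := by
        refine le_trans ?_ h1
        rw [wsucc]; exact Tle _ _ (wpos n) hp
      have hwn := wpos (n + 1)
      unfold dD at h3
      rw [div_le_div_iff₀ (by positivity) (by positivity)] at h3
      have h4 : ‖w (n + 1) - T p‖ ^ 2 * p.im ≤ ‖w (n + 1) - p‖ ^ 2 * (T p).im := by
        refine le_of_mul_le_mul_right ?_ hwn
        linarith
      have h5 : (‖w (n + 1)‖ - ‖T p‖) ^ 2 ≤ ‖w (n + 1) - T p‖ ^ 2 :=
        pow_le_pow_left₀ (sub_nonneg.2 ((le_max_right _ _).trans h2)) (norm_sub_norm_le _ _) 2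
      have h6 : ‖w (n + 1) - p‖ ^ 2 ≤ (‖w (n + 1)‖ + ‖p‖) ^ 2 :=
        pow_le_pow_left₀ (norm_nonneg _) (norm_sub_le _ _) 2
      nlinarith [mul_le_mul_of_nonneg_right h5 hp.le, mul_le_mul_of_nonneg_right h6 hq.le]
    change (T p).im < p.im at hdown
    generalize (T p).im = Q at *
    have hA := norm_nonneg (T p)
    have hB := norm_nonneg p
    generalize ‖T p‖ = A at *
    generalize ‖p‖ = B at *
    generalize p.im = P at *
    have hPQ : 0 < P - Q := by linarith
    set M := 2 * A * P + 2 * B * Q + B ^ 2 * Q with hM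
    have hM0 : 0 ≤ M := by positivity
    obtain ⟨X, hX1, -, hX2⟩ := key2 (M / (P - Q) + 1)
    have hX0 : 1 ≤ X := by
      have : 0 ≤ M / (P - Q) := by positivity
      linarith
    have h1 : M + (P - Q) ≤ X * (P - Q) := by
      calc M + (P - Q) = (M / (P - Q) + 1) * (P - Q) := by field_simp
        _ ≤ _ := by gcongr
    -- X²(P-Q) ≤ 2AXP + 2BXQ + B²Q ≤ M X
    have h2 : X ^ 2 * (P - Q) ≤ M * X := by
      have h3 : 0 ≤ A ^ 2 * P := by positivity
      have h4 : B ^ 2 * Q ≤ B ^ 2 * Q * X := le_mul_of_one_le_right (by positivity) hX0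
      rw [hM]; nlinarith
    have h3 : X * (P - Q) ≤ M := by
      refine le_of_mul_le_mul_right ?_ (by linarith : 0 < X)
      linarith
    linarith
  · -- a bounded subsequence
    rw [tendsto_atTop] at htend
    push Not at htend
    obtain ⟨M, hM⟩ := htend
    have hfreq : ∃ᶠ n in atTop, w n ∈ Metric.closedBall p (max M 0 * p.im + p.im) := by
      refine hM.mono fun n hn => ?_
      rw [Metric.mem_closedBall, dist_eq_norm]
      have hwn := wpos n
      have h1 : dD (w n) p ≤ max M 0 := hn.le.trans (le_max_left _ _)
      unfold dD at h1
      rw [div_le_iff₀ (by positivity)] at h1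
      have h2 : (w n).im ≤ ‖w n - p‖ + p.im := by
        have := (le_abs_self _).trans (Complex.abs_im_le_norm (w n - p))
        rw [Complex.sub_im] at this; linarith
      have hm : 0 ≤ max M 0 := le_max_right _ _
      have h0 := norm_nonneg (w n - p)
      generalize ‖w n - p‖ = X at *
      generalize (max M 0) = m at *
      have hmp : 0 ≤ m * p.im := by positivity
      by_contra! hlt
      have h3 : X ^ 2 ≤ m * p.im * (X + p.im) := by
        nlinarith [mul_le_mul_of_nonneg_left h2 hmp]
      nlinarith
    obtain ⟨x, -, φ, hφ, hlim⟩ := (isCompact_closedBall p _).tendsto_subseq' hfreq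
    have hxim : c ≤ x.im :=
      ge_of_tendsto' ((Complex.continuous_im.tendsto x).comp hlim) fun n => wlow (φ n)
    have hx : 0 < x.im := hc.trans_le hxim
    have hanti : Antitone fun n => dD (w n) (w (n + 1)) := antitone_nat_of_succ_le fun n => by
      have := Tle (w n) (w (n + 1)) (wpos n) (wpos _)
      rwa [← wsucc, ← wsucc] at this
    obtain ⟨l, hl⟩ : ∃ l, Tendsto (fun n => dD (w n) (w (n + 1))) atTop (nhds l) :=
      ⟨_, tendsto_atTop_ciInf hanti ⟨0, by rintro _ ⟨n, rfl⟩; exact dD_nonneg (wpos _) (wpos _)⟩⟩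
    have dcont : ∀ {u v : ℕ → ℂ} {a b : ℂ}, 0 < a.im → 0 < b.im → Tendsto u atTop (nhds a) →
        Tendsto v atTop (nhds b) → Tendsto (fun n => dD (u n) (v n)) atTop (nhds (dD a b)) := by
      intro u v a b ha hb hu hv
      unfold dD
      refine Tendsto.div ((hu.sub hv).norm.pow 2) ?_ (by positivity)
      exact ((Complex.continuous_im.tendsto a).comp hu).mul
        ((Complex.continuous_im.tendsto b).comp hv)
    have l1 : Tendsto (fun n => w (φ n + 1)) atTop (nhds (T x)) := by
      simp_rw [wsucc]; exact (Tcont x hx).tendsto.comp hlim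
    have l2 : Tendsto (fun n => w (φ n + 1 + 1)) atTop (nhds (T (T x))) := by
      simp_rw [wsucc (_ + 1)]; exact (Tcont _ (Tpos x hx)).tendsto.comp l1
    have m1 := tendsto_nhds_unique (dcont hx (Tpos x hx) hlim l1) (hl.comp hφ.tendsto_atTop)
    have m2 := tendsto_nhds_unique (dcont (Tpos x hx) (Tpos _ (Tpos x hx)) l1 l2)
      (hl.comp ((tendsto_add_atTop_nat 1).comp hφ.tendsto_atTop))
    refine ⟨x, hx, ?_⟩
    by_contra hne
    have := Tlt x (T x) hx (Tpos x hx) (Ne.symm hne)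
    linarith

/-- Lemma 4.2: for every z in the upper half-plane there exist unique points
z₁, z₂ ∈ ℂ⁺ with z = z₁ + z₂ − F_{μ₂}(z₂) and z = z₁ + z₂ − F_{μ₁}(z₁). -/
theorem additive_subordination_pointwise (μ₁ μ₂ : Measure ℝ)
    (h₁ : IsProbabilityMeasure μ₁) (h₂ : IsProbabilityMeasure μ₂)
    (z : ℂ) (hz : z ∈ upperHalf) :
    ∃! p : ℂ × ℂ, p.1 ∈ upperHalf ∧ p.2 ∈ upperHalf ∧
      z = p.1 + p.2 - recF μ₂ p.2 ∧ z = p.1 + p.2 - recF μ₁ p.1 := by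

  have hz' : 0 < z.im := hz
  have g1 := good_hH μ₁ z hz'
  have g2 := good_hH μ₂ z hz'
  obtain ⟨s, ⟨hs1, hs2⟩, hs3⟩ := (((hH_asymp μ₁ (ε := 1 / 20) (by norm_num)).and
    (hH_asymp μ₂ (ε := 1 / 20) (by norm_num))).and
    (eventually_gt_atTop (20 * z.im))).exists
  obtain ⟨p, hp, hdown⟩ := exists_down g1 g2 (s := s) (by linarith)
    (by simp only [Complex.add_im]; linarith) (by simp only [Complex.add_im]; linarith)
  obtain ⟨w, hw, hfix⟩ := fixed_exists g1 g2 hp hdown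
  refine ⟨(w, z + hH μ₁ w), ⟨hw, g1.im_pos hw, ?_, ?_⟩, ?_⟩
  · simp only [hH] at hfix ⊢
    linear_combination hfix
  · simp only [hH]; ring
  · rintro ⟨a, b⟩ ⟨ha, hb, e2, e1⟩
    simp only at ha hb e1 e2
    have hb1 : b = z + hH μ₁ a := by unfold hH; linear_combination -e1
    have ha1 : z + hH μ₂ (z + hH μ₁ a) = a := by
      rw [← hb1]; unfold hH; linear_combination e2
    have : a = w := fixed_unique g1 g2 ha hw ha1 hfix
    subst this
    rw [hb1]
end

section
/- Let μ₁ and μ₂ be measures in ℳ₊ and fix w ∈ ℂ⁺. Define, for z ∈ ℂ⁺, f₁(z) = w·K_{μ₁}(z)/z, f₂(z) = K_{μ₂}(f₁(z))/f₁(z), and f₃(z) = z/f₂(z) (these are well defined: for z ∈ ℂ⁺ one has K_{μ₁}(z) ≠ 0 and f₁(z) ∉ [0,∞), so K_{μ₂}(f₁(z)) is defined and nonzero). Then the function f₃ : ℂ⁺ → ℂ takes the value w precisely once in ℂ⁺; moreover, the unique point z ∈ ℂ⁺ with f₃(z) = w satisfies arg w ≤ arg z < π. -/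
open MeasureTheory Complex Filter Set

/-- The domain ℂ ∖ [0,∞). -/
def kreinDomain : Set ℂ := {z : ℂ | z.im ≠ 0 ∨ z.re < 0}

/-- The Krein class 𝒦: functions analytic on ℂ ∖ [0,∞), real-symmetric,
mapping ℂ⁺ into ℂ⁺ ∪ ℝ, real and nonpositive on (−∞,0), tending to 0 at 0 from the left. -/
def kreinClass (f : ℂ → ℂ) : Prop :=
  DifferentiableOn ℂ f kreinDomain ∧
  (∀ z ∈ kreinDomain, f (starRingEnd ℂ z) = starRingEnd ℂ (f z)) ∧
  (∀ z ∈ upperHalf, 0 ≤ (f z).im) ∧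
  (∀ x : ℝ, x < 0 → (f (x : ℂ)).im = 0 ∧ (f (x : ℂ)).re ≤ 0) ∧
  Filter.Tendsto (fun x : ℝ => f (-(x : ℂ))) (nhdsWithin 0 (Set.Ioi 0)) (nhds 0)

/-- The class ℳ₊ of Borel probability measures on [0,∞) with μ({0}) < 1. -/
def MPlus (μ : Measure ℝ) : Prop :=
  IsProbabilityMeasure μ ∧ μ (Set.Iio 0) = 0 ∧ μ {0} < 1

/-- ψ_μ(z) = ∫ zξ/(1 − zξ) dμ(ξ). -/
noncomputable def psiPlus (μ : Measure ℝ) (z : ℂ) : ℂ :=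
  ∫ t, (z * (t : ℂ)) / (1 - z * (t : ℂ)) ∂μ

/-- K_μ = ψ_μ/(1 + ψ_μ). -/
noncomputable def KPlus (μ : Measure ℝ) (z : ℂ) : ℂ :=
  psiPlus μ z / (1 + psiPlus μ z)


/-- A Poincaré–Miranda principle for holomorphic functions on a rectangle. -/
theorem rect_zero (F : ℂ → ℂ) (a b c d : ℝ) (hab : a < b) (hcd : c < d)
    (hF : ∀ x ∈ Icc a b, ∀ y ∈ Icc c d, DifferentiableAt ℂ F (x + y * I))
    (hbot : ∀ x ∈ Icc a b, (F (x + c * I)).im ≤ 0)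
    (htop : ∀ x ∈ Icc a b, 0 ≤ (F (x + d * I)).im)
    (hleft : ∀ y ∈ Icc c d, (F (a + y * I)).re ≤ 0)
    (hright : ∀ y ∈ Icc c d, 0 < (F (b + y * I)).re) :
    ∃ x ∈ Icc a b, ∃ y ∈ Icc c d, F (x + y * I) = 0 := by
  by_contra! hne
  have hd : ∀ x ∈ Icc a b, ∀ y ∈ Icc c d, DifferentiableAt ℂ (fun z => (F z)⁻¹) (x + y * I) :=
    fun x hx y hy => (hF x hx y hy).inv (hne x hx y hy)
  have key := Complex.integral_boundary_rect_eq_zero_of_differentiableOn (fun z => (F z)⁻¹)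
    (a + c * I) (b + d * I) (by
      intro z hz
      simp [Complex.mem_reProdIm, uIcc_of_le hab.le, uIcc_of_le hcd.le] at hz
      have := hd z.re hz.1 z.im hz.2
      rw [Complex.re_add_im] at this
      exact this.differentiableWithinAt)
  simp only [add_re, ofReal_re, mul_re, I_re, mul_zero, ofReal_im, I_im, mul_one, sub_self,
    add_zero, add_im, mul_im, zero_add] at key
  have ih : ∀ y ∈ Icc c d, IntervalIntegrable (fun x : ℝ => (F (x + y * I))⁻¹) volume a b := by
    intro y hy
    apply ContinuousOn.intervalIntegrable
    rw [uIcc_of_le hab.le]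
    intro x hx
    exact ((hd x hx y hy).continuousAt.comp (f := fun x : ℝ => (x : ℂ) + y * I)
      (by fun_prop)).continuousWithinAt
  have iv : ∀ x ∈ Icc a b, IntervalIntegrable (fun y : ℝ => (F (x + y * I))⁻¹) volume c d := by
    intro x hx
    apply ContinuousOn.intervalIntegrable
    rw [uIcc_of_le hcd.le]
    intro y hy
    exact ((hd x hx y hy).continuousAt.comp (f := fun y : ℝ => (x : ℂ) + y * I)
      (by fun_prop)).continuousWithinAt
  have ha : a ∈ Icc a b := left_mem_Icc.2 hab.le
  have hb : b ∈ Icc a b := right_mem_Icc.2 hab.le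
  have hc : c ∈ Icc c d := left_mem_Icc.2 hcd.le
  have hdd : d ∈ Icc c d := right_mem_Icc.2 hcd.le
  have e := congrArg Complex.im key
  simp only [smul_eq_mul, sub_im, add_im, mul_im, I_re, I_im, zero_mul, one_mul, zero_add,
    Complex.zero_im] at e
  have q1 := imCLM.intervalIntegral_comp_comm (ih c hc)
  have q2 := imCLM.intervalIntegral_comp_comm (ih d hdd)
  have q3 := reCLM.intervalIntegral_comp_comm (iv b hb)
  have q4 := reCLM.intervalIntegral_comp_comm (iv a ha)
  have i3 : IntervalIntegrable (fun y : ℝ => reCLM ((F (b + y * I))⁻¹)) volume c d :=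
    ⟨reCLM.integrable_comp (iv b hb).1, reCLM.integrable_comp (iv b hb).2⟩
  simp only [imCLM_apply, reCLM_apply] at q1 q2 q3 q4 i3
  rw [← q1, ← q2, ← q3, ← q4] at e
  have p1 : 0 ≤ ∫ x in a..b, ((F (x + c * I))⁻¹).im := by
    apply intervalIntegral.integral_nonneg hab.le
    intro x hx
    rw [inv_im]
    exact div_nonneg (by linarith [hbot x hx]) (normSq_nonneg _)
  have p2 : 0 ≤ ∫ x in a..b, -((F (x + d * I))⁻¹).im := by
    apply intervalIntegral.integral_nonneg hab.le
    intro x hx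
    rw [inv_im, neg_div, neg_neg]
    exact div_nonneg (by linarith [htop x hx]) (normSq_nonneg _)
  have p4 : 0 ≤ ∫ y in c..d, -((F (a + y * I))⁻¹).re := by
    apply intervalIntegral.integral_nonneg hcd.le
    intro y hy
    rw [inv_re, ← neg_div]
    exact div_nonneg (by linarith [hleft y hy]) (normSq_nonneg _)
  have p3 : 0 < ∫ y in c..d, ((F (b + y * I))⁻¹).re := by
    apply intervalIntegral.intervalIntegral_pos_of_pos_on i3 _ hcd
    intro y hy
    have hy' := Ioo_subset_Icc_self hy
    rw [inv_re]
    exact div_pos (hright y hy') (normSq_pos.2 (hne b hb y hy'))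
  rw [intervalIntegral.integral_neg] at p2 p4
  linarith

/-- A holomorphic self-map of the upper half-plane with two fixed points is the identity. -/
theorem fixed_unique_s12 (g : ℂ → ℂ) (hg : ∀ z : ℂ, 0 < z.im → DifferentiableAt ℂ g z)
    (hm : ∀ z : ℂ, 0 < z.im → 0 < (g z).im) (p q : ℂ) (hp : 0 < p.im) (hq : 0 < q.im)
    (gp : g p = p) (gq : g q = q) (hpq : p ≠ q) (z : ℂ) (hz : 0 < z.im) : g z = z := by
  set pc := (starRingEnd ℂ) p with hpc
  have hpcim : pc.im = -p.im := by simp [hpc]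
  have hpcre : pc.re = p.re := by simp [hpc]
  have hden : ∀ z : ℂ, 0 < z.im → z - pc ≠ 0 := by
    intro z hz h
    have := congrArg Complex.im h
    simp [hpcim] at this
    linarith
  -- Cayley transform and its inverse
  let C : ℂ → ℂ := fun z => (z - p) / (z - pc)
  let D : ℂ → ℂ := fun s => (p - pc * s) / (1 - s)
  have h1s : ∀ s : ℂ, ‖s‖ < 1 → 1 - s ≠ 0 := by
    intro s hs h
    have : s = 1 := by linear_combination -h
    simp [this] at hs
  have hCball : ∀ z : ℂ, 0 < z.im → ‖C z‖ < 1 := by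
    intro z hz
    simp only [C, norm_div]
    rw [div_lt_one (norm_pos_iff.2 (hden z hz))]
    rw [← sq_lt_sq₀ (norm_nonneg _) (norm_nonneg _), Complex.sq_norm, Complex.sq_norm,
      normSq_apply, normSq_apply]
    simp only [sub_re, sub_im, hpcre, hpcim]
    nlinarith [mul_pos hz hp]
  have hDC : ∀ z : ℂ, 0 < z.im → D (C z) = z := by
    intro z hz
    have h0 := h1s _ (hCball z hz)
    have h2 := hden z hz
    simp only [D]
    rw [div_eq_iff h0]
    simp only [C]
    field_simp
    ring
  have hDim : ∀ s : ℂ, ‖s‖ < 1 → 0 < (D s).im := by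
    intro s hs
    have h0 := h1s s hs
    have e : (D s).im = p.im * (1 - ‖s‖ ^ 2) / normSq (1 - s) := by
      simp only [D]
      rw [div_im, Complex.sq_norm, normSq_apply s]
      simp only [sub_im, sub_re, mul_im, mul_re, hpcre, hpcim, one_re, one_im]
      ring
    rw [e]
    have : ‖s‖ ^ 2 < 1 := by nlinarith [norm_nonneg s]
    exact div_pos (mul_pos hp (by linarith)) (normSq_pos.2 h0)
  let φ : ℂ → ℂ := fun s => C (g (D s))
  have hφ0 : φ 0 = 0 := by simp [φ, D, C, gp]
  have hφd : DifferentiableOn ℂ φ (Metric.ball 0 1) := by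
    intro s hs
    have hs' : ‖s‖ < 1 := by simpa using hs
    have hD : DifferentiableAt ℂ D s := by
      simp only [D]
      exact DifferentiableAt.div (by fun_prop) (by fun_prop) (h1s s hs')
    have hC : DifferentiableAt ℂ C (g (D s)) := by
      simp only [C]
      exact DifferentiableAt.div (by fun_prop) (by fun_prop) (hden _ (hm _ (hDim s hs')))
    have h3 := (hg _ (hDim s hs')).comp s hD
    exact (hC.comp s h3).differentiableWithinAt
  have hmaps : MapsTo φ (Metric.ball 0 1) (Metric.closedBall (φ 0) 1) := by
    intro s hs
    have hs' : ‖s‖ < 1 := by simpa using hs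
    rw [hφ0]
    simpa using (hCball _ (hm _ (hDim s hs'))).le
  have hs0 : C q ≠ 0 := by
    simp only [C]
    exact div_ne_zero (sub_ne_zero.2 hpq.symm) (hden q hq)
  have hφq : φ (C q) = C q := by simp only [φ]; rw [hDC q hq, gq]
  have hsl : dslope φ 0 (C q) = 1 := by
    rw [dslope_of_ne _ hs0, slope_def_field, hφq, hφ0]
    simp [hs0]
  have hE := Complex.affine_of_mapsTo_ball_of_norm_dslope_eq_div (R₁ := 1) (R₂ := 1) hφd hmaps
    (z₀ := C q) (by simpa using hCball q hq) (by simp [hsl])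
  have := hE (x := C z) (by simpa using hCball z hz)
  simp only [hsl, hφ0] at this
  simp only [φ, hDC z hz] at this
  rw [← hDC (g z) (hm z hz), this]
  simp [hDC z hz]

theorem sec_of_arg {α : ℝ} (hα : 0 < α) {z : ℂ} (hz : α ≤ z.arg) :
    Real.sin (α / 2) * (‖z‖ + z.re) ≤ Real.cos (α / 2) * z.im := by
  have hpi := Complex.arg_le_pi z
  have e1 : z.re = ‖z‖ * Real.cos z.arg := (Complex.norm_mul_cos_arg z).symm
  have e2 : z.im = ‖z‖ * Real.sin z.arg := (Complex.norm_mul_sin_arg z).symm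
  have e3 : z.arg = 2 * (z.arg / 2) := by ring
  have h1 : 0 ≤ Real.cos (z.arg / 2) :=
    Real.cos_nonneg_of_mem_Icc ⟨by linarith, by linarith⟩
  have h2 : 0 ≤ Real.sin (z.arg / 2 - α / 2) :=
    Real.sin_nonneg_of_nonneg_of_le_pi (by linarith) (by linarith)
  rw [e1, e2, e3, Real.cos_two_mul, Real.sin_two_mul]
  rw [Real.sin_sub] at h2
  have := mul_nonneg (mul_nonneg (norm_nonneg z) h1) h2
  nlinarith

theorem sec_lower {σ κ : ℝ} (hs : σ ^ 2 + κ ^ 2 = 1) {z : ℂ}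
    (hz : σ * (‖z‖ + z.re) ≤ κ * z.im) {t : ℝ} (ht : 0 ≤ t) :
    σ * (1 + ‖z‖ * t) ≤ ‖1 - z * t‖ := by
  have h1 : σ * (1 + ‖z‖ * t) ≤ σ * (1 - z.re * t) + κ * (z.im * t) := by
    nlinarith
  refine h1.trans ?_
  refine abs_le_of_sq_le_sq' ?_ (norm_nonneg _) |>.2
  rw [Complex.sq_norm, normSq_apply]
  simp
  nlinarith [sq_nonneg (κ * (1 - z.re * t) - σ * (z.im * t))]

theorem sec_pos {σ κ : ℝ} (hs : σ ^ 2 + κ ^ 2 = 1) (hσ : 0 < σ) {z : ℂ}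
    (hz : σ * (‖z‖ + z.re) ≤ κ * z.im) {t : ℝ} (ht : 0 ≤ t) :
    0 < ‖1 - z * t‖ :=
  lt_of_lt_of_le (by have := norm_nonneg z; positivity) (sec_lower hs hz ht)

theorem sec_upper (z : ℂ) {t : ℝ} (ht : 0 ≤ t) : ‖1 - z * t‖ ≤ 1 + ‖z‖ * t := by
  refine (norm_sub_le _ _).trans ?_
  simp [abs_of_nonneg ht]

/-- Lower bound for the rotated kernel `1/(1-zt)`. -/
theorem ker_one {σ κ : ℝ} (hs : σ ^ 2 + κ ^ 2 = 1) (hσ : 0 < σ) {z : ℂ}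
    (hz : σ * (‖z‖ + z.re) ≤ κ * z.im) {t : ℝ} (ht : 0 ≤ t) :
    σ * (1 + ‖z‖ * t)⁻¹ ≤ ((⟨σ, -κ⟩ : ℂ) * (1 - z * t)⁻¹).re := by
  have hp := sec_pos hs hσ hz ht
  have hN : 0 < normSq (1 - z * t) := normSq_pos.2 (norm_pos_iff.1 hp)
  have h1 : 0 < 1 + ‖z‖ * t := by have := norm_nonneg z; positivity
  have hle : normSq (1 - z * t) ≤ (1 + ‖z‖ * t) ^ 2 := by
    rw [← Complex.sq_norm]
    exact pow_le_pow_left₀ hp.le (sec_upper z ht) 2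
  have e : ((⟨σ, -κ⟩ : ℂ) * (1 - z * t)⁻¹).re
      = (σ * (1 - z.re * t) + κ * (z.im * t)) / normSq (1 - z * t) := by
    rw [mul_re, inv_re, inv_im]
    simp
    ring
  rw [e, le_div_iff₀ hN]
  calc σ * (1 + ‖z‖ * t)⁻¹ * normSq (1 - z * t)
      ≤ σ * (1 + ‖z‖ * t)⁻¹ * (1 + ‖z‖ * t) ^ 2 := by gcongr
    _ = σ * (1 + ‖z‖ * t) := by field_simp
    _ ≤ _ := by nlinarith

/-- Lower bound for the rotated kernel `zt/(1-zt)`. -/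
theorem ker_two {σ κ : ℝ} (hs : σ ^ 2 + κ ^ 2 = 1) (hσ : 0 < σ) {z : ℂ}
    (hz : σ * (‖z‖ + z.re) ≤ κ * z.im) {t : ℝ} (ht : 0 ≤ t) :
    σ * (‖z‖ * t * (1 + ‖z‖ * t)⁻¹) ≤ ((⟨-σ, -κ⟩ : ℂ) * (z * t / (1 - z * t))).re := by
  have hp := sec_pos hs hσ hz ht
  have hN : 0 < normSq (1 - z * t) := normSq_pos.2 (norm_pos_iff.1 hp)
  have h1 : 0 < 1 + ‖z‖ * t := by have := norm_nonneg z; positivity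
  have hle : normSq (1 - z * t) ≤ (1 + ‖z‖ * t) ^ 2 := by
    rw [← Complex.sq_norm]
    exact pow_le_pow_left₀ hp.le (sec_upper z ht) 2
  have hn : z.re ^ 2 + z.im ^ 2 = ‖z‖ ^ 2 := by
    rw [Complex.sq_norm, normSq_apply]; ring
  have e : ((⟨-σ, -κ⟩ : ℂ) * (z * t / (1 - z * t))).re
      = t * (-σ * z.re + κ * z.im + σ * t * ‖z‖ ^ 2) / normSq (1 - z * t) := by
    rw [← hn, mul_re, div_re, div_im]
    simp
    ring
  rw [e, le_div_iff₀ hN]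
  calc σ * (‖z‖ * t * (1 + ‖z‖ * t)⁻¹) * normSq (1 - z * t)
      ≤ σ * (‖z‖ * t * (1 + ‖z‖ * t)⁻¹) * (1 + ‖z‖ * t) ^ 2 := by gcongr
    _ = t * (σ * ‖z‖ + σ * t * ‖z‖ ^ 2) := by field_simp
    _ ≤ _ := by
      apply mul_le_mul_of_nonneg_left _ ht
      linarith

/-- Points of the Krein domain: kernel bound. -/
theorem krein_bound {z : ℂ} (hz : z ∈ kreinDomain) :
    ∃ δ > 0, ∀ t : ℝ, 0 ≤ t → δ * (1 + t) ≤ ‖1 - z * t‖ := by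
  have main : ∀ z : ℂ, 0 < z.arg → ∃ δ > 0, ∀ t : ℝ, 0 ≤ t → δ * (1 + t) ≤ ‖1 - z * t‖ := by
    intro z hz
    have hz0 : z ≠ 0 := by rintro rfl; simp at hz
    have hn := norm_pos_iff.2 hz0
    have hσ : 0 < Real.sin (z.arg / 2) :=
      Real.sin_pos_of_pos_of_lt_pi (by linarith) (by linarith [arg_le_pi z, Real.pi_pos])
    refine ⟨Real.sin (z.arg / 2) * min 1 ‖z‖, by positivity, fun t ht => ?_⟩
    refine le_trans ?_ (sec_lower (Real.sin_sq_add_cos_sq _) (sec_of_arg hz le_rfl) ht)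
    rw [mul_assoc]
    apply mul_le_mul_of_nonneg_left _ hσ.le
    nlinarith [min_le_left 1 ‖z‖, min_le_right 1 ‖z‖]
  by_cases h : 0 < z.arg
  · exact main z h
  · have hi : z.im < 0 := by
      by_contra! hi
      have h0 : z.arg = 0 := le_antisymm (not_lt.1 h) (arg_nonneg_iff.2 hi)
      rw [arg_eq_zero_iff] at h0
      rcases hz with hz | hz
      · exact hz h0.2
      · linarith [h0.1]
    have h1 : 0 < ((starRingEnd ℂ) z).arg := by
      have := arg_neg_iff.2 hi
      rw [arg_conj, if_neg (by linarith [Real.pi_pos])]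
      linarith
    obtain ⟨δ, hδ, hb⟩ := main _ h1
    refine ⟨δ, hδ, fun t ht => (hb t ht).trans_eq ?_⟩
    rw [← Complex.norm_conj]
    simp

/-- Working form of membership in ℳ₊. -/
structure Good_s12 (μ : Measure ℝ) : Prop where
  prob : IsProbabilityMeasure μ
  nn : ∀ᵐ t ∂μ, 0 ≤ t
  pos : 0 < μ (Ioi 0)

theorem MPlus.good {μ : Measure ℝ} (h : MPlus μ) : Good_s12 μ := by
  obtain ⟨h1, h2, h3⟩ := h
  refine ⟨h1, ?_, ?_⟩
  · rw [ae_iff]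
    convert h2 using 2
    ext t; simp
  · by_contra h4
    have h4 : μ (Ioi 0) = 0 := by simpa using h4
    have : μ univ ≤ μ (Iio 0) + μ {0} + μ (Ioi 0) := by
      have hu : (univ : Set ℝ) = Iio 0 ∪ {0} ∪ Ioi 0 := by
        ext t; rcases lt_trichotomy t 0 with h | h | h <;> simp [h]
      rw [hu]
      exact (measure_union_le _ _).trans (by gcongr; exact measure_union_le _ _)
    rw [h2, h4, measure_univ] at this
    simp at this
    exact absurd h3 (not_lt.2 this.ge)

/-- The transform `B(z) = ∫ 1/(1-zt)`. -/
noncomputable def Bf (μ : Measure ℝ) (z : ℂ) : ℂ := ∫ t, (1 - z * (t : ℂ))⁻¹ ∂μ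

theorem meas_ker (z : ℂ) : Measurable (fun t : ℝ => (1 - z * (t : ℂ))⁻¹) := by
  fun_prop

theorem integrable_ker {μ : Measure ℝ} (h : Good_s12 μ) {z : ℂ} (hz : z ∈ kreinDomain) :
    Integrable (fun t : ℝ => (1 - z * (t : ℂ))⁻¹) μ := by
  have := h.prob
  obtain ⟨δ, hδ, hb⟩ := krein_bound hz
  refine Integrable.of_bound (meas_ker z).aestronglyMeasurable δ⁻¹ ?_
  filter_upwards [h.nn] with t ht
  rw [norm_inv]
  exact inv_anti₀ hδ (by nlinarith [hb t ht])

theorem psi_eq {μ : Measure ℝ} (h : Good_s12 μ) {z : ℂ} (hz : z ∈ kreinDomain) :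
    psiPlus μ z = Bf μ z - 1 := by
  have := h.prob
  obtain ⟨δ, hδ, hb⟩ := krein_bound hz
  have : (1 : ℂ) = ∫ t : ℝ, (1 : ℂ) ∂μ := by simp
  rw [this, Bf, ← integral_sub (integrable_ker h hz) (integrable_const _), psiPlus]
  apply integral_congr_ae
  filter_upwards [h.nn] with t ht
  have : 1 - z * (t : ℂ) ≠ 0 := by
    rw [← norm_pos_iff]
    have := hb t ht
    have : 0 < δ * (1 + t) := by positivity
    linarith
  field_simp
  ring

theorem Bf_diff {μ : Measure ℝ} (h : Good_s12 μ) {z : ℂ} (hz : z ∈ kreinDomain) :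
    DifferentiableAt ℂ (Bf μ) z := by
  have := h.prob
  obtain ⟨δ, hδ, hb⟩ := krein_bound hz
  have hloc : ∀ x ∈ Metric.ball z (δ / 2), ∀ t : ℝ, 0 ≤ t → δ / 2 * (1 + t) ≤ ‖1 - x * t‖ := by
    intro x hx t ht
    have h1 := hb t ht
    have h2 : ‖1 - z * t‖ ≤ ‖1 - x * t‖ + ‖(x - z) * t‖ := by
      refine le_trans (le_of_eq ?_) (norm_add_le _ _)
      congr 1; ring
    rw [norm_mul, Complex.norm_real, Real.norm_of_nonneg ht] at h2
    have h3 : ‖x - z‖ < δ / 2 := by simpa [dist_eq_norm] using hx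
    nlinarith
  have := hasDerivAt_integral_of_dominated_loc_of_deriv_le (μ := μ) (𝕜 := ℂ)
    (F := fun (x : ℂ) (t : ℝ) => (1 - x * (t : ℂ))⁻¹)
    (F' := fun (x : ℂ) (t : ℝ) => (t : ℂ) / (1 - x * (t : ℂ)) ^ 2) (x₀ := z)
    (bound := fun _ => (δ / 2)⁻¹ ^ 2) (s := Metric.ball z (δ / 2))
    (Metric.ball_mem_nhds _ (by positivity))
    (Eventually.of_forall fun x => (meas_ker x).aestronglyMeasurable)
    (integrable_ker h hz)
    (Measurable.aestronglyMeasurable (by fun_prop)) ?_ (integrable_const _) ?_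
  · exact this.2.differentiableAt
  · filter_upwards [h.nn] with t ht x hx
    have h1 := hloc x hx t ht
    have h0 : 0 < δ / 2 * (1 + t) := by positivity
    rw [norm_div, norm_pow, Complex.norm_real, Real.norm_of_nonneg ht]
    rw [div_le_iff₀ (pow_pos (by linarith) 2)]
    calc t ≤ (1 + t) ^ 2 := by nlinarith
      _ = (δ / 2)⁻¹ ^ 2 * (δ / 2 * (1 + t)) ^ 2 := by field_simp
      _ ≤ _ := by gcongr
  · filter_upwards [h.nn] with t ht x hx
    have h1 := hloc x hx t ht
    have h0 : 0 < δ / 2 * (1 + t) := by positivity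
    have hne : 1 - x * (t : ℂ) ≠ 0 := by
      rw [← norm_pos_iff]; linarith
    have hd : HasDerivAt (fun x : ℂ => 1 - x * (t : ℂ)) (-(1 * (t : ℂ))) x :=
      ((hasDerivAt_id x).mul_const (t : ℂ)).const_sub 1
    have h3 := hd.fun_inv hne
    rwa [neg_neg, one_mul] at h3

theorem int_pos {μ : Measure ℝ} (h : Good_s12 μ) {f : ℝ → ℝ} (hf : Integrable f μ)
    (h0 : ∀ t, 0 ≤ t → 0 ≤ f t) (h1 : ∀ t, 0 < t → 0 < f t) : 0 < ∫ t, f t ∂μ := by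
  rw [integral_pos_iff_support_of_nonneg_ae _ hf]
  · exact h.pos.trans_le (measure_mono fun t ht => (h1 t ht).ne')
  · filter_upwards [h.nn] with t ht using h0 t ht

/-- Signs of `B` and `zB`. -/
theorem Bf_im {μ : Measure ℝ} (h : Good_s12 μ) {z : ℂ} (hz : z.im ≠ 0) :
    (∃ p > 0, (Bf μ z).im = z.im * p) ∧
    (∃ q, ‖Bf μ z‖ ^ 2 ≤ q ∧ (z * Bf μ z).im = z.im * q) := by
  have hpr := h.prob
  have hk : z ∈ kreinDomain := Or.inl hz
  have hi := integrable_ker h hk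
  obtain ⟨δ, hδ, hb⟩ := krein_bound hk
  have hne : ∀ t : ℝ, 0 ≤ t → 0 < normSq (1 - z * t) := by
    intro t ht
    rw [normSq_pos, ← norm_pos_iff]
    have := hb t ht
    have : 0 < δ * (1 + t) := by positivity
    linarith
  have hlow : ∀ t : ℝ, 0 ≤ t → (δ * (1 + t)) ^ 2 ≤ normSq (1 - z * t) := by
    intro t ht
    rw [← Complex.sq_norm]
    exact pow_le_pow_left₀ (by positivity) (hb t ht) 2
  constructor
  · refine ⟨∫ t : ℝ, t / normSq (1 - z * t) ∂μ, ?_, ?_⟩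
    · apply int_pos h
      · refine Integrable.of_bound (Measurable.aestronglyMeasurable ?_) (δ⁻¹ ^ 2) ?_
        · exact measurable_id.div (Complex.continuous_normSq.measurable.comp (by fun_prop))
        · filter_upwards [h.nn] with t ht
          rw [Real.norm_of_nonneg (div_nonneg ht (normSq_nonneg _)), div_le_iff₀ (hne t ht)]
          calc t ≤ (1 + t) ^ 2 := by nlinarith
            _ = δ⁻¹ ^ 2 * (δ * (1 + t)) ^ 2 := by field_simp
            _ ≤ _ := by gcongr; exact hlow t ht
      · intro t ht; exact div_nonneg ht (normSq_nonneg _)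
      · intro t ht; exact div_pos ht (hne t ht.le)
    · rw [← integral_const_mul]
      have := imCLM.integral_comp_comm hi
      simp only [imCLM_apply] at this
      rw [Bf, ← this]
      congr 1
      ext t
      rw [inv_im]
      simp
      ring
  · refine ⟨∫ t : ℝ, 1 / normSq (1 - z * t) ∂μ, ?_, ?_⟩
    · have h1 : ‖Bf μ z‖ ≤ ∫ t : ℝ, ‖(1 - z * (t : ℂ))⁻¹‖ ∂μ := norm_integral_le_integral_norm _
      have h2 := ConvexOn.map_integral_le (μ := μ) (s := univ)
        (f := fun t : ℝ => ‖(1 - z * (t : ℂ))⁻¹‖) (g := fun x : ℝ => x ^ 2)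
        (even_two.convexOn_pow) (by fun_prop) isClosed_univ (by simp) hi.norm ?_
      · refine (pow_le_pow_left₀ (norm_nonneg _) h1 2).trans (h2.trans (le_of_eq ?_))
        congr 1
        ext t
        rw [norm_inv, inv_pow, Complex.sq_norm, one_div]
      · refine Integrable.of_bound (Measurable.aestronglyMeasurable ?_) (δ⁻¹ ^ 2) ?_
        · exact ((meas_ker z).norm).pow_const 2
        · filter_upwards [h.nn] with t ht
          simp only [Function.comp_apply, norm_pow, norm_norm]
          gcongr
          rw [norm_inv]
          exact inv_anti₀ hδ (by nlinarith [hb t ht])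
    · rw [← integral_const_mul, Bf, ← integral_const_mul]
      have := imCLM.integral_comp_comm (hi.const_mul z)
      simp only [imCLM_apply] at this
      rw [← this]
      congr 1
      ext t
      rw [mul_im, inv_im, inv_re]
      simp
      ring

/-- Real version on the negative axis. -/
noncomputable def Qf (μ : Measure ℝ) (x : ℝ) : ℝ := ∫ t : ℝ, (1 + x * t)⁻¹ ∂μ

theorem Q_int {μ : Measure ℝ} (h : Good_s12 μ) {x : ℝ} (hx : 0 ≤ x) :
    Integrable (fun t : ℝ => (1 + x * t)⁻¹) μ := by
  have hpr := h.prob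
  refine Integrable.of_bound (Measurable.aestronglyMeasurable (by fun_prop)) 1 ?_
  filter_upwards [h.nn] with t ht
  have : 0 ≤ x * t := mul_nonneg hx ht
  rw [Real.norm_of_nonneg (by positivity)]
  exact inv_le_one_of_one_le₀ (by linarith)

theorem P_eq {μ : Measure ℝ} (h : Good_s12 μ) {x : ℝ} (hx : 0 ≤ x) :
    Integrable (fun t : ℝ => x * t * (1 + x * t)⁻¹) μ ∧
    1 - Qf μ x = ∫ t : ℝ, x * t * (1 + x * t)⁻¹ ∂μ := by
  have hpr := h.prob
  have e : (fun t : ℝ => 1 - (1 + x * t)⁻¹) =ᵐ[μ] (fun t : ℝ => x * t * (1 + x * t)⁻¹) := by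
    filter_upwards [h.nn] with t ht
    have : 0 ≤ x * t := mul_nonneg hx ht
    have : 1 + x * t ≠ 0 := by positivity
    field_simp
    ring
  constructor
  · exact ((integrable_const 1).sub (Q_int h hx)).congr e
  · rw [← integral_congr_ae e, integral_sub (integrable_const _) (Q_int h hx)]
    simp [Qf]

theorem Q_pos {μ : Measure ℝ} (h : Good_s12 μ) {x : ℝ} (hx : 0 ≤ x) : 0 < Qf μ x := by
  apply int_pos h (Q_int h hx)
  · intro t ht; positivity
  · intro t ht; positivity

theorem Q_lt {μ : Measure ℝ} (h : Good_s12 μ) {x : ℝ} (hx : 0 < x) : Qf μ x < 1 := by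
  have := int_pos h (P_eq h hx.le).1 (fun t ht => by positivity) (fun t ht => by positivity)
  rw [← (P_eq h hx.le).2] at this
  linarith

theorem Q_anti {μ : Measure ℝ} (h : Good_s12 μ) {x y : ℝ} (hx : 0 ≤ x) (hxy : x ≤ y) :
    Qf μ y ≤ Qf μ x := by
  apply integral_mono_ae (Q_int h (hx.trans hxy)) (Q_int h hx)
  filter_upwards [h.nn] with t ht
  have : 0 ≤ x * t := mul_nonneg hx ht
  exact inv_anti₀ (by positivity) (by nlinarith)

theorem Q_tendsto {μ : Measure ℝ} (h : Good_s12 μ) :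
    Tendsto (Qf μ) (nhdsWithin 0 (Ioi 0)) (nhds 1) := by
  have hpr := h.prob
  have := tendsto_integral_filter_of_dominated_convergence (μ := μ)
    (l := nhdsWithin (0 : ℝ) (Ioi 0))
    (F := fun (x : ℝ) (t : ℝ) => (1 + x * t)⁻¹) (f := fun _ => (1 : ℝ)) (fun _ => (1 : ℝ))
    (Eventually.of_forall fun x => Measurable.aestronglyMeasurable (by fun_prop)) ?_
    (integrable_const _) ?_
  · simp only [integral_const, probReal_univ, one_smul] at this
    exact this
  · filter_upwards [self_mem_nhdsWithin] with x hx
    have hx : 0 < x := hx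
    filter_upwards [h.nn] with t ht
    rw [Real.norm_of_nonneg (by positivity)]
    exact inv_le_one_of_one_le₀ (by nlinarith [mul_nonneg hx.le ht])
  · refine Eventually.of_forall fun t => ?_
    apply tendsto_nhdsWithin_of_tendsto_nhds
    have : ContinuousAt (fun x : ℝ => (1 + x * t)⁻¹) 0 := by
      apply ContinuousAt.inv₀ (by fun_prop) (by simp)
    simpa [ContinuousAt] using this

/-- `k(x) = -K(-x)`. -/
noncomputable def kf (μ : Measure ℝ) (x : ℝ) : ℝ := (1 - Qf μ x) / Qf μ x

theorem k_pos {μ : Measure ℝ} (h : Good_s12 μ) {x : ℝ} (hx : 0 < x) : 0 < kf μ x :=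
  div_pos (by linarith [Q_lt h hx]) (Q_pos h hx.le)

theorem k_mono {μ : Measure ℝ} (h : Good_s12 μ) {x y : ℝ} (hx : 0 ≤ x) (hxy : x ≤ y) :
    kf μ x ≤ kf μ y := by
  have h1 := Q_anti h hx hxy
  have h2 := Q_pos h (hx.trans hxy)
  have h3 := Q_pos h hx
  rw [kf, kf, div_le_div_iff₀ h3 h2]
  nlinarith

theorem k_tendsto {μ : Measure ℝ} (h : Good_s12 μ) :
    Tendsto (kf μ) (nhdsWithin 0 (Ioi 0)) (nhds 0) := by
  have := ((Q_tendsto h).const_sub 1).div (Q_tendsto h) one_ne_zero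
  simp only [sub_self, zero_div] at this
  exact this

theorem k_lower {μ : Measure ℝ} (h : Good_s12 μ) {x : ℝ} (hx : 0 < x) (hx1 : x ≤ 1) :
    x * (1 - Qf μ 1) ≤ kf μ x := by
  have h2 := Q_pos h hx.le
  have h3 := Q_lt h hx
  have h4 : x * (1 - Qf μ 1) ≤ 1 - Qf μ x := by
    rw [(P_eq h hx.le).2, (P_eq h zero_le_one).2, ← integral_const_mul]
    apply integral_mono_ae ((P_eq h zero_le_one).1.const_mul x) (P_eq h hx.le).1
    filter_upwards [h.nn] with t ht
    have : (1 + 1 * t)⁻¹ ≤ (1 + x * t)⁻¹ := inv_anti₀ (by positivity) (by nlinarith)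
    calc x * (1 * t * (1 + 1 * t)⁻¹) = x * t * (1 + 1 * t)⁻¹ := by ring
      _ ≤ _ := by gcongr
  rw [kf, le_div_iff₀ h2]
  nlinarith

theorem k_upper {μ : Measure ℝ} (h : Good_s12 μ) {x : ℝ} (hx : 1 ≤ x) :
    kf μ x ≤ x / Qf μ 1 := by
  have hx0 : 0 ≤ x := by linarith
  have h2 := Q_pos h hx0
  have h3 := Q_pos h zero_le_one
  have h4 : Qf μ 1 ≤ x * Qf μ x := by
    rw [Qf, Qf, ← integral_const_mul]
    apply integral_mono_ae (Q_int h zero_le_one) ((Q_int h hx0).const_mul x)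
    filter_upwards [h.nn] with t ht
    have : 0 ≤ x * t := mul_nonneg hx0 ht
    have a : 0 < 1 + x * t := by positivity
    have b : 0 < 1 + 1 * t := by positivity
    rw [← div_eq_mul_inv, inv_eq_one_div, div_le_div_iff₀ b a]
    nlinarith
  rw [kf, div_le_div_iff₀ h2 h3]
  nlinarith

theorem Bf_neg {μ : Measure ℝ} (x : ℝ) : Bf μ (-(x : ℂ)) = (Qf μ x : ℂ) := by
  rw [Bf, Qf, ← integral_complex_ofReal]
  congr 1
  ext t
  push_cast
  ring

theorem Bf_ne {μ : Measure ℝ} (h : Good_s12 μ) {z : ℂ} (hz : z ∈ kreinDomain) : Bf μ z ≠ 0 := by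
  by_cases hi : z.im = 0
  · have hr : z.re < 0 := by rcases hz with hz | hz; exacts [absurd hi hz, hz]
    have : z = -((-z.re : ℝ) : ℂ) := by apply Complex.ext <;> simp [hi]
    rw [this, Bf_neg]
    exact_mod_cast (Q_pos h (by linarith)).ne'
  · obtain ⟨⟨p, hp, e⟩, -⟩ := Bf_im h hi
    intro h0
    rw [h0] at e
    have : z.im * p ≠ 0 := mul_ne_zero hi hp.ne'
    exact this e.symm

theorem K_eq {μ : Measure ℝ} (h : Good_s12 μ) {z : ℂ} (hz : z ∈ kreinDomain) :
    KPlus μ z = 1 - (Bf μ z)⁻¹ := by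
  have := Bf_ne h hz
  rw [KPlus, psi_eq h hz]
  rw [add_sub_cancel, sub_div, div_self this, one_div]

theorem kreinDomain_open : IsOpen kreinDomain := by
  apply IsOpen.union
  · exact isOpen_ne.preimage Complex.continuous_im
  · exact isOpen_Iio.preimage Complex.continuous_re

theorem K_diff {μ : Measure ℝ} (h : Good_s12 μ) {z : ℂ} (hz : z ∈ kreinDomain) :
    DifferentiableAt ℂ (KPlus μ) z := by
  have h1 : DifferentiableAt ℂ (fun z => 1 - (Bf μ z)⁻¹) z :=
    ((Bf_diff h hz).inv (Bf_ne h hz)).const_sub 1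
  refine h1.congr_of_eventuallyEq ?_
  filter_upwards [kreinDomain_open.mem_nhds hz] with y hy using K_eq h hy

theorem krein_ne {z : ℂ} (hz : z ∈ kreinDomain) : z ≠ 0 := by
  rintro rfl
  simp [kreinDomain] at hz

/-- Signs of `K` and `K/z`. -/
theorem K_im {μ : Measure ℝ} (h : Good_s12 μ) {z : ℂ} (hz : z.im ≠ 0) :
    (∃ p > 0, (KPlus μ z).im = z.im * p) ∧ (∃ q ≥ 0, (KPlus μ z / z).im = z.im * q) := by
  have hk : z ∈ kreinDomain := Or.inl hz
  have hB := Bf_ne h hk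
  have hN : 0 < normSq (Bf μ z) := normSq_pos.2 hB
  have hz0 : 0 < normSq z := normSq_pos.2 (krein_ne hk)
  obtain ⟨⟨p, hp, e⟩, ⟨q, hq, e'⟩⟩ := Bf_im h hz
  rw [K_eq h hk]
  constructor
  · refine ⟨p / normSq (Bf μ z), div_pos hp hN, ?_⟩
    simp [inv_im, e]
    ring
  · refine ⟨(q - ‖Bf μ z‖ ^ 2) / (normSq (Bf μ z) * normSq z),
      div_nonneg (by linarith) (by positivity), ?_⟩
    rw [Complex.sq_norm]
    rw [mul_im] at e'
    rw [div_im]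
    simp only [sub_re, sub_im, inv_re, inv_im, one_re, one_im]
    have hNe := hN.ne'
    have hze := hz0.ne'
    field_simp
    linear_combination e'

theorem H_neg {μ : Measure ℝ} (h : Good_s12 μ) {z : ℂ} (hi : z.im = 0) (hr : z.re < 0) :
    (KPlus μ z / z).im = 0 ∧ 0 < (KPlus μ z / z).re := by
  have hk : z ∈ kreinDomain := Or.inr hr
  have e : z = -((-z.re : ℝ) : ℂ) := by apply Complex.ext <;> simp [hi]
  have hx : 0 < -z.re := by linarith
  have h1 := Q_pos h hx.le
  have h2 := Q_lt h hx
  have e2 : KPlus μ z / z = (((1 - (Qf μ (-z.re))⁻¹) / z.re : ℝ) : ℂ) := by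
    rw [K_eq h hk]
    conv_lhs => rw [e, Bf_neg]
    push_cast
    simp
  rw [e2]
  refine ⟨ofReal_im _, ?_⟩
  rw [ofReal_re]
  apply div_pos_of_neg_of_neg _ hr
  have := (one_lt_inv₀ h1).2 h2
  linarith

theorem sec_krein {σ κ : ℝ} (hσ : 0 < σ) {z : ℂ} (h0 : z ≠ 0)
    (hz : σ * (‖z‖ + z.re) ≤ κ * z.im) : z ∈ kreinDomain := by
  by_cases hi : z.im = 0
  · right
    rw [hi, mul_zero] at hz
    have := norm_pos_iff.2 h0
    by_contra! hr
    have : 0 < σ * (‖z‖ + z.re) := by positivity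
    linarith
  · exact Or.inl hi

/-- Two-sided bound for `K` on a sector. -/
theorem K_bounds {μ : Measure ℝ} (h : Good_s12 μ) {σ κ : ℝ} (hs : σ ^ 2 + κ ^ 2 = 1) (hσ : 0 < σ)
    {z : ℂ} (h0 : z ≠ 0) (hz : σ * (‖z‖ + z.re) ≤ κ * z.im) :
    σ ^ 2 * kf μ ‖z‖ ≤ ‖KPlus μ z‖ ∧ σ ^ 2 * ‖KPlus μ z‖ ≤ kf μ ‖z‖ := by
  have hpr := h.prob
  have hk := sec_krein hσ h0 hz
  have hn := norm_pos_iff.2 h0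
  have hQ := Q_pos h hn.le
  have hP : 0 < 1 - Qf μ ‖z‖ := by linarith [Q_lt h hn]
  have hi := integrable_ker h hk
  have hne : ∀ t : ℝ, 0 ≤ t → 1 - z * (t : ℂ) ≠ 0 :=
    fun t ht => norm_pos_iff.1 (sec_pos hs hσ hz ht)
  have hi2 : Integrable (fun t : ℝ => z * (t : ℂ) / (1 - z * (t : ℂ))) μ := by
    refine (hi.sub (integrable_const (1 : ℂ))).congr ?_
    filter_upwards [h.nn] with t ht
    have := hne t ht
    simp only [Pi.sub_apply]
    field_simp
    ring
  have inv_le : ∀ t : ℝ, 0 ≤ t → ‖1 - z * (t : ℂ)‖⁻¹ ≤ σ⁻¹ * (1 + ‖z‖ * t)⁻¹ := by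
    intro t ht
    rw [← mul_inv]
    exact inv_anti₀ (by positivity) (sec_lower hs hz ht)
  have b1 : ‖Bf μ z‖ ≤ σ⁻¹ * Qf μ ‖z‖ := by
    refine (norm_integral_le_integral_norm _).trans ?_
    rw [Qf, ← integral_const_mul]
    apply integral_mono_ae hi.norm ((Q_int h hn.le).const_mul _)
    filter_upwards [h.nn] with t ht
    rw [norm_inv]
    exact inv_le t ht
  have b2 : ‖psiPlus μ z‖ ≤ σ⁻¹ * (1 - Qf μ ‖z‖) := by
    refine (norm_integral_le_integral_norm _).trans ?_
    rw [(P_eq h hn.le).2, ← integral_const_mul]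
    apply integral_mono_ae hi2.norm ((P_eq h hn.le).1.const_mul _)
    filter_upwards [h.nn] with t ht
    rw [norm_div, norm_mul, Complex.norm_real, Real.norm_of_nonneg ht, div_eq_mul_inv]
    have := inv_le t ht
    calc ‖z‖ * t * ‖1 - z * (t : ℂ)‖⁻¹ ≤ ‖z‖ * t * (σ⁻¹ * (1 + ‖z‖ * t)⁻¹) := by gcongr
      _ = _ := by ring
  have nu : ‖(⟨σ, -κ⟩ : ℂ)‖ = 1 := by
    rw [← sq_eq_sq₀ (norm_nonneg _) zero_le_one, Complex.sq_norm, normSq_apply]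
    simp; linarith
  have nv : ‖(⟨-σ, -κ⟩ : ℂ)‖ = 1 := by
    rw [← sq_eq_sq₀ (norm_nonneg _) zero_le_one, Complex.sq_norm, normSq_apply]
    simp; linarith
  have b3 : σ * Qf μ ‖z‖ ≤ ‖Bf μ z‖ := by
    have e := reCLM.integral_comp_comm (hi.const_mul (⟨σ, -κ⟩ : ℂ))
    simp only [reCLM_apply] at e
    rw [integral_const_mul] at e
    have : σ * Qf μ ‖z‖ ≤ ((⟨σ, -κ⟩ : ℂ) * Bf μ z).re := by
      rw [Bf, ← e, Qf, ← integral_const_mul]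
      apply integral_mono_ae ((Q_int h hn.le).const_mul _)
        (reCLM.integrable_comp (hi.const_mul (⟨σ, -κ⟩ : ℂ)))
      filter_upwards [h.nn] with t ht
      exact ker_one hs hσ hz ht
    refine this.trans ((re_le_norm _).trans ?_)
    rw [norm_mul, nu, one_mul]
  have b4 : σ * (1 - Qf μ ‖z‖) ≤ ‖psiPlus μ z‖ := by
    have e := reCLM.integral_comp_comm (hi2.const_mul (⟨-σ, -κ⟩ : ℂ))
    simp only [reCLM_apply] at e
    rw [integral_const_mul] at e
    have : σ * (1 - Qf μ ‖z‖) ≤ ((⟨-σ, -κ⟩ : ℂ) * psiPlus μ z).re := by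
      rw [psiPlus, ← e, (P_eq h hn.le).2, ← integral_const_mul]
      apply integral_mono_ae ((P_eq h hn.le).1.const_mul _)
        (reCLM.integrable_comp (hi2.const_mul (⟨-σ, -κ⟩ : ℂ)))
      filter_upwards [h.nn] with t ht
      exact ker_two hs hσ hz ht
    refine this.trans ((re_le_norm _).trans ?_)
    rw [norm_mul, nv, one_mul]
  have eK : ‖KPlus μ z‖ = ‖psiPlus μ z‖ / ‖Bf μ z‖ := by
    rw [KPlus, norm_div]
    congr 2
    rw [psi_eq h hk]; ring
  have hB : 0 < ‖Bf μ z‖ := norm_pos_iff.2 (Bf_ne h hk)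
  rw [eK, kf, ← mul_div_assoc, ← mul_div_assoc]
  have b1' : σ * ‖Bf μ z‖ ≤ Qf μ ‖z‖ := by
    rwa [inv_mul_eq_div, le_div_iff₀ hσ, mul_comm] at b1
  have b2' : σ * ‖psiPlus μ z‖ ≤ 1 - Qf μ ‖z‖ := by
    rwa [inv_mul_eq_div, le_div_iff₀ hσ, mul_comm] at b2
  constructor
  · rw [div_le_div_iff₀ hQ hB]
    calc σ ^ 2 * (1 - Qf μ ‖z‖) * ‖Bf μ z‖ = (σ * (1 - Qf μ ‖z‖)) * (σ * ‖Bf μ z‖) := by ring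
      _ ≤ _ := by gcongr
  · rw [div_le_div_iff₀ hB hQ]
    calc σ ^ 2 * ‖psiPlus μ z‖ * Qf μ ‖z‖ = (σ * ‖psiPlus μ z‖) * (σ * Qf μ ‖z‖) := by ring
      _ ≤ _ := by gcongr

theorem cross_eq (w z : ℂ) :
    w.re * z.im - w.im * z.re = ‖w‖ * ‖z‖ * Real.sin (z.arg - w.arg) := by
  rw [Real.sin_sub]
  conv_lhs => rw [← Complex.norm_mul_cos_arg w, ← Complex.norm_mul_sin_arg w,
    ← Complex.norm_mul_cos_arg z, ← Complex.norm_mul_sin_arg z]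
  ring

theorem arg_pos_of_im {w : ℂ} (hw : 0 < w.im) : 0 < w.arg := by
  refine lt_of_le_of_ne (arg_nonneg_iff.2 hw.le) fun h => ?_
  exact hw.ne' (arg_eq_zero_iff.1 h.symm).2

theorem arg_lt_of_im {w : ℂ} (hw : 0 < w.im) : w.arg < Real.pi := by
  refine lt_of_le_of_ne (arg_le_pi w) fun h => ?_
  exact hw.ne' (arg_eq_pi_iff.1 h).2

theorem cross_of_arg {w z : ℂ} (hw : 0 < w.im) (h : w.arg ≤ z.arg) :
    0 ≤ w.re * z.im - w.im * z.re := by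
  rw [cross_eq]
  have := arg_pos_of_im hw
  have := arg_le_pi z
  exact mul_nonneg (by positivity) (Real.sin_nonneg_of_nonneg_of_le_pi (by linarith) (by linarith))

theorem arg_of_cross {w z : ℂ} (hw : 0 < w.im) (hz : 0 < z.im)
    (h : 0 ≤ w.re * z.im - w.im * z.re) : w.arg ≤ z.arg := by
  by_contra! hlt
  have h1 := arg_lt_of_im hw
  have h2 := arg_pos_of_im hz
  have h3 : Real.sin (z.arg - w.arg) < 0 :=
    Real.sin_neg_of_neg_of_neg_pi_lt (by linarith) (by linarith)
  have hwn : 0 < ‖w‖ := norm_pos_iff.2 (by rintro rfl; simp at hw)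
  have hzn : 0 < ‖z‖ := norm_pos_iff.2 (by rintro rfl; simp at hz)
  rw [cross_eq] at h
  have := mul_neg_of_pos_of_neg (mul_pos hwn hzn) h3
  linarith

theorem alg_upper {f h w : ℂ} (hf : 0 < f.im) (hh : 0 ≤ h.im) (hfh : 0 < (f * h).im)
    (hw : 0 < w.im) (hc : 0 ≤ w.re * f.im - w.im * f.re) : 0 < (w * h).im := by
  rw [mul_im] at *
  have h1 : 0 < f.im * (w.re * h.im + w.im * h.re) := by
    nlinarith [mul_nonneg hc hh, mul_pos hw hfh]
  exact (mul_pos_iff_of_pos_left hf).1 h1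

theorem alg_lower {f h w : ℂ} (hf : f.im < 0) (hh : h.im ≤ 0) (hfh : (f * h).im < 0)
    (hw : 0 < w.im) (hc : 0 ≤ w.re * f.im - w.im * f.re) : 0 < (w * h).im := by
  rw [mul_im] at *
  have h1 : f.im * (w.re * h.im + w.im * h.re) < 0 := by
    nlinarith [mul_nonneg hc (neg_nonneg.2 hh), mul_pos hw (neg_pos.2 hfh)]
  exact (pos_iff_pos_of_mul_pos (a := -f.im) (by linarith)).1 (by linarith)

theorem cross_mul (w h : ℂ) : w.re * (w * h).im - w.im * (w * h).re = normSq w * h.im := by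
  rw [mul_im, mul_re, normSq_apply]; ring

/-- One step: `z ↦ w K(z)/z` maps the closed sector into its part in the upper half-plane. -/
theorem step {μ : Measure ℝ} (h : Good_s12 μ) {w z : ℂ} (hw : 0 < w.im) (hz : w.arg ≤ z.arg) :
    0 < (w * (KPlus μ z / z)).im ∧ w.arg ≤ (w * (KPlus μ z / z)).arg := by
  have ha := (arg_pos_of_im hw).trans_le hz
  have hi : 0 ≤ z.im := arg_nonneg_iff.1 ha.le
  have hc := cross_of_arg hw hz
  have main : 0 < (w * (KPlus μ z / z)).im ∧ 0 ≤ (KPlus μ z / z).im := by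
    rcases hi.lt_or_eq with hi | hi
    · obtain ⟨⟨p, hp, e1⟩, ⟨q, hq, e2⟩⟩ := K_im h hi.ne'
      have hz0 : z ≠ 0 := by rintro rfl; simp at hi
      have e3 : 0 ≤ (KPlus μ z / z).im := by rw [e2]; positivity
      refine ⟨alg_upper hi e3 ?_ hw hc, e3⟩
      rw [mul_div_cancel₀ _ hz0, e1]; positivity
    · have hr : z.re < 0 := by
        by_contra! hr
        exact ha.ne' (arg_eq_zero_iff.2 ⟨hr, hi.symm⟩)
      obtain ⟨e1, e2⟩ := H_neg h hi.symm hr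
      refine ⟨?_, e1.ge⟩
      rw [mul_im, e1]
      have := mul_pos hw e2
      linarith
  refine ⟨main.1, arg_of_cross hw main.1 ?_⟩
  rw [cross_mul]
  exact mul_nonneg (normSq_nonneg _) main.2

theorem im_krein {z : ℂ} (hz : 0 < z.im) : z ∈ kreinDomain := Or.inl hz.ne'

theorem arg_krein {w z : ℂ} (hw : 0 < w.im) (hz : w.arg ≤ z.arg) : z ∈ kreinDomain := by
  have ha := (arg_pos_of_im hw).trans_le hz
  by_cases hi : z.im = 0
  · right
    by_contra! hr
    exact ha.ne' (arg_eq_zero_iff.2 ⟨hr, hi⟩)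
  · exact Or.inl hi

noncomputable def ff (μ : Measure ℝ) (w z : ℂ) : ℂ := w * (KPlus μ z / z)

noncomputable def gg (μ₁ μ₂ : Measure ℝ) (w z : ℂ) : ℂ := ff μ₂ w (ff μ₁ w z)

theorem ff_diff {μ : Measure ℝ} (h : Good_s12 μ) (w : ℂ) {z : ℂ} (hz : z ∈ kreinDomain) :
    DifferentiableAt ℂ (ff μ w) z :=
  ((K_diff h hz).div differentiableAt_id (krein_ne hz)).const_mul w

theorem ff_krein {μ : Measure ℝ} (h : Good_s12 μ) {w z : ℂ} (hw : 0 < w.im) (hz : 0 < z.im) :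
    ff μ w z ∈ kreinDomain ∧ 0 ≤ w.re * (ff μ w z).im - w.im * (ff μ w z).re := by
  obtain ⟨⟨p, hp, e1⟩, ⟨q, hq, e2⟩⟩ := K_im h hz.ne'
  have hc : 0 ≤ w.re * (ff μ w z).im - w.im * (ff μ w z).re := by
    rw [ff, cross_mul, e2]
    have := normSq_nonneg w
    positivity
  refine ⟨?_, hc⟩
  have hz0 : z ≠ 0 := by rintro rfl; simp at hz
  have hw0 : w ≠ 0 := by rintro rfl; simp at hw
  have hK : KPlus μ z ≠ 0 := by
    intro h0
    rw [h0] at e1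
    have : z.im * p ≠ 0 := mul_ne_zero hz.ne' hp.ne'
    exact this e1.symm
  have hne : ff μ w z ≠ 0 := mul_ne_zero hw0 (div_ne_zero hK hz0)
  by_cases hi : (ff μ w z).im = 0
  · right
    rw [hi] at hc
    have h1 : (ff μ w z).re ≤ 0 := by
      by_contra! h1
      have := mul_pos hw h1
      linarith
    refine lt_of_le_of_ne h1 fun h2 => hne (Complex.ext h2 hi)
  · exact Or.inl hi

theorem gg_maps {μ₁ μ₂ : Measure ℝ} (h₁ : Good_s12 μ₁) (h₂ : Good_s12 μ₂) {w z : ℂ} (hw : 0 < w.im)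
    (hz : 0 < z.im) : 0 < (gg μ₁ μ₂ w z).im := by
  obtain ⟨hk, hc⟩ := ff_krein h₁ hw hz
  rw [gg]
  set f := ff μ₁ w z
  have hf0 := krein_ne hk
  rw [ff]
  rcases lt_trichotomy f.im 0 with hi | hi | hi
  · obtain ⟨⟨p, hp, e1⟩, ⟨q, hq, e2⟩⟩ := K_im h₂ hi.ne
    refine alg_lower hi ?_ ?_ hw hc
    · rw [e2]; exact mul_nonpos_of_nonpos_of_nonneg hi.le hq
    · rw [mul_div_cancel₀ _ hf0, e1]; exact mul_neg_of_neg_of_pos hi hp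
  · have hr : f.re < 0 := by rcases hk with hk | hk; exacts [absurd hi hk, hk]
    obtain ⟨e1, e2⟩ := H_neg h₂ hi hr
    rw [mul_im, e1]
    have := mul_pos hw e2
    linarith
  · obtain ⟨⟨p, hp, e1⟩, ⟨q, hq, e2⟩⟩ := K_im h₂ hi.ne'
    refine alg_upper hi ?_ ?_ hw hc
    · rw [e2]; positivity
    · rw [mul_div_cancel₀ _ hf0, e1]; positivity

/-- Fixed points lie in the sector. -/
theorem fixed_arg {μ₁ μ₂ : Measure ℝ} (h₁ : Good_s12 μ₁) (h₂ : Good_s12 μ₂) {w z : ℂ} (hw : 0 < w.im)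
    (hz : 0 < z.im) (hg : gg μ₁ μ₂ w z = z) : 0 ≤ w.re * z.im - w.im * z.re := by
  obtain ⟨hk, hc⟩ := ff_krein h₁ hw hz
  have hw0 : w ≠ 0 := by rintro rfl; simp at hw
  have hz0 : z ≠ 0 := by rintro rfl; simp at hz
  have hf0 := krein_ne hk
  have hg' := hg
  rw [gg] at hg
  have hf : ff μ₁ w z = w * (KPlus μ₁ z / z) := rfl
  set f := ff μ₁ w z
  rw [ff] at hg
  have hKK : KPlus μ₁ z = KPlus μ₂ f := by
    have a : w * KPlus μ₂ f = z * f := by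
      rw [← hg]; field_simp
    have b : w * KPlus μ₁ z = z * f := by
      rw [hf]; field_simp
    exact mul_left_cancel₀ hw0 (b.trans a.symm)
  obtain ⟨⟨p, hp, e1⟩, -⟩ := K_im h₁ hz.ne'
  have hKpos : 0 < (KPlus μ₂ f).im := by rw [← hKK, e1]; positivity
  have key : 0 ≤ (KPlus μ₂ f / f).im := by
    by_cases hi : f.im = 0
    · have hr : f.re < 0 := by rcases hk with hk | hk; exacts [absurd hi hk, hk]
      exact (H_neg h₂ hi hr).1.ge
    · obtain ⟨⟨p, hp, e1⟩, ⟨q, hq, e2⟩⟩ := K_im h₂ hi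
      rw [e1] at hKpos
      have : 0 < f.im := (pos_iff_pos_of_mul_pos hKpos).2 hp
      rw [e2]; positivity
  rw [← hg, cross_mul]
  exact mul_nonneg (normSq_nonneg _) key

theorem sec_data {w : ℂ} (hw : 0 < w.im) : 0 < Real.sin (w.arg / 2) :=
  Real.sin_pos_of_pos_of_lt_pi (by linarith [arg_pos_of_im hw])
    (by linarith [arg_lt_of_im hw, Real.pi_pos])

theorem K_sec {μ : Measure ℝ} (h : Good_s12 μ) {w z : ℂ} (hw : 0 < w.im) (hz : w.arg ≤ z.arg) :
    Real.sin (w.arg / 2) ^ 2 * kf μ ‖z‖ ≤ ‖KPlus μ z‖ ∧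
      Real.sin (w.arg / 2) ^ 2 * ‖KPlus μ z‖ ≤ kf μ ‖z‖ :=
  K_bounds h (Real.sin_sq_add_cos_sq _) (sec_data hw) (krein_ne (arg_krein hw hz))
    (sec_of_arg (arg_pos_of_im hw) hz)

theorem gg_norm {μ₁ μ₂ : Measure ℝ} (h₁ : Good_s12 μ₁) {w z : ℂ} (hw : 0 < w.im)
    (hz : w.arg ≤ z.arg) :
    0 < ‖KPlus μ₁ z‖ ∧ ‖ff μ₁ w z‖ = ‖w‖ * ‖KPlus μ₁ z‖ / ‖z‖ ∧
    ‖gg μ₁ μ₂ w z‖ * ‖KPlus μ₁ z‖ = ‖z‖ * ‖KPlus μ₂ (ff μ₁ w z)‖ := by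
  have hk := arg_krein hw hz
  have hz0 := krein_ne hk
  have hzn := norm_pos_iff.2 hz0
  have hw0 : w ≠ 0 := by rintro rfl; simp at hw
  have hwn := norm_pos_iff.2 hw0
  have hK : 0 < ‖KPlus μ₁ z‖ :=
    lt_of_lt_of_le (mul_pos (pow_pos (sec_data hw) 2) (k_pos h₁ hzn)) (K_sec h₁ hw hz).1
  have e : ‖ff μ₁ w z‖ = ‖w‖ * ‖KPlus μ₁ z‖ / ‖z‖ := by
    rw [ff, norm_mul, norm_div, mul_div_assoc]
  refine ⟨hK, e, ?_⟩
  rw [gg, ff, norm_mul, norm_div, e]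
  field_simp

theorem small_radius {μ₁ μ₂ : Measure ℝ} (h₁ : Good_s12 μ₁) (h₂ : Good_s12 μ₂) {w : ℂ} (hw : 0 < w.im) :
    ∃ r, 0 < r ∧ r < 1 ∧ ∀ z : ℂ, w.arg ≤ z.arg → ‖z‖ = r → ‖z‖ < ‖gg μ₁ μ₂ w z‖ := by
  have hw0 : w ≠ 0 := by rintro rfl; simp at hw
  have hwn := norm_pos_iff.2 hw0
  have hσ := sec_data hw
  set s := Real.sin (w.arg / 2) ^ 2 with hs
  have hs0 : 0 < s := pow_pos hσ 2
  have hQ : 0 < 1 - Qf μ₁ 1 := by linarith [Q_lt h₁ one_pos]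
  set δ := ‖w‖ * s * (1 - Qf μ₁ 1) with hδ
  have hδ0 : 0 < δ := by positivity
  have hk2 := k_pos h₂ hδ0
  have ev : ∀ᶠ x in nhdsWithin (0 : ℝ) (Ioi 0), kf μ₁ x < s * (s * kf μ₂ δ) :=
    (k_tendsto h₁).eventually_lt_const (by positivity)
  have ev2 : ∀ᶠ x in nhdsWithin (0 : ℝ) (Ioi 0), x < 1 :=
    nhdsWithin_le_nhds (Iio_mem_nhds one_pos)
  obtain ⟨r, hr1, hr2, hr0⟩ := (ev.and (ev2.and self_mem_nhdsWithin)).exists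
  have hr0 : 0 < r := hr0
  refine ⟨r, hr0, hr2, fun z hz hzr => ?_⟩
  obtain ⟨hK, ef, eg⟩ := gg_norm (μ₂ := μ₂) h₁ hw hz
  have b1 := K_sec h₁ hw hz
  have b2 := K_sec h₂ hw (step h₁ hw hz).2
  rw [← ff] at b2
  rw [hzr] at b1 ef eg
  have hf : δ ≤ ‖ff μ₁ w z‖ := by
    rw [ef, le_div_iff₀ hr0, hδ]
    have := k_lower h₁ hr0 hr2.le
    calc ‖w‖ * s * (1 - Qf μ₁ 1) * r = ‖w‖ * (s * (r * (1 - Qf μ₁ 1))) := by ring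
      _ ≤ ‖w‖ * (s * kf μ₁ r) := by gcongr
      _ ≤ _ := by gcongr; exact b1.1
  have hm := k_mono h₂ hδ0.le hf
  have lt : ‖KPlus μ₁ z‖ < ‖KPlus μ₂ (ff μ₁ w z)‖ := by
    have c1 : s * ‖KPlus μ₁ z‖ < s * (s * kf μ₂ δ) := lt_of_le_of_lt b1.2 hr1
    have c2 := lt_of_mul_lt_mul_left c1 hs0.le
    refine c2.trans_le (le_trans ?_ b2.1)
    gcongr
  rw [hzr]
  refine lt_of_mul_lt_mul_right (a := ‖KPlus μ₁ z‖) ?_ hK.le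
  rw [eg]
  exact mul_lt_mul_of_pos_left lt hr0

theorem large_radius {μ₁ μ₂ : Measure ℝ} (h₁ : Good_s12 μ₁) (h₂ : Good_s12 μ₂) {w : ℂ} (hw : 0 < w.im) :
    ∃ R, 1 ≤ R ∧ ∀ z : ℂ, w.arg ≤ z.arg → ‖z‖ = R → ‖gg μ₁ μ₂ w z‖ < ‖z‖ := by
  have hw0 : w ≠ 0 := by rintro rfl; simp at hw
  have hwn := norm_pos_iff.2 hw0
  have hσ := sec_data hw
  set s := Real.sin (w.arg / 2) ^ 2 with hs
  have hs0 : 0 < s := pow_pos hσ 2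
  -- it suffices to control `k₂` at a bound for `‖f‖`
  have main : ∀ R M : ℝ, 1 ≤ R → 0 < M → ‖w‖ * kf μ₁ R / (s * R) ≤ M →
      kf μ₂ M < s * (s * kf μ₁ R) →
      ∀ z : ℂ, w.arg ≤ z.arg → ‖z‖ = R → ‖gg μ₁ μ₂ w z‖ < ‖z‖ := by
    intro R M hR hM hb hlt z hz hzr
    have hR0 : 0 < R := by linarith
    obtain ⟨hK, ef, eg⟩ := gg_norm (μ₂ := μ₂) h₁ hw hz
    have b1 := K_sec h₁ hw hz
    have b2 := K_sec h₂ hw (step h₁ hw hz).2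
    rw [← ff] at b2
    rw [hzr] at b1 ef eg
    have hf : ‖ff μ₁ w z‖ ≤ M := by
      refine le_trans ?_ hb
      rw [ef, div_le_div_iff₀ hR0 (by positivity)]
      calc ‖w‖ * ‖KPlus μ₁ z‖ * (s * R) = ‖w‖ * (s * ‖KPlus μ₁ z‖) * R := by ring
        _ ≤ ‖w‖ * kf μ₁ R * R := by gcongr; exact b1.2
    have hm := k_mono h₂ (norm_nonneg _) hf
    have lt : ‖KPlus μ₂ (ff μ₁ w z)‖ < ‖KPlus μ₁ z‖ := by
      have c1 : s * ‖KPlus μ₂ (ff μ₁ w z)‖ < s * (s * kf μ₁ R) :=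
        lt_of_le_of_lt (b2.2.trans hm) hlt
      exact (lt_of_mul_lt_mul_left c1 hs0.le).trans_le b1.1
    rw [hzr]
    refine lt_of_mul_lt_mul_right (a := ‖KPlus μ₁ z‖) ?_ hK.le
    rw [eg]
    exact mul_lt_mul_of_pos_left lt hR0
  have hQ := Q_pos h₁ zero_le_one
  by_cases hbd : ∃ N, ∀ x, 1 ≤ x → kf μ₁ x ≤ N
  · obtain ⟨N, hN⟩ := hbd
    have hk1 := k_pos h₁ one_pos
    have hN0 : 0 < N := hk1.trans_le (hN 1 le_rfl)
    have ev : ∀ᶠ x in nhdsWithin (0 : ℝ) (Ioi 0), kf μ₂ x < s * (s * kf μ₁ 1) :=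
      (k_tendsto h₂).eventually_lt_const (by positivity)
    obtain ⟨M, hM1, hM0⟩ := (ev.and self_mem_nhdsWithin).exists
    have hM0 : 0 < M := hM0
    refine ⟨max 1 (‖w‖ * N / (s * M)), le_max_left _ _, ?_⟩
    have hR : 1 ≤ max 1 (‖w‖ * N / (s * M)) := le_max_left _ _
    have hR2 : ‖w‖ * N / (s * M) ≤ max 1 (‖w‖ * N / (s * M)) := le_max_right _ _
    set R := max 1 (‖w‖ * N / (s * M))
    have hR0 : 0 < R := by linarith
    apply main R M hR hM0
    · rw [div_le_iff₀ (by positivity)] at hR2 ⊢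
      calc ‖w‖ * kf μ₁ R ≤ ‖w‖ * N := by gcongr; exact hN R hR
        _ ≤ R * (s * M) := hR2
        _ = _ := by ring
    · refine hM1.trans_le ?_
      have := k_mono h₁ zero_le_one hR
      gcongr
  · push Not at hbd
    set M := ‖w‖ / (s * Qf μ₁ 1) with hM
    have hM0 : 0 < M := by positivity
    obtain ⟨R, hR, hR2⟩ := hbd (kf μ₂ M / (s * s))
    have hR0 : 0 < R := by linarith
    refine ⟨R, hR, main R M hR hM0 ?_ ?_⟩
    · have := k_upper h₁ hR
      rw [le_div_iff₀ hQ] at this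
      rw [hM, div_le_div_iff₀ (by positivity) (by positivity)]
      calc ‖w‖ * kf μ₁ R * (s * Qf μ₁ 1) = ‖w‖ * s * (kf μ₁ R * Qf μ₁ 1) := by ring
        _ ≤ ‖w‖ * s * R := by gcongr
        _ = _ := by ring
    · rw [div_lt_iff₀ (by positivity)] at hR2
      linarith

theorem exists_fixed {μ₁ μ₂ : Measure ℝ} (h₁ : Good_s12 μ₁) (h₂ : Good_s12 μ₂) {w : ℂ} (hw : 0 < w.im) :
    ∃ z : ℂ, 0 < z.im ∧ gg μ₁ μ₂ w z = z := by
  obtain ⟨r, hr0, hr1, hr⟩ := small_radius h₁ h₂ hw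
  obtain ⟨R, hR1, hR⟩ := large_radius h₁ h₂ hw
  have hα := arg_pos_of_im hw
  have hαπ := arg_lt_of_im hw
  have hR0 : 0 < R := by linarith
  have harg : ∀ x y : ℝ, y ∈ Icc w.arg Real.pi → (Complex.exp (x + y * I)).arg = y := by
    intro x y hy
    rw [Complex.exp_add, ← Complex.ofReal_exp, Complex.exp_mul_I]
    exact Complex.arg_mul_cos_add_sin_mul_I (Real.exp_pos x)
      ⟨by linarith [hy.1, Real.pi_pos], hy.2⟩
  have hnorm : ∀ x y : ℝ, ‖Complex.exp (x + y * I)‖ = Real.exp x := by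
    intro x y
    rw [Complex.norm_exp]
    simp
  -- everything about `g` at points of the rectangle
  have hg : ∀ x y : ℝ, y ∈ Icc w.arg Real.pi →
      0 < (gg μ₁ μ₂ w (Complex.exp (x + y * I))).im ∧
      w.arg ≤ (gg μ₁ μ₂ w (Complex.exp (x + y * I))).arg := by
    intro x y hy
    have h := step h₁ hw (z := Complex.exp (x + y * I)) (by rw [harg x y hy]; exact hy.1)
    exact step h₂ hw h.2
  have := rect_zero (fun ζ => ζ - Complex.log (gg μ₁ μ₂ w (Complex.exp ζ)))
    (Real.log r) (Real.log R) w.arg Real.pi (Real.log_lt_log hr0 (by linarith)) hαπ ?_ ?_ ?_ ?_ ?_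
  · obtain ⟨x, -, y, hy, h0⟩ := this
    have h0 : Complex.log (gg μ₁ μ₂ w (Complex.exp (x + y * I))) = x + y * I := by
      rw [sub_eq_zero] at h0; exact h0.symm
    have hp := (hg x y hy).1
    have hne : gg μ₁ μ₂ w (Complex.exp (x + y * I)) ≠ 0 := by
      intro h; rw [h] at hp; simp at hp
    have e := congrArg Complex.exp h0
    rw [Complex.exp_log hne] at e
    refine ⟨Complex.exp (x + y * I), ?_, e⟩
    rw [← e]; exact hp
  · intro x hx y hy
    apply differentiableAt_id.sub
    have h := step h₁ hw (z := Complex.exp (x + y * I)) (by rw [harg x y hy]; exact hy.1)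
    have hk : Complex.exp (x + y * I) ∈ kreinDomain :=
      arg_krein hw (by rw [harg x y hy]; exact hy.1)
    have d1 := ff_diff h₁ w hk
    have d2 : DifferentiableAt ℂ (ff μ₂ w) (ff μ₁ w (Complex.exp (x + y * I))) :=
      ff_diff h₂ w (im_krein h.1)
    have d3 := (d2.comp _ d1).comp ((x : ℂ) + y * I) Complex.differentiable_exp.differentiableAt
    exact DifferentiableAt.clog d3 (Or.inr (hg x y hy).1.ne')
  · intro x hx
    have := (hg x w.arg ⟨le_rfl, hαπ.le⟩).2
    simp [Complex.log_im]
    exact this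
  · intro x hx
    have := (hg x Real.pi ⟨hαπ.le, le_rfl⟩).1
    have := arg_le_pi (gg μ₁ μ₂ w (Complex.exp (x + Real.pi * I)))
    simp only [sub_im, Complex.log_im]
    simp only [add_im, ofReal_im, mul_im, ofReal_re, I_im, I_re]
    linarith
  · intro y hy
    have := hr (Complex.exp (Real.log r + y * I)) (by rw [harg _ y hy]; exact hy.1)
      (by rw [hnorm, Real.exp_log hr0])
    have := Real.log_le_log (by rw [hnorm, Real.exp_log hr0]; exact hr0) this.le
    rw [hnorm, Real.exp_log hr0] at this
    simp only [sub_re, Complex.log_re]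
    simp only [add_re, ofReal_re, mul_re, ofReal_im, I_im, I_re]
    linarith
  · intro y hy
    have h1 := hR (Complex.exp (Real.log R + y * I)) (by rw [harg _ y hy]; exact hy.1)
      (by rw [hnorm, Real.exp_log hR0])
    have hp := (hg (Real.log R) y hy).1
    have hne : 0 < ‖gg μ₁ μ₂ w (Complex.exp (Real.log R + y * I))‖ := by
      rw [norm_pos_iff]
      intro h; rw [h] at hp; simp at hp
    have := Real.log_lt_log hne h1
    rw [hnorm, Real.exp_log hR0] at this
    simp only [sub_re, Complex.log_re]
    simp only [add_re, ofReal_re, mul_re, ofReal_im, I_im, I_re]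
    linarith

theorem gg_diff {μ₁ μ₂ : Measure ℝ} (h₁ : Good_s12 μ₁) (h₂ : Good_s12 μ₂) {w z : ℂ} (hw : 0 < w.im)
    (hz : 0 < z.im) : DifferentiableAt ℂ (gg μ₁ μ₂ w) z :=
  (ff_diff h₂ w (ff_krein h₁ hw hz).1).comp z (ff_diff h₁ w (im_krein hz))

theorem eq_iff_fixed {μ₁ μ₂ : Measure ℝ} (h₁ : Good_s12 μ₁) {w z : ℂ}
    (hw : 0 < w.im) (hz : 0 < z.im) :
    z / (KPlus μ₂ (w * KPlus μ₁ z / z) / (w * KPlus μ₁ z / z)) = w ↔ gg μ₁ μ₂ w z = z := by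
  have hw0 : w ≠ 0 := by rintro rfl; simp at hw
  have hz0 : z ≠ 0 := by rintro rfl; simp at hz
  rw [mul_div_assoc, gg, ff, ff]
  set a := KPlus μ₂ (w * (KPlus μ₁ z / z)) / (w * (KPlus μ₁ z / z))
  by_cases ha : a = 0
  · rw [ha]
    simp [hw0.symm, hz0.symm]
  · rw [div_eq_iff ha, eq_comm]

/-- Lemma 5.1: the function f₃(z) = z / f₂(z), where
f₁(z) = w·K_{μ₁}(z)/z and f₂(z) = K_{μ₂}(f₁(z))/f₁(z), takes the value w ∈ ℂ⁺
precisely once in ℂ⁺, and does so in the sector arg w ≤ arg z < π. -/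
theorem halfline_value_once (μ₁ μ₂ : Measure ℝ) (h₁ : MPlus μ₁) (h₂ : MPlus μ₂)
    (w : ℂ) (hw : w ∈ upperHalf) :
    (∃! z : ℂ, z ∈ upperHalf ∧
      z / (KPlus μ₂ (w * KPlus μ₁ z / z) / (w * KPlus μ₁ z / z)) = w) ∧
    (∀ z ∈ upperHalf,
      z / (KPlus μ₂ (w * KPlus μ₁ z / z) / (w * KPlus μ₁ z / z)) = w →
      w.arg ≤ z.arg ∧ z.arg < Real.pi) := by
  have g₁ := h₁.good
  have g₂ := h₂.good
  have hw : 0 < w.im := hw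
  constructor
  · obtain ⟨z, hz, hgz⟩ := exists_fixed g₁ g₂ hw
    refine ⟨z, ⟨hz, (eq_iff_fixed g₁ hw hz).2 hgz⟩, ?_⟩
    rintro y ⟨hy, ey⟩
    have hy : 0 < y.im := hy
    have hgy := (eq_iff_fixed g₁ hw hy).1 ey
    by_contra hne
    -- two fixed points would force `g = id`, impossible outside the sector
    have hid := fixed_unique_s12 (gg μ₁ μ₂ w) (fun z hz => gg_diff g₁ g₂ hw hz)
      (fun z hz => gg_maps g₁ g₂ hw hz) y z hy hz hgy hgz hne
    have hw1 : 0 < (w + 1).im := by simpa using hw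
    have := fixed_arg g₁ g₂ hw hw1 (hid _ hw1)
    simp at this
    nlinarith
  · intro z hz ez
    have hz : 0 < z.im := hz
    have hgz := (eq_iff_fixed g₁ hw hz).1 ez
    exact ⟨arg_of_cross hw hz (fixed_arg g₁ g₂ hw hz hgz), arg_lt_of_im hz⟩
end

section
/- Let a₁ ≥ 0, a₂ ≥ 0, and let σ be a finite nonnegative Borel measure on (0,∞) with σ ≠ 0. Define f₄(z) = −a₁·z + a₂/z + ∫_{(0,∞)} (1 + uz)/(z − u) dσ(u) for z ∈ ℂ ∖ [0,∞), and f₅(z) = Log z + f₄(z) for z ∈ ℂ⁺, where Log is the principal branch of the logarithm. Then f₅ takes every value in the strip S_π = {w ∈ ℂ : 0 < Im w < π} precisely once; that is, for every w ∈ S_π there is a unique z ∈ ℂ⁺ with f₅(z) = w. Moreover, the function z ↦ f₅^{(−1)}(Log z), defined for z ∈ ℂ⁺ via the inverse f₅^{(−1)} : S_π → ℂ⁺, extends to a function in the Krein class 𝒦. -/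
open MeasureTheory Complex Filter Set

/-- The function f₄ of Lemma 5.3. -/
noncomputable def fFour (a₁ a₂ : ℝ) (σ : Measure ℝ) (z : ℂ) : ℂ :=
  -(a₁ : ℂ) * z + (a₂ : ℂ) / z + ∫ u, (1 + (u : ℂ) * z) / (z - (u : ℂ)) ∂σ

/-- The function f₅ of Lemma 5.3 (principal branch of the logarithm). -/
noncomputable def fFive (a₁ a₂ : ℝ) (σ : Measure ℝ) (z : ℂ) : ℂ :=
  Complex.log z + fFour a₁ a₂ σ z


theorem aux_sq (Z : ℂ) (u : ℝ) : normSq (Z + u) = normSq Z + 2 * u * Z.re + u ^ 2 := by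
  simp [normSq_apply]; ring

/-- Uniform lower bound for the denominators. -/
theorem aux_lower (Z₀ : ℂ) (h0 : Z₀ ∈ slitPlane) :
    ∃ δ : ℝ, 0 < δ ∧ ∀ᶠ Z in nhds Z₀, Z ∈ slitPlane ∧
      ∀ u : ℝ, 0 < u → δ * (1 + u ^ 2) ≤ normSq (Z + u) := by
  have hpos : ∀ Z : ℂ, Z ∈ slitPlane → 0 < (‖Z‖ + Z.re) / (2 * ‖Z‖) * min (‖Z‖ ^ 2) 1 := by
    intro Z hZ
    have h1 : 0 < ‖Z‖ := norm_pos_iff.2 (slitPlane_ne_zero hZ)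
    have h2 : 0 < ‖Z‖ + Z.re := by
      have h3 : ‖Z‖ ^ 2 = Z.re ^ 2 + Z.im ^ 2 := by
        rw [← normSq_eq_norm_sq, normSq_apply]; ring
      rcases mem_slitPlane_iff.1 hZ with h | h
      · linarith
      · have : 0 < Z.im ^ 2 := by positivity
        by_contra hcon
        nlinarith
    positivity
  have hcont : ContinuousAt
      (fun Z : ℂ => (‖Z‖ + Z.re) / (2 * ‖Z‖) * min (‖Z‖ ^ 2) 1) Z₀ := by
    have h1 : 2 * ‖Z₀‖ ≠ 0 := by
      have := norm_pos_iff.2 (slitPlane_ne_zero h0)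
      positivity
    have h2 : ContinuousAt (fun Z : ℂ => Z.re) Z₀ := Complex.continuous_re.continuousAt
    fun_prop (disch := assumption)
  refine ⟨_, half_pos (hpos Z₀ h0), ?_⟩
  filter_upwards [hcont.eventually (lt_mem_nhds (half_lt_self (hpos Z₀ h0))),
    isOpen_slitPlane.mem_nhds h0] with Z h1 hZ
  refine ⟨hZ, fun u hu => ?_⟩
  have hr : 0 < ‖Z‖ := norm_pos_iff.2 (slitPlane_ne_zero hZ)
  refine (mul_le_mul_of_nonneg_right h1.le (by positivity)).trans ?_
  have habs := abs_le.1 (abs_re_le_norm Z)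
  have hmin : min (‖Z‖ ^ 2) 1 * (1 + u ^ 2) ≤ ‖Z‖ ^ 2 + u ^ 2 := by
    nlinarith [min_le_left (‖Z‖ ^ 2) 1, min_le_right (‖Z‖ ^ 2) 1, sq_nonneg u]
  have hk : (‖Z‖ + Z.re) * (‖Z‖ ^ 2 + u ^ 2) ≤ 2 * ‖Z‖ * normSq (Z + u) := by
    rw [aux_sq, normSq_eq_norm_sq]
    nlinarith [mul_nonneg (sub_nonneg.2 habs.2) (sq_nonneg (‖Z‖ - u)),
      mul_nonneg (mul_pos hu hr).le (by linarith : 0 ≤ ‖Z‖ + Z.re)]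
  rw [mul_assoc, div_mul_eq_mul_div, div_le_iff₀ (by positivity)]
  calc (‖Z‖ + Z.re) * (min (‖Z‖ ^ 2) 1 * (1 + u ^ 2))
      ≤ (‖Z‖ + Z.re) * (‖Z‖ ^ 2 + u ^ 2) :=
        mul_le_mul_of_nonneg_left hmin (by linarith)
    _ ≤ _ := by linarith

theorem aux_ae (σ : Measure ℝ) (hs : σ (Set.Iic 0) = 0) : ∀ᵐ u ∂σ, 0 < u := by
  rw [ae_iff]
  simpa [not_lt, Set.Iic] using hs

theorem aux_integrableC (σ : Measure ℝ) [IsFiniteMeasure σ] (hs : σ (Set.Iic 0) = 0)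
    (Z : ℂ) (hZ : Z ∈ slitPlane) :
    Integrable (fun u : ℝ => ((1 : ℂ) + u * (-Z)) / (-Z - u)) σ := by
  obtain ⟨δ, hδ, hev⟩ := aux_lower Z hZ
  have hl := hev.self_of_nhds.2
  refine Integrable.mono' (integrable_const (√((1 + ‖Z‖ ^ 2) / δ))) (by
    apply Measurable.aestronglyMeasurable; fun_prop) ?_
  filter_upwards [aux_ae σ hs] with u hu
  apply Real.le_sqrt_of_sq_le
  rw [← normSq_eq_norm_sq, ← normSq_eq_norm_sq, normSq_div]
  have h1 : normSq (-Z - u) = normSq (Z + u) := by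
    rw [← normSq_neg]; congr 1; ring
  have h2 := hl u hu
  have h3 : 0 < normSq (Z + u) := lt_of_lt_of_le (by positivity) h2
  rw [h1, div_le_div_iff₀ h3 hδ]
  have h4 : normSq ((1 : ℂ) + u * (-Z)) ≤ (1 + normSq Z) * (1 + u ^ 2) := by
    simp only [normSq_apply, add_re, one_re, mul_re, ofReal_re, neg_re, ofReal_im, neg_im, add_im,
      one_im, mul_im]
    nlinarith [sq_nonneg (u + Z.re), mul_nonneg (sq_nonneg Z.im) (sq_nonneg u), sq_nonneg Z.im]
  calc _ ≤ (1 + normSq Z) * (1 + u ^ 2) * δ := mul_le_mul_of_nonneg_right h4 hδ.le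
    _ = (1 + normSq Z) * (δ * (1 + u ^ 2)) := by ring
    _ ≤ _ := mul_le_mul_of_nonneg_left h2 (by have := normSq_nonneg Z; linarith)

theorem aux_integrableP (σ : Measure ℝ) [IsFiniteMeasure σ] (hs : σ (Set.Iic 0) = 0)
    (Z : ℂ) (hZ : Z ∈ slitPlane) :
    Integrable (fun u : ℝ => (1 + u ^ 2) / normSq (Z + u)) σ := by
  obtain ⟨δ, hδ, hev⟩ := aux_lower Z hZ
  have hl := hev.self_of_nhds.2
  refine Integrable.mono' (integrable_const (1 / δ)) (by
    apply Measurable.aestronglyMeasurable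
    have : Measurable (fun u : ℝ => normSq (Z + u)) := by
      simp only [aux_sq]; fun_prop
    fun_prop) ?_
  filter_upwards [aux_ae σ hs] with u hu
  have h2 := hl u hu
  have h3 : 0 < normSq (Z + u) := lt_of_lt_of_le (by positivity) h2
  rw [Real.norm_of_nonneg (by positivity), div_le_div_iff₀ h3 hδ]
  linarith

theorem aux_deriv (σ : Measure ℝ) [IsFiniteMeasure σ] (hs : σ (Set.Iic 0) = 0)
    (Z : ℂ) (hZ : Z ∈ slitPlane) :
    Integrable (fun u : ℝ => ((1 : ℂ) + u ^ 2) / (Z + u) ^ 2) σ ∧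
    HasDerivAt (fun Z : ℂ => ∫ u : ℝ, ((1 : ℂ) + u * (-Z)) / (-Z - u) ∂σ)
      (∫ u : ℝ, ((1 : ℂ) + u ^ 2) / (Z + u) ^ 2 ∂σ) Z := by
  obtain ⟨δ, hδ, hev⟩ := aux_lower Z hZ
  refine hasDerivAt_integral_of_dominated_loc_of_deriv_le (bound := fun _ => 1 / δ)
    (F := fun (Z : ℂ) (u : ℝ) => ((1 : ℂ) + u * (-Z)) / (-Z - u))
    (F' := fun (Z : ℂ) (u : ℝ) => ((1 : ℂ) + u ^ 2) / (Z + u) ^ 2) (x₀ := Z)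
    hev ?_ (aux_integrableC σ hs Z hZ) ?_ ?_ (integrable_const _) ?_
  · refine Eventually.of_forall fun Z => Measurable.aestronglyMeasurable ?_
    fun_prop
  · apply Measurable.aestronglyMeasurable
    fun_prop
  · filter_upwards [aux_ae σ hs] with u hu W hW
    have h2 := hW.2 u hu
    have h3 : 0 < normSq (W + u) := lt_of_lt_of_le (by positivity) h2
    have h4 : ‖(1 : ℂ) + u ^ 2‖ = 1 + u ^ 2 := by
      have : (1 : ℂ) + u ^ 2 = ((1 + u ^ 2 : ℝ) : ℂ) := by push_cast; rfl
      rw [this, Complex.norm_real, Real.norm_of_nonneg (by positivity)]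
    rw [norm_div, norm_pow, ← normSq_eq_norm_sq, h4, div_le_div_iff₀ h3 hδ]
    linarith
  · filter_upwards [aux_ae σ hs] with u hu W hW
    have h2 := hW.2 u hu
    have h3 : 0 < normSq (W + u) := lt_of_lt_of_le (by positivity) h2
    have h4 : W + u ≠ 0 := normSq_pos.1 h3
    have h5 : -W - u ≠ 0 := by
      intro h; apply h4; linear_combination -h
    have ha : HasDerivAt (fun x : ℂ => (1 : ℂ) + u * (-x)) (u * (-1)) W :=
      ((hasDerivAt_id W).neg.const_mul (u : ℂ)).const_add 1
    have hb : HasDerivAt (fun x : ℂ => -x - (u : ℂ)) (-1) W :=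
      (hasDerivAt_id W).neg.sub_const _
    refine (ha.div hb h5).congr_deriv ?_
    rw [div_eq_div_iff (pow_ne_zero 2 h5) (pow_ne_zero 2 h4)]
    ring


theorem strip_abstract (g g' : ℂ → ℂ) (C : ℝ)
    (hd : ∀ ζ : ℂ, |ζ.im| < Real.pi → HasStrictDerivAt g (g' ζ) ζ)
    (hpos : ∀ ζ : ℂ, |ζ.im| < Real.pi → |(g ζ).im| < Real.pi → 0 < (g' ζ).re)
    (huniq : ∀ s α β : ℝ, |α| < Real.pi → |β| < Real.pi → |(g ⟨s, α⟩).im| < Real.pi →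
      (g ⟨s, α⟩).im = (g ⟨s, β⟩).im → α = β)
    (hex : ∀ s c : ℝ, |c| < Real.pi → ∃ α : ℝ, |α| < Real.pi ∧ (g ⟨s, α⟩).im = c)
    (hgr1 : ∀ ζ : ℂ, |ζ.im| < Real.pi → |(g ζ).im| < Real.pi → 0 ≤ ζ.re → ζ.re - C ≤ (g ζ).re)
    (hgr2 : ∀ ζ : ℂ, |ζ.im| < Real.pi → |(g ζ).im| < Real.pi → ζ.re ≤ 0 → (g ζ).re ≤ ζ.re + C) :
    ∃ G : ℂ → ℂ, (∀ w : ℂ, |w.im| < Real.pi → |(G w).im| < Real.pi ∧ g (G w) = w) ∧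
      (∀ ζ : ℂ, |ζ.im| < Real.pi → |(g ζ).im| < Real.pi → ζ = G (g ζ)) ∧
      DifferentiableOn ℂ G {w : ℂ | |w.im| < Real.pi} ∧
      (∀ w₁ w₂ : ℂ, |w₁.im| < Real.pi → w₁.im = w₂.im → w₁.re < w₂.re →
        (G w₁).re < (G w₂).re) := by
  have hopen : IsOpen {w : ℂ | |w.im| < Real.pi} :=
    isOpen_lt (Complex.continuous_im.abs) continuous_const
  -- the local inverse
  have hloc : ∀ ζ : ℂ, |ζ.im| < Real.pi → |(g ζ).im| < Real.pi →
      ∃ φ : ℂ → ℂ, HasStrictDerivAt φ (g' ζ)⁻¹ (g ζ) ∧ φ (g ζ) = ζ ∧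
        (∀ᶠ w in nhds (g ζ), g (φ w) = w ∧ |(φ w).im| < Real.pi ∧ |w.im| < Real.pi) := by
    intro ζ h1 h2
    have hne : g' ζ ≠ 0 := by
      intro h
      have := hpos ζ h1 h2
      simp [h] at this
    have hs := hd ζ h1
    have h3 := hs.to_localInverse hne
    have h5 : hs.localInverse g (g' ζ) ζ hne (g ζ) = ζ :=
      HasStrictFDerivAt.localInverse_apply_image _
    refine ⟨hs.localInverse g (g' ζ) ζ hne, h3, h5, ?_⟩
    have h4 := h3.hasDerivAt.continuousAt
    have h6 : ∀ᶠ w in nhds (g ζ), |(hs.localInverse g (g' ζ) ζ hne w).im| < Real.pi :=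
      h4.eventually (hopen.mem_nhds (by rw [h5]; exact h1))
    filter_upwards [hs.eventually_right_inverse hne, h6, hopen.mem_nhds h2] with w a b c
    exact ⟨a, b, c⟩
  choose A hA1 hA2 using hex
  -- the function along level lines
  have hmono : ∀ c (hc : |c| < Real.pi),
      StrictMono (fun s => (g ⟨s, A s c hc⟩).re) ∧ Continuous (fun s => (g ⟨s, A s c hc⟩).re) := by
    intro c hc
    have hder : ∀ s, ∃ d : ℝ, 0 < d ∧ HasDerivAt (fun s => (g ⟨s, A s c hc⟩).re) d s := by
      intro s
      obtain ⟨φ, hφ, hφ0, hφe⟩ := hloc ⟨s, A s c hc⟩ (hA1 s c hc) (by rw [hA2 s c hc]; exact hc)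
      have hp := hpos ⟨s, A s c hc⟩ (hA1 s c hc) (by rw [hA2 s c hc]; exact hc)
      set D := g' ⟨s, A s c hc⟩
      set t0 := (g ⟨s, A s c hc⟩).re with ht0
      have hg0 : g ⟨s, A s c hc⟩ = (t0 : ℂ) + c * I := by
        apply Complex.ext <;> simp [ht0, hA2]
      rw [hg0] at hφ hφ0 hφe
      have hDpos : 0 < (D⁻¹).re := by
        rw [Complex.inv_re]
        apply div_pos hp
        rw [Complex.normSq_pos]
        intro h
        rw [h] at hp
        simp at hp
      have hline : HasStrictDerivAt (fun t : ℝ => (t : ℂ) + c * I) 1 t0 :=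
        (Complex.ofRealCLM.hasStrictDerivAt (x := t0)).add_const _
      have hψ : HasStrictDerivAt (fun t : ℝ => (φ ((t : ℂ) + c * I)).re) (D⁻¹).re t0 := by
        have h1 : HasStrictDerivAt (fun t : ℝ => φ ((t : ℂ) + c * I)) D⁻¹ t0 := by
          have := HasStrictDerivAt.scomp t0 (g₁ := φ) (h := fun t : ℝ => (t : ℂ) + c * I)
            hφ hline
          rw [one_smul] at this
          exact this
        have := Complex.reCLM.hasStrictFDerivAt.comp_hasStrictDerivAt t0 h1
        simpa [Function.comp_def] using this
      have hψ' := hψ.to_localInverse hDpos.ne'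
      have hr := hψ.eventually_right_inverse hDpos.ne'
      have hv : hψ.localInverse _ _ _ hDpos.ne' ((φ ((t0 : ℂ) + c * I)).re) = t0 :=
        HasStrictFDerivAt.localInverse_apply_image _
      set ρ := hψ.localInverse _ _ _ hDpos.ne'
      simp only [hφ0] at hψ' hr hv
      refine ⟨_, inv_pos.2 hDpos, hψ'.hasDerivAt.congr_of_eventuallyEq ?_⟩
      have hcont : Tendsto (fun s' => ((ρ s' : ℝ) : ℂ) + c * I) (nhds s)
          (nhds ((t0 : ℂ) + c * I)) := by
        have h1 := hψ'.hasDerivAt.continuousAt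
        have h2 : Tendsto ρ (nhds s) (nhds t0) := by
          have := h1.tendsto
          rwa [hv] at this
        exact ((Complex.continuous_ofReal.tendsto t0).comp h2).add_const _
      filter_upwards [hr, hcont.eventually hφe] with s' h1 h2
      obtain ⟨h3, h4, h5⟩ := h2
      have h6 : φ ((ρ s' : ℂ) + c * I) = ⟨s', (φ ((ρ s' : ℂ) + c * I)).im⟩ := by
        apply Complex.ext
        · exact h1
        · rfl
      have h7 : A s' c hc = (φ ((ρ s' : ℂ) + c * I)).im := by
        apply huniq s' _ _ (hA1 _ _ _) h4
        · rw [hA2]; exact hc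
        · rw [← h6, h3, hA2]; simp
      rw [h7, ← h6, h3]
      simp
    choose d hd0 hd1 using hder
    refine ⟨strictMono_of_deriv_pos fun s => ?_, ?_⟩
    · rw [(hd1 s).deriv]; exact hd0 s
    · exact continuous_iff_continuousAt.2 fun s => (hd1 s).continuousAt
  have hsurj : ∀ c (hc : |c| < Real.pi),
      Function.Surjective (fun s => (g ⟨s, A s c hc⟩).re) := by
    intro c hc
    apply (hmono c hc).2.surjective
    · apply tendsto_atTop_mono' _ _ (tendsto_atTop_add_const_right _ (-C) tendsto_id)
      filter_upwards [eventually_ge_atTop 0] with s hs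
      have := hgr1 ⟨s, A s c hc⟩ (hA1 s c hc) (by rw [hA2]; exact hc) hs
      simpa [sub_eq_add_neg] using this
    · apply tendsto_atBot_mono' _ _ (tendsto_atBot_add_const_right _ C tendsto_id)
      filter_upwards [eventually_le_atBot 0] with s hs
      exact hgr2 ⟨s, A s c hc⟩ (hA1 s c hc) (by rw [hA2]; exact hc) hs
  -- global comparison
  have hpt : ∀ ζ : ℂ, |ζ.im| < Real.pi → ∀ hc : |(g ζ).im| < Real.pi,
      ζ = ⟨ζ.re, A ζ.re (g ζ).im hc⟩ := by
    intro ζ h1 hc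
    apply Complex.ext
    · rfl
    · exact huniq ζ.re _ _ h1 (hA1 _ _ _) hc (by rw [hA2])
  have hcmp : ∀ ζ₁ ζ₂ : ℂ, |ζ₁.im| < Real.pi → |ζ₂.im| < Real.pi → |(g ζ₁).im| < Real.pi →
      (g ζ₁).im = (g ζ₂).im → ((g ζ₁).re < (g ζ₂).re ↔ ζ₁.re < ζ₂.re) := by
    intro ζ₁ ζ₂ h1 h2 h3 h4
    have e1 := hpt ζ₁ h1 h3
    have e2 := hpt ζ₂ h2 (h4 ▸ h3)
    have := (hmono _ h3).1.lt_iff_lt (a := ζ₁.re) (b := ζ₂.re)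
    rw [← e1] at this
    simp only [← h4] at e2
    rw [← e2] at this
    exact this
  have hinj : ∀ ζ₁ ζ₂ : ℂ, |ζ₁.im| < Real.pi → |ζ₂.im| < Real.pi → |(g ζ₁).im| < Real.pi →
      g ζ₁ = g ζ₂ → ζ₁ = ζ₂ := by
    intro ζ₁ ζ₂ h1 h2 h3 h4
    have a1 := hcmp ζ₁ ζ₂ h1 h2 h3 (by rw [h4])
    have a2 := hcmp ζ₂ ζ₁ h2 h1 (h4 ▸ h3) (by rw [h4])
    rw [h4] at a1 a2
    have hre : ζ₁.re = ζ₂.re := by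
      simp only [lt_self_iff_false, false_iff, not_lt] at a1 a2
      exact le_antisymm a2 a1
    apply Complex.ext hre
    apply huniq ζ₁.re _ _ h1 h2 h3
    have : (⟨ζ₁.re, ζ₂.im⟩ : ℂ) = ζ₂ := by apply Complex.ext <;> simp [hre]
    rw [this]
    exact congrArg Complex.im h4
  have hall : ∀ w : ℂ, ∃ ζ : ℂ, |w.im| < Real.pi → |ζ.im| < Real.pi ∧ g ζ = w := by
    intro w
    by_cases hw : |w.im| < Real.pi
    · obtain ⟨s, hs⟩ := hsurj w.im hw w.re
      exact ⟨⟨s, A s w.im hw⟩, fun _ => ⟨hA1 _ _ _, Complex.ext hs (hA2 _ _ _)⟩⟩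
    · exact ⟨0, fun h => absurd h hw⟩
  choose G hG using hall
  have hGu : ∀ ζ : ℂ, |ζ.im| < Real.pi → |(g ζ).im| < Real.pi → ζ = G (g ζ) := by
    intro ζ h1 h2
    exact hinj _ _ h1 (hG _ h2).1 h2 (hG _ h2).2.symm
  refine ⟨G, hG, hGu, ?_, ?_⟩
  · intro w hw
    obtain ⟨h1, h2⟩ := hG w hw
    obtain ⟨φ, hφ, hφ0, hφe⟩ := hloc (G w) h1 (by rw [h2]; exact hw)
    rw [h2] at hφ hφe
    apply DifferentiableAt.differentiableWithinAt
    apply hφ.hasDerivAt.differentiableAt.congr_of_eventuallyEq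
    filter_upwards [hφe] with w' ⟨a, b, c⟩
    have := hGu (φ w') b (by rw [a]; exact c)
    rw [a] at this
    exact this.symm
  · intro w₁ w₂ h1 h2 h3
    obtain ⟨a1, a2⟩ := hG w₁ h1
    obtain ⟨b1, b2⟩ := hG w₂ (h2 ▸ h1)
    apply (hcmp _ _ a1 b1 (by rw [a2]; exact h1) (by rw [a2, b2, h2])).1
    rw [a2, b2]; exact h3

/-- The positive kernel. -/
noncomputable def auxP (a₁ a₂ : ℝ) (σ : Measure ℝ) (Z : ℂ) : ℝ :=
  a₁ + a₂ / normSq Z + ∫ u : ℝ, (1 + u ^ 2) / normSq (Z + u) ∂σ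

/-- The derivative of `Z ↦ f₄(-Z)`. -/
noncomputable def auxD (a₁ a₂ : ℝ) (σ : Measure ℝ) (Z : ℂ) : ℂ :=
  a₁ + a₂ / Z ^ 2 + ∫ u : ℝ, ((1 : ℂ) + u ^ 2) / (Z + u) ^ 2 ∂σ

theorem aux_normSq_pos (Z : ℂ) (hZ : Z ∈ slitPlane) (u : ℝ) (hu : 0 < u) :
    0 < normSq (Z + u) := by
  obtain ⟨δ, hδ, hev⟩ := aux_lower Z hZ
  exact lt_of_lt_of_le (by positivity) (hev.self_of_nhds.2 u hu)

theorem auxP_nonneg (a₁ a₂ : ℝ) (ha₁ : 0 ≤ a₁) (ha₂ : 0 ≤ a₂) (σ : Measure ℝ) (Z : ℂ) :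
    0 ≤ auxP a₁ a₂ σ Z := by
  unfold auxP
  have h1 : 0 ≤ ∫ u : ℝ, (1 + u ^ 2) / normSq (Z + u) ∂σ :=
    integral_nonneg fun u => div_nonneg (by positivity) (normSq_nonneg _)
  have h2 : 0 ≤ a₂ / normSq Z := div_nonneg ha₂ (normSq_nonneg _)
  linarith

theorem auxP_mono (a₁ a₂ : ℝ) (σ : Measure ℝ) [IsFiniteMeasure σ] (hs : σ (Set.Iic 0) = 0)
    (Z W : ℂ) (hZ : Z ∈ slitPlane) (hW : W ∈ slitPlane) (h : normSq Z = normSq W)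
    (hre : W.re ≤ Z.re) : auxP a₁ a₂ σ Z ≤ auxP a₁ a₂ σ W := by
  unfold auxP
  rw [h]
  gcongr 1
  refine integral_mono_ae (aux_integrableP σ hs Z hZ) (aux_integrableP σ hs W hW) ?_
  filter_upwards [aux_ae σ hs] with u hu
  have h1 := aux_normSq_pos W hW u hu
  refine div_le_div_of_nonneg_left (by positivity) h1 ?_
  rw [aux_sq, aux_sq, h]
  nlinarith

theorem aux_hasDerivAt (a₁ a₂ : ℝ) (σ : Measure ℝ) [IsFiniteMeasure σ]
    (hs : σ (Set.Iic 0) = 0) (Z : ℂ) (hZ : Z ∈ slitPlane) :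
    HasDerivAt (fun Z => fFour a₁ a₂ σ (-Z)) (auxD a₁ a₂ σ Z) Z := by
  unfold fFour auxD
  have h0 := slitPlane_ne_zero hZ
  have h1 : HasDerivAt (fun Z : ℂ => -(a₁ : ℂ) * -Z) a₁ Z := by
    have := (hasDerivAt_id Z).neg.const_mul (-(a₁ : ℂ))
    exact this.congr_deriv (by ring)
  have h2 : HasDerivAt (fun Z : ℂ => (a₂ : ℂ) / -Z) (a₂ / Z ^ 2) Z := by
    have := (hasDerivAt_const Z (a₂ : ℂ)).div (hasDerivAt_id Z).neg (neg_ne_zero.2 h0)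
    refine this.congr_deriv ?_
    simp
  exact (h1.add h2).add (aux_deriv σ hs Z hZ).2

theorem aux_conj (a₁ a₂ : ℝ) (σ : Measure ℝ) (Z : ℂ) :
    fFour a₁ a₂ σ (starRingEnd ℂ Z) = starRingEnd ℂ (fFour a₁ a₂ σ Z) := by
  unfold fFour
  rw [map_add, map_add, ← integral_conj]
  simp

theorem aux_im (a₁ a₂ : ℝ) (σ : Measure ℝ) [IsFiniteMeasure σ]
    (hs : σ (Set.Iic 0) = 0) (Z : ℂ) (hZ : Z ∈ slitPlane) :
    (fFour a₁ a₂ σ (-Z)).im = Z.im * auxP a₁ a₂ σ Z := by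
  unfold fFour auxP
  have h0 : normSq Z ≠ 0 := (normSq_pos.2 (slitPlane_ne_zero hZ)).ne'
  have h1 := Complex.imCLM.integral_comp_comm (aux_integrableC σ hs Z hZ)
  simp only [imCLM_apply] at h1
  rw [add_im, add_im, ← h1, mul_add, mul_add, ← integral_const_mul]
  congr 1
  · congr 1
    · simp; ring
    · simp [div_im]; ring
  · apply integral_congr_ae
    filter_upwards [aux_ae σ hs] with u hu
    have h2 := (aux_normSq_pos Z hZ u hu).ne'
    have h3 : normSq (-Z - u) = normSq (Z + u) := by
      rw [← normSq_neg]; congr 1; ring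
    rw [div_im, h3]
    field_simp
    simp
    ring

theorem aux_re (a₁ a₂ : ℝ) (σ : Measure ℝ) [IsFiniteMeasure σ]
    (hs : σ (Set.Iic 0) = 0) (Z : ℂ) (hZ : Z ∈ slitPlane) :
    Integrable (fun u : ℝ => (u * (normSq Z - 1) + (u ^ 2 - 1) * Z.re) / normSq (Z + u)) σ ∧
    (fFour a₁ a₂ σ (-Z)).re = a₁ * Z.re - a₂ * Z.re / normSq Z
      + ∫ u : ℝ, (u * (normSq Z - 1) + (u ^ 2 - 1) * Z.re) / normSq (Z + u) ∂σ := by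
  unfold fFour
  have hae : (fun u : ℝ => (((1 : ℂ) + u * (-Z)) / (-Z - u)).re) =ᵐ[σ]
      (fun u : ℝ => (u * (normSq Z - 1) + (u ^ 2 - 1) * Z.re) / normSq (Z + u)) := by
    filter_upwards [aux_ae σ hs] with u hu
    have h2 := (aux_normSq_pos Z hZ u hu).ne'
    have h3 : normSq (-Z - u) = normSq (Z + u) := by
      rw [← normSq_neg]; congr 1; ring
    rw [div_re, h3]
    field_simp
    simp [normSq_apply Z]
    ring
  have h1 := Complex.reCLM.integral_comp_comm (aux_integrableC σ hs Z hZ)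
  simp only [reCLM_apply] at h1
  refine ⟨(Complex.reCLM.integrable_comp (aux_integrableC σ hs Z hZ)).congr hae, ?_⟩
  rw [add_re, add_re, ← h1, integral_congr_ae hae]
  congr 1
  simp [div_re]
  ring

theorem aux_dre (a₁ a₂ : ℝ) (σ : Measure ℝ) [IsFiniteMeasure σ]
    (hs : σ (Set.Iic 0) = 0) (Z : ℂ) (hZ : Z ∈ slitPlane) :
    Z.re * auxP a₁ a₂ σ Z ≤ (Z * auxD a₁ a₂ σ Z).re := by
  unfold auxD auxP
  have h00 := slitPlane_ne_zero hZ
  have h0 : normSq Z ≠ 0 := (normSq_pos.2 h00).ne'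
  have hintg := (aux_deriv σ hs Z hZ).1.const_mul Z
  have h1 := Complex.reCLM.integral_comp_comm hintg
  simp only [reCLM_apply] at h1
  rw [mul_add Z, mul_add Z, add_re, add_re, ← integral_const_mul Z, ← h1, mul_add, mul_add,
    ← integral_const_mul]
  refine add_le_add (add_le_add ?_ ?_) ?_
  · simp [mul_comm]
  · have : Z * (a₂ / Z ^ 2) = a₂ / Z := by field_simp
    rw [this, div_re]
    simp
    apply le_of_eq; ring
  · refine integral_mono_ae ((aux_integrableP σ hs Z hZ).const_mul _)
      (Complex.reCLM.integrable_comp hintg) ?_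
    filter_upwards [aux_ae σ hs] with u hu
    have h2 := aux_normSq_pos Z hZ u hu
    have h3 : Z + u ≠ 0 := normSq_pos.1 h2
    have h4 : (Z * (((1 : ℂ) + u ^ 2) / (Z + u) ^ 2)).re
        = (1 + u ^ 2) * (Z.re * normSq (Z + u) + 2 * u * Z.im ^ 2) / normSq (Z + u) ^ 2 := by
      have e1 : Z * (((1 : ℂ) + u ^ 2) / (Z + u) ^ 2) =
          ((1 + u ^ 2 : ℝ) : ℂ) * (Z / (Z + u) ^ 2) := by push_cast; ring
      rw [e1, re_ofReal_mul, div_re, map_pow, ← add_div, mul_div_assoc (1 + u ^ 2)]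
      congr 2
      simp [sq, normSq_apply]
      ring
    have h5 : Z.re * ((1 + u ^ 2) / normSq (Z + u))
        = (1 + u ^ 2) * (Z.re * normSq (Z + u)) / normSq (Z + u) ^ 2 := by
      field_simp
    change _ ≤ (Z * (((1 : ℂ) + u ^ 2) / (Z + u) ^ 2)).re
    rw [h4, h5]
    have : 0 ≤ 2 * u * Z.im ^ 2 := by positivity
    gcongr
    linarith

theorem aux_lower_re (a₁ a₂ : ℝ) (ha₁ : 0 ≤ a₁) (ha₂ : 0 ≤ a₂) (σ : Measure ℝ)
    [IsFiniteMeasure σ] (hs : σ (Set.Iic 0) = 0) (Z : ℂ) (hZ : Z ∈ slitPlane)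
    (h1 : 1 ≤ normSq Z) :
    (0 ≤ Z.re → -(a₂ + σ.real univ) ≤ (fFour a₁ a₂ σ (-Z)).re) ∧
    (Z.re ≤ 0 → Z.re * auxP a₁ a₂ σ Z ≤ (fFour a₁ a₂ σ (-Z)).re) := by
  obtain ⟨hintg, he⟩ := aux_re a₁ a₂ σ hs Z hZ
  have hN : 0 < normSq Z := by linarith
  rw [he]
  have hle : Z.re ≤ normSq Z := by
    rw [normSq_apply] at *
    nlinarith [sq_nonneg Z.im, sq_nonneg (Z.re - 1)]
  constructor
  · intro hX
    have e1 : 0 ≤ a₁ * Z.re := by positivity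
    have e2 : a₂ * Z.re / normSq Z ≤ a₂ := by
      rw [div_le_iff₀ hN]; exact mul_le_mul_of_nonneg_left hle ha₂
    have e3 : ∫ _ : ℝ, (-1 : ℝ) ∂σ ≤
        ∫ u : ℝ, (u * (normSq Z - 1) + (u ^ 2 - 1) * Z.re) / normSq (Z + u) ∂σ := by
      refine integral_mono_ae (integrable_const _) hintg ?_
      filter_upwards [aux_ae σ hs] with u hu
      have h2 := aux_normSq_pos Z hZ u hu
      rw [le_div_iff₀ h2, aux_sq]
      nlinarith [mul_nonneg hu.le (sub_nonneg.2 h1), mul_nonneg (sq_nonneg u) hX,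
        mul_nonneg hu.le hX, sq_nonneg u]
    rw [integral_const] at e3
    simp at e3
    linarith
  · intro hX
    unfold auxP
    rw [mul_add, mul_add, ← integral_const_mul]
    have e1 : Z.re * (a₂ / normSq Z) ≤ 0 :=
      mul_nonpos_of_nonpos_of_nonneg hX (by positivity)
    have e2 : a₂ * Z.re / normSq Z = Z.re * (a₂ / normSq Z) := by ring
    have e3 : ∫ u : ℝ, Z.re * ((1 + u ^ 2) / normSq (Z + u)) ∂σ ≤
        ∫ u : ℝ, (u * (normSq Z - 1) + (u ^ 2 - 1) * Z.re) / normSq (Z + u) ∂σ := by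
      refine integral_mono_ae ((aux_integrableP σ hs Z hZ).const_mul _) hintg ?_
      filter_upwards [aux_ae σ hs] with u hu
      have h2 := aux_normSq_pos Z hZ u hu
      rw [← mul_div_assoc]
      apply div_le_div_of_nonneg_right _ h2.le
      nlinarith [mul_nonneg hu.le (sub_nonneg.2 h1)]
    linarith

theorem aux_upper_re (a₁ a₂ : ℝ) (ha₁ : 0 ≤ a₁) (ha₂ : 0 ≤ a₂) (σ : Measure ℝ)
    [IsFiniteMeasure σ] (hs : σ (Set.Iic 0) = 0) (Z : ℂ) (hZ : Z ∈ slitPlane)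
    (h1 : normSq Z ≤ 1) :
    (0 ≤ Z.re → (fFour a₁ a₂ σ (-Z)).re ≤ a₁ + σ.real univ) ∧
    (Z.re ≤ 0 → (fFour a₁ a₂ σ (-Z)).re ≤ -(Z.re * auxP a₁ a₂ σ Z)) := by
  obtain ⟨hintg, he⟩ := aux_re a₁ a₂ σ hs Z hZ
  have hN : 0 < normSq Z := normSq_pos.2 (slitPlane_ne_zero hZ)
  rw [he]
  have hle : Z.re ≤ 1 := by
    rw [normSq_apply] at *
    nlinarith [sq_nonneg Z.im, sq_nonneg (Z.re - 1)]
  constructor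
  · intro hX
    have e1 : a₁ * Z.re ≤ a₁ := by nlinarith
    have e2 : 0 ≤ a₂ * Z.re / normSq Z := by positivity
    have e3 : ∫ u : ℝ, (u * (normSq Z - 1) + (u ^ 2 - 1) * Z.re) / normSq (Z + u) ∂σ
        ≤ ∫ _ : ℝ, (1 : ℝ) ∂σ := by
      refine integral_mono_ae hintg (integrable_const _) ?_
      filter_upwards [aux_ae σ hs] with u hu
      have h2 := aux_normSq_pos Z hZ u hu
      rw [div_le_iff₀ h2, aux_sq]
      nlinarith [mul_nonneg hu.le (sub_nonneg.2 h1), mul_nonneg (sq_nonneg u) (sub_nonneg.2 hle),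
        mul_nonneg hu.le hX, sq_nonneg u]
    rw [integral_const] at e3
    simp at e3
    linarith
  · intro hX
    unfold auxP
    rw [mul_add, mul_add, ← integral_const_mul, neg_add, ← integral_neg]
    have e1 : a₁ * Z.re ≤ 0 := mul_nonpos_of_nonneg_of_nonpos ha₁ hX
    have e2 : a₂ * Z.re / normSq Z = Z.re * (a₂ / normSq Z) := by ring
    have e3 : ∫ u : ℝ, (u * (normSq Z - 1) + (u ^ 2 - 1) * Z.re) / normSq (Z + u) ∂σ ≤
        ∫ u : ℝ, -(Z.re * ((1 + u ^ 2) / normSq (Z + u))) ∂σ := by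
      refine integral_mono_ae hintg ((aux_integrableP σ hs Z hZ).const_mul _).neg ?_
      filter_upwards [aux_ae σ hs] with u hu
      have h2 := aux_normSq_pos Z hZ u hu
      rw [← mul_div_assoc, ← neg_div]
      apply div_le_div_of_nonneg_right _ h2.le
      nlinarith [mul_nonneg hu.le (sub_nonneg.2 h1), mul_nonneg (sq_nonneg u) (neg_nonneg.2 hX)]
    linarith

/-! Trigonometric facts. -/

theorem trig_cos (α k : ℝ) (hk : 0 ≤ k) (h1 : |α| < Real.pi)
    (h2 : |α + k * Real.sin α| < Real.pi) : -1 < k * Real.cos α := by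
  wlog h : 0 ≤ α generalizing α
  · have := this (-α) (by rwa [abs_neg]) (by
      rw [Real.sin_neg, ← abs_neg]; convert h2 using 2; ring) (by linarith)
    rwa [Real.cos_neg] at this
  by_cases hc : 0 ≤ Real.cos α
  · nlinarith [mul_nonneg hk hc]
  have h3 : Real.pi / 2 < α := by
    by_contra hcon
    exact hc (Real.cos_nonneg_of_neg_pi_div_two_le_of_le (by linarith [Real.pi_pos]) (by linarith))
  rw [abs_lt] at h1 h2
  have h4 := Real.lt_tan (x := Real.pi - α) (by linarith) (by linarith)
  have hcp : 0 < -Real.cos α := by linarith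
  rw [Real.tan_eq_sin_div_cos, Real.sin_pi_sub, Real.cos_pi_sub, lt_div_iff₀ hcp] at h4
  have hsp : 0 < Real.sin α := Real.sin_pos_of_pos_of_lt_pi (by linarith [Real.pi_pos]) h1.2
  have h5 : k * Real.sin α * (-Real.cos α) < Real.sin α := by
    have : k * Real.sin α < Real.pi - α := by linarith
    nlinarith
  have h6 : Real.sin α * (-(k * Real.cos α)) < Real.sin α * 1 := by linarith
  have := lt_of_mul_lt_mul_left h6 hsp.le
  linarith

theorem trig_uniq_aux (α β k l c : ℝ) (h0 : 0 < α) (h1 : α < β) (h2 : β < Real.pi)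
    (hl : 0 ≤ l) (hkl : k ≤ l) (hc : c < Real.pi) (e1 : α + k * Real.sin α = c)
    (e2 : β + l * Real.sin β = c) : False := by
  have sa : 0 < Real.sin α := Real.sin_pos_of_pos_of_lt_pi h0 (by linarith)
  have sb : 0 < Real.sin β := Real.sin_pos_of_pos_of_lt_pi (by linarith) h2
  have hbc : β ≤ c := by nlinarith
  -- concavity
  have hcv : (Real.pi - β) * Real.sin α ≤ (Real.pi - α) * Real.sin β := by
    have hm1 : α ∈ Icc 0 Real.pi := ⟨h0.le, by linarith⟩
    have hm2 : Real.pi ∈ Icc 0 Real.pi := ⟨by linarith, le_refl _⟩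
    have hm3 : 0 ≤ (Real.pi - β) / (Real.pi - α) := div_nonneg (by linarith) (by linarith)
    have hm4 : 0 ≤ (β - α) / (Real.pi - α) := div_nonneg (by linarith) (by linarith)
    have := strictConcaveOn_sin_Icc.concaveOn.2 hm1 hm2 hm3 hm4
      (by rw [← add_div, div_eq_one_iff_eq (by linarith)]; ring)
    have hne : Real.pi - α ≠ 0 := by linarith
    have e : (Real.pi - β) / (Real.pi - α) * α + (β - α) / (Real.pi - α) * Real.pi = β := by
      field_simp; ring
    simp only [smul_eq_mul, Real.sin_pi, mul_zero, add_zero] at this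
    rw [e, div_mul_eq_mul_div, div_le_iff₀ (by linarith)] at this
    linarith
  -- affine interpolation in `c`
  have h3 : (c - α) * Real.sin β ≤ (c - β) * Real.sin α := by
    have a1 : c - α = k * Real.sin α := by linarith
    have a2 : c - β = l * Real.sin β := by linarith
    rw [a1, a2]
    nlinarith [mul_pos sa sb]
  have h4 : 0 < (Real.pi - c) * ((β - α) * Real.sin β) :=
    mul_pos (by linarith) (mul_pos (by linarith) sb)
  have h5 : 0 ≤ (c - β) * ((Real.pi - α) * Real.sin β - (Real.pi - β) * Real.sin α) :=
    mul_nonneg (by linarith) (by linarith)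
  have h6 : 0 ≤ (Real.pi - β) * ((c - β) * Real.sin α - (c - α) * Real.sin β) :=
    mul_nonneg (by linarith) (by linarith)
  nlinarith

theorem trig_sign (α k : ℝ) (hk : 0 ≤ k) (h1 : |α| < Real.pi) :
    (0 < α → 0 < α + k * Real.sin α) ∧ (α < 0 → α + k * Real.sin α < 0) := by
  rw [abs_lt] at h1
  constructor
  · intro h
    have := Real.sin_pos_of_pos_of_lt_pi h h1.2
    nlinarith [mul_nonneg hk this.le]
  · intro h
    have := Real.sin_neg_of_neg_of_neg_pi_lt h h1.1
    nlinarith [mul_nonneg hk (neg_nonneg.2 this.le)]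

theorem trig_uniq (K : ℝ → ℝ) (hK : ∀ x, 0 ≤ K x)
    (hmono : ∀ x y, |x| < Real.pi → |y| < Real.pi → |x| ≤ |y| → K x ≤ K y)
    (α β : ℝ) (ha : |α| < Real.pi) (hb : |β| < Real.pi)
    (hc : |α + K α * Real.sin α| < Real.pi)
    (e : α + K α * Real.sin α = β + K β * Real.sin β) : α = β := by
  have key : ∀ x y : ℝ, 0 < x → x < y → y < Real.pi →
      |x + K x * Real.sin x| < Real.pi → x + K x * Real.sin x = y + K y * Real.sin y → False := by
    intro x y h0 h1 h2 h3 h4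
    exact trig_uniq_aux x y (K x) (K y) _ h0 h1 h2 (hK y)
      (hmono x y (by rw [abs_of_pos h0]; linarith) (by rw [abs_of_pos (by linarith)]; linarith)
        (by rw [abs_of_pos h0, abs_of_pos (by linarith)]; linarith)) (abs_lt.1 h3).2 rfl h4.symm
  have hsym : ∀ x, |x| < Real.pi → K (-x) = K x := by
    intro x hx
    apply le_antisymm <;> apply hmono <;> simp [hx]
  obtain ⟨a1, a2⟩ := trig_sign α (K α) (hK α) ha
  obtain ⟨b1, b2⟩ := trig_sign β (K β) (hK β) hb
  rcases lt_trichotomy α 0 with h | h | h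
  · have hb0 : β < 0 := by
      by_contra hcon
      rcases (not_lt.1 hcon).eq_or_lt with h' | h'
      · have := a2 h
        rw [e, ← h'] at this; simp at this
      · linarith [a2 h, b1 h']
    have ea : -α + K (-α) * Real.sin (-α) = -(α + K α * Real.sin α) := by
      rw [hsym α ha, Real.sin_neg]; ring
    have eb : -β + K (-β) * Real.sin (-β) = -(β + K β * Real.sin β) := by
      rw [hsym β hb, Real.sin_neg]; ring
    rw [abs_lt] at ha hb
    rcases lt_trichotomy α β with h' | h' | h'
    · exact (key (-β) (-α) (by linarith) (by linarith) (by linarith)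
        (by rw [eb, abs_neg, ← e]; exact hc) (by rw [ea, eb, e])).elim
    · exact h'
    · exact (key (-α) (-β) (by linarith) (by linarith) (by linarith)
        (by rw [ea, abs_neg]; exact hc) (by rw [ea, eb, e])).elim
  · subst h
    simp at e
    rcases lt_trichotomy β 0 with h' | h' | h'
    · linarith [b2 h']
    · exact h'.symm
    · linarith [b1 h']
  · have hb0 : 0 < β := by
      by_contra hcon
      rcases (not_lt.1 hcon).eq_or_lt with h' | h'
      · have := a1 h
        rw [e, h'] at this; simp at this
      · linarith [a1 h, b2 h']
    rw [abs_lt] at ha hb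
    rcases lt_trichotomy α β with h' | h' | h'
    · exact (key α β h h' hb.2 hc e).elim
    · exact h'
    · exact (key β α hb0 h' ha.2 (by rw [← e]; exact hc) e.symm).elim

/-- The conjugated map on the strip. -/
noncomputable def auxG (a₁ a₂ : ℝ) (σ : Measure ℝ) (ζ : ℂ) : ℂ :=
  ζ + fFour a₁ a₂ σ (-(Complex.exp ζ))

theorem exp_slit (ζ : ℂ) (h : |ζ.im| < Real.pi) : Complex.exp ζ ∈ slitPlane := by
  rw [abs_lt] at h
  rw [mem_slitPlane_iff_arg]
  refine ⟨?_, Complex.exp_ne_zero _⟩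
  rw [← Complex.log_im, Complex.log_exp h.1 h.2.le]
  exact h.2.ne

theorem auxG_im (a₁ a₂ : ℝ) (σ : Measure ℝ) [IsFiniteMeasure σ]
    (hs : σ (Set.Iic 0) = 0) (ζ : ℂ) (h : |ζ.im| < Real.pi) :
    (auxG a₁ a₂ σ ζ).im =
      ζ.im + (Real.exp ζ.re * auxP a₁ a₂ σ (Complex.exp ζ)) * Real.sin ζ.im := by
  unfold auxG
  rw [add_im, aux_im a₁ a₂ σ hs _ (exp_slit ζ h), Complex.exp_im]
  ring

theorem auxG_conj (a₁ a₂ : ℝ) (σ : Measure ℝ) (ζ : ℂ) :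
    auxG a₁ a₂ σ (starRingEnd ℂ ζ) = starRingEnd ℂ (auxG a₁ a₂ σ ζ) := by
  unfold auxG
  rw [map_add, ← aux_conj, map_neg, ← Complex.exp_conj]

theorem auxG_inverse (a₁ a₂ : ℝ) (ha₁ : 0 ≤ a₁) (ha₂ : 0 ≤ a₂) (σ : Measure ℝ)
    [IsFiniteMeasure σ] (hs : σ (Set.Iic 0) = 0) :
    ∃ G : ℂ → ℂ, (∀ w : ℂ, |w.im| < Real.pi → |(G w).im| < Real.pi ∧ auxG a₁ a₂ σ (G w) = w) ∧
      (∀ ζ : ℂ, |ζ.im| < Real.pi → |(auxG a₁ a₂ σ ζ).im| < Real.pi →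
        ζ = G (auxG a₁ a₂ σ ζ)) ∧
      DifferentiableOn ℂ G {w : ℂ | |w.im| < Real.pi} ∧
      (∀ w₁ w₂ : ℂ, |w₁.im| < Real.pi → w₁.im = w₂.im → w₁.re < w₂.re →
        (G w₁).re < (G w₂).re) := by
  have hopen : IsOpen {w : ℂ | |w.im| < Real.pi} :=
    isOpen_lt (Complex.continuous_im.abs) continuous_const
  have hPnn : ∀ Z, 0 ≤ auxP a₁ a₂ σ Z := auxP_nonneg a₁ a₂ ha₁ ha₂ σ
  have hKnn : ∀ ζ : ℂ, 0 ≤ Real.exp ζ.re * auxP a₁ a₂ σ (Complex.exp ζ) := fun ζ =>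
    mul_nonneg (Real.exp_pos _).le (hPnn _)
  have hder : ∀ ζ : ℂ, |ζ.im| < Real.pi → HasDerivAt (auxG a₁ a₂ σ)
      (1 + Complex.exp ζ * auxD a₁ a₂ σ (Complex.exp ζ)) ζ := by
    intro ζ h
    have h1 := (aux_hasDerivAt a₁ a₂ σ hs _ (exp_slit ζ h)).comp ζ (Complex.hasDerivAt_exp ζ)
    have h2 := (hasDerivAt_id ζ).add h1
    rw [mul_comm (Complex.exp ζ)]
    exact h2
  have hXP : ∀ ζ : ℂ, |ζ.im| < Real.pi → |(auxG a₁ a₂ σ ζ).im| < Real.pi →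
      -1 < (Complex.exp ζ).re * auxP a₁ a₂ σ (Complex.exp ζ) := by
    intro ζ h1 h2
    rw [auxG_im a₁ a₂ σ hs ζ h1] at h2
    have := trig_cos ζ.im _ (hKnn ζ) h1 h2
    rw [Complex.exp_re]
    linarith
  have hnsq : ∀ ζ : ℂ, normSq (Complex.exp ζ) = Real.exp ζ.re ^ 2 := by
    intro ζ
    rw [normSq_eq_norm_sq, Complex.norm_exp]
  have hMr : 0 ≤ σ.real univ := measureReal_nonneg
  apply strip_abstract (auxG a₁ a₂ σ)
    (fun ζ => 1 + Complex.exp ζ * auxD a₁ a₂ σ (Complex.exp ζ)) (1 + a₁ + a₂ + σ.real univ)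
  · intro ζ h
    have han : AnalyticAt ℂ (auxG a₁ a₂ σ) ζ := by
      refine DifferentiableOn.analyticAt (s := {w : ℂ | |w.im| < Real.pi}) ?_ (hopen.mem_nhds h)
      intro w hw
      exact (hder w hw).differentiableAt.differentiableWithinAt
    have := han.hasStrictDerivAt
    rwa [(hder ζ h).deriv] at this
  · intro ζ h1 h2
    have h3 := hXP ζ h1 h2
    have h4 := aux_dre a₁ a₂ σ hs _ (exp_slit ζ h1)
    rw [add_re, one_re]
    linarith
  · intro s α β hα hβ hc he
    rw [auxG_im a₁ a₂ σ hs ⟨s, α⟩ hα] at hc he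
    rw [auxG_im a₁ a₂ σ hs ⟨s, β⟩ hβ] at he
    refine trig_uniq (fun x => Real.exp s * auxP a₁ a₂ σ (Complex.exp ⟨s, x⟩))
      (fun x => hKnn ⟨s, x⟩) ?_ α β hα hβ hc he
    intro x y hx hy hxy
    apply mul_le_mul_of_nonneg_left _ (Real.exp_pos s).le
    apply auxP_mono a₁ a₂ σ hs _ _ (exp_slit ⟨s, x⟩ hx) (exp_slit ⟨s, y⟩ hy)
    · rw [hnsq, hnsq]
    · rw [Complex.exp_re, Complex.exp_re]
      apply mul_le_mul_of_nonneg_left _ (Real.exp_pos s).le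
      change Real.cos y ≤ Real.cos x
      rw [← Real.cos_abs x, ← Real.cos_abs y]
      exact Real.cos_le_cos_of_nonneg_of_le_pi (abs_nonneg _) hy.le hxy
  · intro s c hc
    have hcont : ∀ α : ℝ, |α| < Real.pi →
        ContinuousAt (fun α : ℝ => (auxG a₁ a₂ σ ⟨s, α⟩).im) α := by
      intro α hα
      have h1 : ContinuousAt (auxG a₁ a₂ σ) ⟨s, α⟩ := (hder ⟨s, α⟩ hα).continuousAt
      have h2 : Continuous (fun α : ℝ => (⟨s, α⟩ : ℂ)) := by
        have : (fun α : ℝ => (⟨s, α⟩ : ℂ)) = fun α : ℝ => (s : ℂ) + α * I := by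
          funext α; apply Complex.ext <;> simp
        rw [this]; fun_prop
      have h3 : ContinuousAt (auxG a₁ a₂ σ ∘ (fun α : ℝ => (⟨s, α⟩ : ℂ))) α :=
        ContinuousAt.comp h1 h2.continuousAt
      exact Complex.continuous_im.continuousAt.comp h3
    have h0 : (auxG a₁ a₂ σ ⟨s, 0⟩).im = 0 := by
      rw [auxG_im a₁ a₂ σ hs ⟨s, 0⟩ (by simp [Real.pi_pos])]; simp
    have hcv := auxG_im a₁ a₂ σ hs ⟨s, c⟩ hc
    have hk := hKnn ⟨s, c⟩
    simp only at hcv hk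
    have hc' := abs_lt.1 hc
    rcases le_total 0 c with h | h
    · have hsn := Real.sin_nonneg_of_nonneg_of_le_pi h hc'.2.le
      have := intermediate_value_Icc h (f := fun α : ℝ => (auxG a₁ a₂ σ ⟨s, α⟩).im)
        (fun α hα => (hcont α (abs_lt.2 ⟨by linarith [hα.1, Real.pi_pos],
          by linarith [hα.2]⟩)).continuousWithinAt)
      obtain ⟨α, hα, he⟩ := this (show c ∈ Icc _ _ from
        ⟨by simp only [h0]; exact h, by simp only [hcv]; nlinarith [mul_nonneg hk hsn]⟩)
      exact ⟨α, abs_lt.2 ⟨by linarith [hα.1, Real.pi_pos], by linarith [hα.2]⟩, he⟩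
    · have hsn := Real.sin_nonpos_of_nonpos_of_neg_pi_le h hc'.1.le
      have := intermediate_value_Icc h (f := fun α : ℝ => (auxG a₁ a₂ σ ⟨s, α⟩).im)
        (fun α hα => (hcont α (abs_lt.2 ⟨by linarith [hα.1],
          by linarith [hα.2, Real.pi_pos]⟩)).continuousWithinAt)
      obtain ⟨α, hα, he⟩ := this (show c ∈ Icc _ _ from
        ⟨by simp only [hcv]; nlinarith [mul_nonneg hk (neg_nonneg.2 hsn)],
          by simp only [h0]; exact h⟩)
      exact ⟨α, abs_lt.2 ⟨by linarith [hα.1], by linarith [hα.2, Real.pi_pos]⟩, he⟩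
  · intro ζ h1 h2 h3
    have hn : 1 ≤ normSq (Complex.exp ζ) := by
      rw [hnsq]; exact one_le_pow₀ (Real.one_le_exp h3)
    obtain ⟨b1, b2⟩ := aux_lower_re a₁ a₂ ha₁ ha₂ σ hs _ (exp_slit ζ h1) hn
    have h4 := hXP ζ h1 h2
    unfold auxG
    rw [add_re]
    rcases le_total 0 (Complex.exp ζ).re with h | h
    · linarith [b1 h]
    · linarith [b2 h]
  · intro ζ h1 h2 h3
    have hn : normSq (Complex.exp ζ) ≤ 1 := by
      rw [hnsq]; exact pow_le_one₀ (Real.exp_pos _).le (Real.exp_le_one_iff.2 h3)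
    obtain ⟨b1, b2⟩ := aux_upper_re a₁ a₂ ha₁ ha₂ σ hs _ (exp_slit ζ h1) hn
    have h4 := hXP ζ h1 h2
    unfold auxG
    rw [add_re]
    rcases le_total 0 (Complex.exp ζ).re with h | h
    · linarith [b1 h]
    · linarith [b2 h]

theorem log_neg_of_upper (z : ℂ) (hz : 0 < z.im) :
    Complex.log z = Complex.log (-z) + Real.pi * I := by
  apply Complex.ext
  · simp [Complex.log_re]
  · simp [Complex.log_im, arg_neg_eq_arg_sub_pi_of_im_pos hz]

theorem log_strip (Z : ℂ) (hZ : Z ∈ slitPlane) : |(Complex.log Z).im| < Real.pi := by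
  rw [mem_slitPlane_iff_arg] at hZ
  rw [Complex.log_im, abs_lt]
  exact ⟨neg_pi_lt_arg Z, lt_of_le_of_ne (arg_le_pi Z) hZ.1⟩

theorem neg_slit (z : ℂ) (hz : z ∈ kreinDomain) : -z ∈ slitPlane := by
  rw [mem_slitPlane_iff]
  rcases hz with h | h
  · right; simpa using h
  · left; simpa using h

theorem fFive_eq (a₁ a₂ : ℝ) (σ : Measure ℝ) (z : ℂ) (hz : 0 < z.im) :
    fFive a₁ a₂ σ z = auxG a₁ a₂ σ (Complex.log (-z)) + Real.pi * I := by
  unfold fFive auxG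
  have : -z ≠ 0 := by
    intro h
    rw [neg_eq_zero] at h
    simp [h] at hz
  rw [Complex.exp_log this, neg_neg, log_neg_of_upper z hz]
  ring

/-- Lemma 5.3: f₅ takes every value of the strip 0 < Im w < π precisely once in ℂ⁺,
and z ↦ f₅⁻¹(Log z) extends to a function of the Krein class 𝒦. -/
theorem strip_value_once (a₁ a₂ : ℝ) (ha₁ : 0 ≤ a₁) (ha₂ : 0 ≤ a₂)
    (σ : Measure ℝ) (hσfin : IsFiniteMeasure σ)
    (hσsupp : σ (Set.Iic 0) = 0) (hσne : σ ≠ 0) :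
    (∀ w : ℂ, 0 < w.im → w.im < Real.pi →
      ∃! z : ℂ, z ∈ upperHalf ∧ fFive a₁ a₂ σ z = w) ∧
    ∃ h : ℂ → ℂ, kreinClass h ∧
      ∀ z ∈ upperHalf, h z ∈ upperHalf ∧ fFive a₁ a₂ σ (h z) = Complex.log z := by
  obtain ⟨G, hG, hGu, hGd, hGm⟩ := auxG_inverse a₁ a₂ ha₁ ha₂ σ hσsupp
  have hKnn : ∀ ζ : ℂ, 0 ≤ Real.exp ζ.re * auxP a₁ a₂ σ (Complex.exp ζ) := fun ζ =>
    mul_nonneg (Real.exp_pos _).le (auxP_nonneg a₁ a₂ ha₁ ha₂ σ _)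
  -- the sign of the imaginary part
  have hGneg : ∀ w : ℂ, |w.im| < Real.pi → w.im < 0 → (G w).im < 0 := by
    intro w hw h
    obtain ⟨h1, h2⟩ := hG w hw
    have h3 := auxG_im a₁ a₂ σ hσsupp (G w) h1
    rw [h2] at h3
    by_contra hcon
    rcases (not_lt.1 hcon).eq_or_lt with h' | h'
    · rw [← h'] at h3; simp at h3; linarith
    · have := (trig_sign (G w).im _ (hKnn (G w)) h1).1 h'
      linarith
  have hconj : ∀ w : ℂ, |w.im| < Real.pi → G (starRingEnd ℂ w) = starRingEnd ℂ (G w) := by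
    intro w hw
    obtain ⟨h1, h2⟩ := hG w hw
    have h3 : auxG a₁ a₂ σ (starRingEnd ℂ (G w)) = starRingEnd ℂ w := by
      rw [auxG_conj, h2]
    have h4 := hGu (starRingEnd ℂ (G w)) (by simpa using h1) (by rw [h3]; simpa using hw)
    rw [h3] at h4
    exact h4.symm
  -- points `-exp (G w)` with `Im w < 0`
  have hpt : ∀ w : ℂ, |w.im| < Real.pi → w.im < 0 →
      0 < (-Complex.exp (G w)).im ∧ fFive a₁ a₂ σ (-Complex.exp (G w)) = w + Real.pi * I := by
    intro w hw h
    obtain ⟨h1, h2⟩ := hG w hw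
    have h3 := abs_lt.1 h1
    have h4 : 0 < (-Complex.exp (G w)).im := by
      rw [neg_im, Complex.exp_im]
      have := Real.sin_neg_of_neg_of_neg_pi_lt (hGneg w hw h) h3.1
      nlinarith [Real.exp_pos (G w).re]
    refine ⟨h4, ?_⟩
    rw [fFive_eq a₁ a₂ σ _ h4, neg_neg, Complex.log_exp h3.1 h3.2.le, h2]
  refine ⟨?_, fun z => -Complex.exp (G (Complex.log (-z))), ?_, ?_⟩
  · intro w hw0 hw1
    have e1 : (w - Real.pi * I).im = w.im - Real.pi := by simp
    have h1 : |(w - Real.pi * I).im| < Real.pi := by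
      rw [e1, abs_lt]; constructor <;> linarith
    obtain ⟨p1, p2⟩ := hpt (w - Real.pi * I) h1 (by rw [e1]; linarith)
    refine ⟨-Complex.exp (G (w - Real.pi * I)), ⟨p1, by rw [p2]; ring⟩, ?_⟩
    rintro z ⟨hz, hfz⟩
    have hz' : 0 < z.im := hz
    have hsl : -z ∈ slitPlane := neg_slit z (Or.inl hz'.ne')
    rw [fFive_eq a₁ a₂ σ z hz'] at hfz
    have e2 : auxG a₁ a₂ σ (Complex.log (-z)) = w - Real.pi * I := by rw [← hfz]; ring
    have h2 := hGu (Complex.log (-z)) (log_strip _ hsl) (by rw [e2]; exact h1)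
    rw [e2] at h2
    rw [← h2, Complex.exp_log (slitPlane_ne_zero hsl), neg_neg]
  · refine ⟨?_, ?_, ?_, ?_, ?_⟩
    · intro z hz
      have hsl := neg_slit z hz
      apply DifferentiableAt.differentiableWithinAt
      have hopen : IsOpen {w : ℂ | |w.im| < Real.pi} :=
        isOpen_lt (Complex.continuous_im.abs) continuous_const
      have h1 : DifferentiableAt ℂ G (Complex.log (-z)) :=
        hGd.differentiableAt (hopen.mem_nhds (log_strip _ hsl))
      have h2 : DifferentiableAt ℂ (fun z : ℂ => Complex.log (-z)) z :=
        (differentiableAt_id.neg).clog hsl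
      exact (DifferentiableAt.comp z h1 h2).cexp.neg
    · intro z hz
      have hsl := neg_slit z hz
      have ha := (mem_slitPlane_iff_arg.1 hsl).1
      change -Complex.exp (G (Complex.log (-(starRingEnd ℂ z)))) = _
      rw [← map_neg, Complex.log_conj _ ha, hconj _ (log_strip _ hsl), Complex.exp_conj, map_neg]
    · intro z hz
      have hz' : 0 < z.im := hz
      have hsl : -z ∈ slitPlane := neg_slit z (Or.inl hz'.ne')
      refine (hpt _ (log_strip _ hsl) ?_).1.le
      rw [Complex.log_im, arg_neg_iff]
      simpa using hz'
    · intro x hx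
      have hr : Complex.log (-(x : ℂ)) = ((Real.log (-x) : ℝ) : ℂ) := by
        rw [Complex.ofReal_log (by linarith)]; simp
      have hc := hconj ((Real.log (-x) : ℝ) : ℂ) (by simp [Real.pi_pos])
      rw [Complex.conj_ofReal] at hc
      have him : (G ((Real.log (-x) : ℝ) : ℂ)).im = 0 := Complex.conj_eq_iff_im.1 hc.symm
      change (-Complex.exp (G (Complex.log (-(x : ℂ))))).im = 0 ∧
        (-Complex.exp (G (Complex.log (-(x : ℂ))))).re ≤ 0
      rw [hr, neg_im, neg_re, Complex.exp_im, Complex.exp_re, him]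
      simp [(Real.exp_pos _).le]
    · have hre : Tendsto (fun x : ℝ => (G ((Real.log x : ℝ) : ℂ)).re)
          (nhdsWithin 0 (Set.Ioi 0)) atBot := by
        rw [tendsto_atBot]
        intro M
        have hMim : (auxG a₁ a₂ σ (M : ℂ)).im = 0 := by
          rw [auxG_im a₁ a₂ σ hσsupp _ (by simp [Real.pi_pos])]; simp
        have hM := hGu (M : ℂ) (by simp [Real.pi_pos]) (by rw [hMim]; simp [Real.pi_pos])
        filter_upwards [Real.tendsto_log_nhdsGT_zero.eventually
          (eventually_lt_atBot (auxG a₁ a₂ σ (M : ℂ)).re)] with x hx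
        have := hGm ((Real.log x : ℝ) : ℂ) (auxG a₁ a₂ σ (M : ℂ)) (by simp [Real.pi_pos])
          (by rw [hMim]; simp) (by simpa using hx)
        rw [← hM] at this
        simpa using this.le
      rw [tendsto_zero_iff_norm_tendsto_zero]
      refine (Real.tendsto_exp_atBot.comp hre).congr' ?_
      filter_upwards [self_mem_nhdsWithin] with x hx
      have hx' : (0 : ℝ) < x := hx
      rw [neg_neg, norm_neg, Complex.norm_exp, Function.comp_apply,
        Complex.ofReal_log hx'.le]
  · intro z hz
    have hz' : 0 < z.im := hz
    have hsl : -z ∈ slitPlane := neg_slit z (Or.inl hz'.ne')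
    obtain ⟨p1, p2⟩ := hpt _ (log_strip _ hsl) (by
      rw [Complex.log_im, arg_neg_iff]
      simpa using hz')
    refine ⟨p1, ?_⟩
    change fFive a₁ a₂ σ (-Complex.exp (G (Complex.log (-z)))) = _
    rw [p2, log_neg_of_upper z hz']
end

section
/- Let Q be an analytic function from the open unit disk 𝔻 into the closed unit disk with Q(0) ≠ 0. Then the function g : 𝔻 ∖ {0} → ℂ defined by g(z) = Q(z)/z takes every value in ℂ ∖ closure(𝔻) precisely once; that is, for every w ∈ ℂ with |w| > 1 there is a unique z ∈ 𝔻 ∖ {0} with Q(z)/z = w. -/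
open MeasureTheory Complex Filter Set

/-- Open unit disk. -/
def unitDisk : Set ℂ := Metric.ball 0 1

/-- The class ℳ_* of Borel probability measures on the unit circle 𝕋
with nonzero first moment. -/
def MStar (μ : Measure ℂ) : Prop :=
  IsProbabilityMeasure μ ∧ μ ((Metric.sphere (0 : ℂ) 1)ᶜ) = 0 ∧ (∫ ξ, ξ ∂μ) ≠ 0

/-- ψ_μ(z) = ∫ zξ/(1 − zξ) dμ(ξ). -/
noncomputable def psiStar (μ : Measure ℂ) (z : ℂ) : ℂ :=
  ∫ ξ, (z * ξ) / (1 - z * ξ) ∂μ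

/-- Q_μ = ψ_μ/(1 + ψ_μ). -/
noncomputable def QStar (μ : Measure ℂ) (z : ℂ) : ℂ :=
  psiStar μ z / (1 + psiStar μ z)

/-- The class 𝒮_*: Schur functions Q with Q(0) = 0 and Q′(0) ≠ 0. -/
def schurStar (Q : ℂ → ℂ) : Prop :=
  DifferentiableOn ℂ Q unitDisk ∧ (∀ z ∈ unitDisk, ‖Q z‖ ≤ 1) ∧
  Q 0 = 0 ∧ deriv Q 0 ≠ 0

open ComplexConjugate in
/-- The disk involution exchanging `a` and `0`. -/
noncomputable def diskInv (a z : ℂ) : ℂ := (a - z) / (1 - conj a * z)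

open ComplexConjugate in
lemma diskInv_den {a z : ℂ} (ha : ‖a‖ < 1) (hz : ‖z‖ < 1) : 1 - conj a * z ≠ 0 := by
  intro h
  have h1 : ‖conj a * z‖ = 1 := by rw [← sub_eq_zero.1 h]; simp
  rw [norm_mul, RCLike.norm_conj] at h1
  nlinarith [norm_nonneg a, norm_nonneg z]

open ComplexConjugate in
lemma diskInv_norm_lt {a z : ℂ} (ha : ‖a‖ < 1) (hz : ‖z‖ < 1) : ‖diskInv a z‖ < 1 := by
  have hd := diskInv_den ha hz
  rw [diskInv, norm_div, div_lt_one (norm_pos_iff.2 hd)]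
  refine lt_of_pow_lt_pow_left₀ 2 (norm_nonneg _) ?_
  have e : ‖1 - conj a * z‖ ^ 2 - ‖a - z‖ ^ 2 = (1 - ‖a‖ ^ 2) * (1 - ‖z‖ ^ 2) := by
    simp only [Complex.sq_norm, Complex.normSq_apply]
    simp
    ring
  have h1 : 0 < 1 - ‖a‖ ^ 2 := by nlinarith [norm_nonneg a]
  have h2 : 0 < 1 - ‖z‖ ^ 2 := by nlinarith [norm_nonneg z]
  nlinarith [mul_pos h1 h2]

open ComplexConjugate in
lemma diskInv_invol {a z : ℂ} (ha : ‖a‖ < 1) (hz : ‖z‖ < 1) : diskInv a (diskInv a z) = z := by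
  have hd := diskInv_den ha hz
  have hd2 := diskInv_den ha (diskInv_norm_lt ha hz)
  have ha2 := diskInv_den ha ha
  have : diskInv a (diskInv a z) * (1 - conj a * diskInv a z)
      = z * (1 - conj a * diskInv a z) := by
    have : diskInv a (diskInv a z) * (1 - conj a * diskInv a z) = a - diskInv a z :=
      div_mul_cancel₀ _ hd2
    rw [this]
    have e : diskInv a z * (1 - conj a * z) = a - z := div_mul_cancel₀ _ hd
    linear_combination -e
  exact mul_right_cancel₀ hd2 this

lemma diskInv_eq_zero {a z : ℂ} (ha : ‖a‖ < 1) (hz : ‖z‖ < 1) (h : diskInv a z = 0) : a = z := by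
  rw [diskInv, div_eq_zero_iff] at h
  exact sub_eq_zero.1 (h.resolve_right (diskInv_den ha hz))

lemma diskInv_diff {a : ℂ} (ha : ‖a‖ < 1) : DifferentiableOn ℂ (diskInv a) (Metric.ball 0 1) := by
  unfold diskInv
  refine DifferentiableOn.div (by fun_prop) (by fun_prop) ?_
  intro z hz
  exact diskInv_den ha (by simpa using hz)

lemma strict_schwarz_pick {f : ℂ → ℂ} {r : ℝ} (hr : r < 1)
    (hf : DifferentiableOn ℂ f (Metric.ball 0 1)) (hb : ∀ z, ‖z‖ < 1 → ‖f z‖ ≤ r)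
    {a b : ℂ} (ha : ‖a‖ < 1) (hb1 : ‖b‖ < 1) (hab : a ≠ b) :
    ‖diskInv (f a) (f b)‖ < ‖diskInv a b‖ := by
  have hfa : ‖f a‖ < 1 := (hb a ha).trans_lt hr
  have hsub : Metric.closedBall (0 : ℂ) r ⊆ Metric.ball 0 1 := Metric.closedBall_subset_ball hr
  have hc : ContinuousOn (fun z => ‖diskInv (f a) z‖) (Metric.closedBall 0 r) :=
    ((diskInv_diff hfa).continuousOn.mono hsub).norm
  obtain ⟨m, hm, hmax⟩ := (isCompact_closedBall (0 : ℂ) r).exists_isMaxOn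
    ⟨f a, by simpa using hb a ha⟩ hc
  have hm1 : ‖diskInv (f a) m‖ < 1 := diskInv_norm_lt hfa (by simpa using hsub hm)
  have hmaps1 : MapsTo (diskInv a) (Metric.ball 0 1) (Metric.ball 0 1) := by
    intro z hz
    simpa using diskInv_norm_lt ha (by simpa using hz)
  have hmaps2 : MapsTo f (Metric.ball 0 1) (Metric.ball 0 1) := by
    intro z hz
    simpa using (hb z (by simpa using hz)).trans_lt hr
  have h00 : diskInv (f a) (f (diskInv a 0)) = 0 := by simp [diskInv]
  have key := Complex.dist_le_div_mul_dist_of_mapsTo_ball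
    (f := fun z => diskInv (f a) (f (diskInv a z))) (c := 0) (R₁ := 1)
    (R₂ := ‖diskInv (f a) m‖) (z := diskInv a b)
    (((diskInv_diff hfa).comp hf hmaps2).comp (diskInv_diff ha) hmaps1)
    (by
      intro z hz
      simp only [h00, Metric.mem_closedBall, dist_zero_right]
      refine hmax ?_
      simpa using hb _ (by simpa using hmaps1 hz))
    (by simpa using diskInv_norm_lt ha hb1)
  simp only [h00, dist_zero_right, div_one, diskInv_invol ha hb1] at key
  have hpos : 0 < ‖diskInv a b‖ := norm_pos_iff.2 fun h => hab (diskInv_eq_zero ha hb1 h)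
  nlinarith

lemma exists_fixed_s14 {f : ℂ → ℂ} {r : ℝ} (hr : r < 1)
    (hf : DifferentiableOn ℂ f (Metric.ball 0 1)) (hb : ∀ z, ‖z‖ < 1 → ‖f z‖ ≤ r) :
    ∃ z, ‖z‖ < 1 ∧ f z = z := by
  have hsub : Metric.closedBall (0 : ℂ) r ⊆ Metric.ball 0 1 := Metric.closedBall_subset_ball hr
  have hfc := hf.continuousOn.mono hsub
  have hc : ContinuousOn (fun z => ‖diskInv z (f z)‖) (Metric.closedBall 0 r) := by
    unfold diskInv
    refine ContinuousOn.norm (ContinuousOn.div (by fun_prop) ?_ ?_)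
    · exact continuousOn_const.sub (Complex.continuous_conj.continuousOn.mul hfc)
    · intro z hz
      have hz1 : ‖z‖ < 1 := by simpa using hsub hz
      exact diskInv_den hz1 ((hb z hz1).trans_lt hr)
  obtain ⟨m, hm, hmin⟩ := (isCompact_closedBall (0 : ℂ) r).exists_isMinOn
    ⟨f 0, by simpa using hb 0 (by simp)⟩ hc
  have hm1 : ‖m‖ < 1 := by simpa using hsub hm
  refine ⟨m, hm1, ?_⟩
  by_contra hne
  have h1 := strict_schwarz_pick hr hf hb hm1 ((hb m hm1).trans_lt hr) (Ne.symm hne)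
  have h2 : ‖diskInv m (f m)‖ ≤ ‖diskInv (f m) (f (f m))‖ :=
    hmin (by simpa using hb m hm1)
  linarith

/-- Lemma 5.4: if Q is a Schur function with Q(0) ≠ 0, then z ↦ Q(z)/z takes every
value outside the closed unit disk precisely once in 𝔻 ∖ {0}. -/
theorem schur_quotient_value_once (Q : ℂ → ℂ)
    (hQ : DifferentiableOn ℂ Q unitDisk) (hbd : ∀ z ∈ unitDisk, ‖Q z‖ ≤ 1)
    (h0 : Q 0 ≠ 0) :
    ∀ w : ℂ, 1 < ‖w‖ → ∃! z : ℂ, z ∈ unitDisk ∧ z ≠ 0 ∧ Q z / z = w := by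
  intro w hw
  have hw0 : w ≠ 0 := by rintro rfl; simp at hw; linarith
  have hmem : ∀ z, z ∈ unitDisk ↔ ‖z‖ < 1 := fun z => by simp [unitDisk]
  have hr : ‖w‖⁻¹ < 1 := inv_lt_one_of_one_lt₀ hw
  have hf : DifferentiableOn ℂ (fun z => Q z / w) (Metric.ball 0 1) :=
    DifferentiableOn.div_const hQ w
  have hb : ∀ z, ‖z‖ < 1 → ‖(fun z => Q z / w) z‖ ≤ ‖w‖⁻¹ := by
    intro z hz
    simp only [norm_div]
    rw [div_eq_mul_inv]
    exact mul_le_of_le_one_left (by positivity) (hbd z ((hmem z).2 hz))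
  have hiff : ∀ z, z ≠ 0 → (Q z / z = w ↔ Q z / w = z) := by
    intro z hz
    rw [div_eq_iff hz, div_eq_iff hw0, mul_comm]
  obtain ⟨z, hz1, hz⟩ := exists_fixed_s14 hr hf hb
  have hz0 : z ≠ 0 := by
    rintro rfl
    simp only [div_eq_zero_iff] at hz
    exact hz.elim h0 hw0
  refine ⟨z, ⟨(hmem z).2 hz1, hz0, (hiff z hz0).2 hz⟩, ?_⟩
  rintro y ⟨hy1, hy0, hy⟩
  by_contra hne
  have := strict_schwarz_pick hr hf hb ((hmem y).1 hy1) hz1 hne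
  have hy2 := (hiff y hy0).1 hy
  simp only [hz, hy2, lt_self_iff_false] at this
end

section
/- Let μ₁ and μ₂ be measures in ℳ_*. Then for every z ∈ 𝔻 ∖ {0} there exist unique points z₁ ∈ 𝔻 and z₂ ∈ 𝔻 with (z₁, z₂) ≠ (0,0) such that z₂ = z·Q_{μ₁}(z₁)/z₁ and z₁ = z·Q_{μ₂}(z₂)/z₂ (where Q_{μ_j}(ζ)/ζ is understood as its analytic extension Q_{μ_j}′(0) at ζ = 0). -/
open MeasureTheory Complex Filter Set

/-- Q_μ(ζ)/ζ, extended analytically by Q_μ′(0) at ζ = 0. -/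
noncomputable def QDiv (μ : Measure ℂ) (ζ : ℂ) : ℂ :=
  if ζ = 0 then deriv (QStar μ) 0 else QStar μ ζ / ζ

lemma moebius_den_ne {a w : ℂ} (ha : ‖a‖ < 1) (hw : ‖w‖ < 1) :
    1 + (starRingEnd ℂ) a * w ≠ 0 := by
  intro h
  have h1 : (starRingEnd ℂ) a * w = -1 := by linear_combination h
  have h2 : ‖(starRingEnd ℂ) a * w‖ = 1 := by rw [h1]; simp
  rw [norm_mul, Complex.norm_conj] at h2
  nlinarith [norm_nonneg a, norm_nonneg w]

lemma moebius_norm_lt {a w : ℂ} (ha : ‖a‖ < 1) (hw : ‖w‖ < 1) :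
    ‖(w + a) / (1 + (starRingEnd ℂ) a * w)‖ < 1 := by
  have hd := moebius_den_ne ha hw
  rw [norm_div, div_lt_one (norm_pos_iff.mpr hd)]
  apply lt_of_pow_lt_pow_left₀ 2 (norm_nonneg _)
  have key : ‖1 + (starRingEnd ℂ) a * w‖ ^ 2 - ‖w + a‖ ^ 2 = (1 - ‖a‖ ^ 2) * (1 - ‖w‖ ^ 2) := by
    simp only [← Complex.normSq_eq_norm_sq, Complex.normSq_apply]
    simp
    ring
  have h1 : 0 < 1 - ‖a‖ ^ 2 := by nlinarith [norm_nonneg a]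
  have h2 : 0 < 1 - ‖w‖ ^ 2 := by nlinarith [norm_nonneg w]
  nlinarith [mul_pos h1 h2]

lemma moebius_diff {a : ℂ} (ha : ‖a‖ < 1) :
    DifferentiableOn ℂ (fun w => (w + a) / (1 + (starRingEnd ℂ) a * w)) (Metric.ball 0 1) := by
  apply DifferentiableOn.div
  · fun_prop
  · fun_prop
  · intro w hw
    exact moebius_den_ne ha (by simpa using hw)

lemma fixed_unique_s15 {F : ℂ → ℂ} {r : ℝ} (hr : r < 1)
    (hF : DifferentiableOn ℂ F (Metric.ball 0 1)) (hb : ∀ w ∈ Metric.ball (0 : ℂ) 1, ‖F w‖ ≤ r)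
    {a b : ℂ} (ha : ‖a‖ < 1) (hbb : ‖b‖ < 1) (hFa : F a = a) (hFb : F b = b) : a = b := by
  have hna : ‖-a‖ < 1 := by simpa using ha
  set φ : ℂ → ℂ := fun w => (w + a) / (1 + (starRingEnd ℂ) a * w) with hφ
  set ψ : ℂ → ℂ := fun w => (w + -a) / (1 + (starRingEnd ℂ) (-a) * w) with hψ
  have hφd : DifferentiableOn ℂ φ (Metric.ball 0 1) := moebius_diff ha
  have hψd : DifferentiableOn ℂ ψ (Metric.ball 0 1) := moebius_diff hna
  have hφm : MapsTo φ (Metric.ball 0 1) (Metric.ball 0 1) := by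
    intro w hw
    rw [mem_ball_zero_iff]
    exact moebius_norm_lt ha (by simpa using hw)
  have hr0 : 0 ≤ r := (norm_nonneg _).trans (hb 0 (by simp))
  have hsub : Metric.closedBall (0 : ℂ) r ⊆ Metric.ball 0 1 := Metric.closedBall_subset_ball hr
  have hFm : MapsTo F (Metric.ball 0 1) (Metric.ball 0 1) := by
    intro w hw
    apply hsub
    simpa using hb w hw
  obtain ⟨m, hm, hmax⟩ := (isCompact_closedBall (0 : ℂ) r).exists_isMaxOn
    ⟨0, by simpa using hr0⟩ ((hψd.continuousOn.mono hsub).norm)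
  have hρ : ‖ψ m‖ < 1 := moebius_norm_lt hna (by simpa using hsub hm)
  have hφ0 : φ 0 = a := by simp [hφ]
  have hψa : ψ a = 0 := by simp [hψ]
  have hG0 : (ψ ∘ F ∘ φ) 0 = 0 := by simp [hφ0, hFa, hψa]
  have hwb : ‖ψ b‖ < 1 := moebius_norm_lt hna hbb
  have hφψ : φ (ψ b) = b := by
    have d1 : 1 + (starRingEnd ℂ) (-a) * b ≠ 0 := moebius_den_ne hna hbb
    have d2 : 1 + (starRingEnd ℂ) a * ψ b ≠ 0 := moebius_den_ne ha hwb
    have e1 : ψ b * (1 + (starRingEnd ℂ) (-a) * b) = b + -a := div_mul_cancel₀ _ d1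
    show (ψ b + a) / (1 + (starRingEnd ℂ) a * ψ b) = b
    rw [div_eq_iff d2]
    rw [map_neg] at e1
    linear_combination e1
  have hS := Complex.dist_le_div_mul_dist_of_mapsTo_ball (f := ψ ∘ F ∘ φ) (c := 0) (R₁ := 1)
    (R₂ := ‖ψ m‖) (z := ψ b)
    (hψd.comp (hF.comp hφd hφm) (hFm.comp hφm))
    (by
      intro w hw
      rw [hG0, mem_closedBall_zero_iff]
      exact hmax (by simpa using hb _ (hφm hw)))
    (by simpa using hwb)
  rw [hG0] at hS
  simp only [Function.comp, hφψ, hFb, dist_zero_right, div_one] at hS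
  have h0 : ψ b = 0 := by
    by_contra hne
    have := norm_pos_iff.mpr hne
    nlinarith
  rw [h0, hφ0] at hφψ
  exact hφψ

lemma fixed_step {F : ℂ → ℂ} {r : ℝ} (hr : r < 1)
    (hF : DifferentiableOn ℂ F (Metric.ball 0 1)) (hb : ∀ w ∈ Metric.ball (0 : ℂ) 1, ‖F w‖ ≤ r)
    {s t : ℝ} (hs : s ∈ Icc (0 : ℝ) 1) (ht : t ∈ Icc (0 : ℝ) 1) (hst : |s - t| < (1 - r) / 2)
    (h : ∃ w ∈ Metric.ball (0 : ℂ) 1, w - t * F w = 0) :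
    ∃ w ∈ Metric.ball (0 : ℂ) 1, w - s * F w = 0 := by
  by_contra hcon
  push Not at hcon
  obtain ⟨w, hw, hwt⟩ := h
  have hr0 : 0 ≤ r := (norm_nonneg _).trans (hb 0 (by simp))
  have hR : (1 + r) / 2 < 1 := by linarith
  have hR0 : (1 + r) / 2 ≠ 0 := by linarith
  have hd : DifferentiableOn ℂ (fun w => (w - s * F w)⁻¹) (Metric.ball 0 1) := by
    apply DifferentiableOn.inv
    · exact differentiableOn_id.sub (hF.const_mul _)
    · exact hcon
  have hdc : DiffContOnCl ℂ (fun w => (w - s * F w)⁻¹) (Metric.ball 0 ((1 + r) / 2)) := by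
    apply DifferentiableOn.diffContOnCl
    apply hd.mono
    rw [closure_ball _ hR0]
    exact Metric.closedBall_subset_ball hR
  have hsF : ∀ (u : ℝ), u ∈ Icc (0 : ℝ) 1 → ∀ v ∈ Metric.ball (0 : ℂ) 1, ‖(u : ℂ) * F v‖ ≤ r := by
    intro u hu v hv
    rw [norm_mul, Complex.norm_real, Real.norm_of_nonneg hu.1]
    nlinarith [hu.2, hu.1, hb v hv, norm_nonneg (F v)]
  have hwr : ‖w‖ ≤ r := by
    have : w = t * F w := sub_eq_zero.mp hwt
    rw [this]
    exact hsF t ht w hw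
  have hδ : 0 < (1 - r) / 2 := by linarith
  have hmain := Complex.norm_le_of_forall_mem_frontier_norm_le Metric.isBounded_ball hdc
    (C := ((1 - r) / 2)⁻¹) (z := w) (by
      intro v hv
      rw [frontier_ball _ hR0, mem_sphere_zero_iff_norm] at hv
      rw [norm_inv]
      apply inv_anti₀ hδ
      have h1 := norm_sub_norm_le v (s * F v)
      have h2 := hsF s hs v (by simp [hv, hR])
      linarith) (by
      apply subset_closure
      rw [mem_ball_zero_iff]
      linarith)
  rw [norm_inv, inv_le_inv₀ (norm_pos_iff.mpr (hcon w hw)) hδ] at hmain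
  have h3 : w - s * F w = ((t - s : ℝ) : ℂ) * F w := by
    push_cast
    linear_combination hwt
  rw [h3, norm_mul, Complex.norm_real, Real.norm_eq_abs, abs_sub_comm] at hmain
  nlinarith [abs_nonneg (s - t), hb w hw, norm_nonneg (F w)]

lemma fixed_exists_s15 {F : ℂ → ℂ} {r : ℝ} (hr : r < 1)
    (hF : DifferentiableOn ℂ F (Metric.ball 0 1)) (hb : ∀ w ∈ Metric.ball (0 : ℂ) 1, ‖F w‖ ≤ r) :
    ∃ w ∈ Metric.ball (0 : ℂ) 1, F w = w := by
  obtain ⟨n, hn⟩ := exists_nat_one_div_lt (show 0 < (1 - r) / 2 by linarith)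
  have hn0 : (0 : ℝ) < n + 1 := by positivity
  have key : ∀ k : ℕ, k ≤ n + 1 →
      ∃ w ∈ Metric.ball (0 : ℂ) 1, w - ((k / (n + 1) : ℝ) : ℂ) * F w = 0 := by
    intro k
    induction k with
    | zero => intro _; exact ⟨0, by simp, by simp⟩
    | succ k ih =>
      intro hk
      have hk' : ((k + 1 : ℕ) : ℝ) ≤ n + 1 := by exact_mod_cast hk
      have hk2 : (k : ℝ) ≤ n + 1 := by push_cast at hk'; linarith
      refine fixed_step hr hF hb ⟨by positivity, (div_le_one hn0).mpr hk'⟩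
        ⟨by positivity, (div_le_one hn0).mpr hk2⟩ ?_ (ih (by omega))
      have : ((k + 1 : ℕ) : ℝ) / (n + 1) - k / (n + 1) = 1 / (n + 1) := by
        push_cast; ring
      rw [this, abs_of_pos (by positivity)]
      exact hn
  obtain ⟨w, hw, h⟩ := key (n + 1) le_rfl
  refine ⟨w, hw, ?_⟩
  have h1 : (((n + 1 : ℕ) : ℝ) / (n + 1) : ℝ) = 1 := by
    push_cast; exact div_self hn0.ne'
  rw [h1] at h
  simp at h
  linear_combination -h

lemma psi_den {z ξ : ℂ} {R : ℝ} (hz : ‖z‖ ≤ R) (hξ : ‖ξ‖ = 1) : 1 - R ≤ ‖1 - z * ξ‖ := by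
  have := norm_sub_norm_le 1 (z * ξ)
  rw [norm_mul, hξ, norm_one] at this
  linarith

lemma psi_hasDeriv {μ : Measure ℂ} (h : MStar μ) {z : ℂ} (hz : ‖z‖ < 1) :
    Integrable (fun ξ => (z * ξ) / (1 - z * ξ)) μ ∧
    HasDerivAt (psiStar μ) (∫ ξ, ξ / (1 - z * ξ) ^ 2 ∂μ) z := by
  have := h.1
  have hae : ∀ᵐ ξ ∂μ, ‖ξ‖ = 1 := by
    have := h.2.1
    rw [← mem_ae_iff] at this
    filter_upwards [this] with ξ hξ
    simpa using hξ
  obtain ⟨R, hzR, hR⟩ := exists_between hz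
  have hR' : 0 < 1 - R := by linarith
  have hR0 : 0 ≤ R := (norm_nonneg z).trans hzR.le
  have hint : Integrable (fun ξ => (z * ξ) / (1 - z * ξ)) μ := by
    apply Integrable.of_bound (C := R / (1 - R))
    · exact Measurable.aestronglyMeasurable (by fun_prop)
    · filter_upwards [hae] with ξ hξ
      rw [norm_div, norm_mul, hξ, mul_one]
      exact div_le_div₀ hR0 hzR.le hR' (psi_den hzR.le hξ)
  refine ⟨hint, ?_⟩
  refine (hasDerivAt_integral_of_dominated_loc_of_deriv_le (s := Metric.ball 0 R)
    (F := fun z ξ => (z * ξ) / (1 - z * ξ)) (F' := fun z ξ => ξ / (1 - z * ξ) ^ 2)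
    (bound := fun _ => 1 / (1 - R) ^ 2)
    (Metric.isOpen_ball.mem_nhds (by simpa using hzR)) ?_ hint ?_ ?_ (integrable_const _) ?_).2
  · exact Eventually.of_forall fun x => Measurable.aestronglyMeasurable (by fun_prop)
  · exact Measurable.aestronglyMeasurable (by fun_prop)
  · filter_upwards [hae] with ξ hξ x hx
    have hx' : ‖x‖ ≤ R := by simpa using (mem_ball_zero_iff.mp hx).le
    rw [norm_div, norm_pow, hξ]
    have := psi_den hx' hξ
    gcongr
  · filter_upwards [hae] with ξ hξ x hx
    have hx' : ‖x‖ ≤ R := by simpa using (mem_ball_zero_iff.mp hx).le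
    have hne : 1 - x * ξ ≠ 0 := norm_pos_iff.mp (hR'.trans_le (psi_den hx' hξ))
    have h1 : HasDerivAt (fun x : ℂ => x * ξ) ξ x := by
      simpa using (hasDerivAt_id x).mul_const ξ
    refine (h1.div (h1.const_sub 1) hne).congr_deriv ?_
    congr 1
    ring

lemma psi_re {μ : Measure ℂ} (h : MStar μ) {z : ℂ} (hz : ‖z‖ < 1) :
    -(1 / 2) ≤ (psiStar μ z).re := by
  have := h.1
  have hint := (psi_hasDeriv h hz).1
  have hre : (psiStar μ z).re = ∫ ξ, ((z * ξ) / (1 - z * ξ)).re ∂μ := by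
    have := integral_re hint
    simpa [psiStar] using this.symm
  rw [hre]
  have hae : ∀ᵐ ξ ∂μ, ‖ξ‖ = 1 := by
    have := h.2.1
    rw [← mem_ae_iff] at this
    filter_upwards [this] with ξ hξ
    simpa using hξ
  have : ∫ ξ : ℂ, (-(1 / 2) : ℝ) ∂μ ≤ ∫ ξ, ((z * ξ) / (1 - z * ξ)).re ∂μ := by
    apply integral_mono_ae (integrable_const _) hint.re
    filter_upwards [hae] with ξ hξ
    have hn : ‖z * ξ‖ < 1 := by rw [norm_mul, hξ, mul_one]; exact hz
    have hne : 1 - z * ξ ≠ 0 := norm_pos_iff.mp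
      ((sub_pos.mpr hz).trans_le (psi_den le_rfl hξ))
    generalize z * ξ = u at hn hne
    show -(1 / 2) ≤ (u / (1 - u)).re
    have hp : 0 < normSq (1 - u) := normSq_pos.mpr hne
    rw [Complex.div_re, ← add_div, le_div_iff₀ hp]
    have hu : normSq u < 1 := by
      rw [normSq_eq_norm_sq]; nlinarith [norm_nonneg u]
    simp only [normSq_apply] at hu ⊢
    simp
    nlinarith
  simpa using this

lemma psi_den_ne {μ : Measure ℂ} (h : MStar μ) {z : ℂ} (hz : ‖z‖ < 1) :
    1 + psiStar μ z ≠ 0 := by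
  intro h0
  have := congrArg Complex.re h0
  simp at this
  linarith [psi_re h hz]

lemma Q_norm {μ : Measure ℂ} (h : MStar μ) {z : ℂ} (hz : ‖z‖ < 1) : ‖QStar μ z‖ ≤ 1 := by
  have hne := psi_den_ne h hz
  have hre := psi_re h hz
  rw [QStar, norm_div, div_le_one (norm_pos_iff.mpr hne)]
  apply le_of_sq_le_sq _ (norm_nonneg _)
  simp only [← Complex.normSq_eq_norm_sq, Complex.normSq_apply]
  simp
  nlinarith

lemma Q_diff {μ : Measure ℂ} (h : MStar μ) : DifferentiableOn ℂ (QStar μ) (Metric.ball 0 1) := by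
  have h1 : DifferentiableOn ℂ (psiStar μ) (Metric.ball 0 1) := fun z hz =>
    (psi_hasDeriv h (by simpa using hz)).2.differentiableAt.differentiableWithinAt
  exact h1.div (h1.const_add 1) fun z hz => psi_den_ne h (by simpa using hz)

lemma psi_zero (μ : Measure ℂ) : psiStar μ 0 = 0 := by simp [psiStar]

lemma Q_zero (μ : Measure ℂ) : QStar μ 0 = 0 := by simp [QStar, psi_zero]

lemma Q_deriv {μ : Measure ℂ} (h : MStar μ) : deriv (QStar μ) 0 ≠ 0 := by
  have h1 := (psi_hasDeriv h (z := 0) (by simp)).2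
  have h2 := h1.div (h1.const_add 1) (by simp [psi_zero])
  have h3 : deriv (QStar μ) 0 = ∫ ξ, ξ ∂μ := by
    have := h2.deriv
    simp [psi_zero] at this
    exact this
  rw [h3]
  exact h.2.2

lemma QDiv_eq (μ : Measure ℂ) : QDiv μ = dslope (QStar μ) 0 := by
  funext ζ
  unfold QDiv
  split_ifs with h0
  · rw [h0, dslope_same]
  · rw [dslope_of_ne _ h0, slope_def_field, Q_zero]
    simp

lemma QDiv_diff {μ : Measure ℂ} (h : MStar μ) :
    DifferentiableOn ℂ (QDiv μ) (Metric.ball 0 1) := by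
  rw [QDiv_eq]
  exact (Complex.differentiableOn_dslope (Metric.ball_mem_nhds _ one_pos)).mpr (Q_diff h)

lemma QDiv_norm {μ : Measure ℂ} (h : MStar μ) {ζ : ℂ} (hζ : ζ ∈ Metric.ball (0 : ℂ) 1) :
    ‖QDiv μ ζ‖ ≤ 1 := by
  rw [QDiv_eq]
  have := Complex.norm_dslope_le_div_of_mapsTo_ball (R₂ := 1) (Q_diff h) (by
    intro w hw
    rw [Q_zero, mem_closedBall_zero_iff]
    exact Q_norm h (by simpa using hw)) hζ
  simpa using this

/-- Lemma 5.5: for every z ∈ 𝔻 ∖ {0} there exist unique points z₁, z₂ ∈ 𝔻 with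
(z₁,z₂) ≠ (0,0), z₂ = z·Q_{μ₁}(z₁)/z₁ and z₁ = z·Q_{μ₂}(z₂)/z₂. -/
theorem circle_subordination_pointwise (μ₁ μ₂ : Measure ℂ)
    (h₁ : MStar μ₁) (h₂ : MStar μ₂)
    (z : ℂ) (hz : z ∈ unitDisk) (hz0 : z ≠ 0) :
    ∃! p : ℂ × ℂ, p.1 ∈ unitDisk ∧ p.2 ∈ unitDisk ∧ p ≠ (0, 0) ∧
      p.2 = z * QDiv μ₁ p.1 ∧ p.1 = z * QDiv μ₂ p.2 := by
  have hz1 : ‖z‖ < 1 := by simpa [unitDisk] using hz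
  have hn : ∀ {μ : Measure ℂ}, MStar μ → ∀ w ∈ Metric.ball (0 : ℂ) 1, ‖z * QDiv μ w‖ ≤ ‖z‖ := by
    intro μ h w hw
    rw [norm_mul]
    exact mul_le_of_le_one_right (norm_nonneg _) (QDiv_norm h hw)
  have hm : ∀ {μ : Measure ℂ}, MStar μ →
      MapsTo (fun w => z * QDiv μ w) (Metric.ball (0 : ℂ) 1) (Metric.ball 0 1) := by
    intro μ h w hw
    rw [mem_ball_zero_iff]
    exact (hn h w hw).trans_lt hz1
  have hF : DifferentiableOn ℂ (fun w => z * QDiv μ₂ (z * QDiv μ₁ w)) (Metric.ball 0 1) :=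
    ((QDiv_diff h₂).comp ((QDiv_diff h₁).const_mul z) (hm h₁)).const_mul z
  have hb : ∀ w ∈ Metric.ball (0 : ℂ) 1, ‖z * QDiv μ₂ (z * QDiv μ₁ w)‖ ≤ ‖z‖ :=
    fun w hw => hn h₂ _ (hm h₁ hw)
  obtain ⟨w, hw, hfix⟩ := fixed_exists_s15 hz1 hF hb
  refine ⟨(w, z * QDiv μ₁ w), ⟨hw, hm h₁ hw, ?_, rfl, hfix.symm⟩, ?_⟩
  · intro h0
    obtain ⟨e1, e2⟩ := Prod.mk.inj h0
    rw [e1] at e2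
    rcases mul_eq_zero.mp e2 with h | h
    · exact hz0 h
    · simp only [QDiv, if_true] at h
      exact Q_deriv h₁ h
  · rintro ⟨a, b⟩ ⟨ha, hb', -, e1, e2⟩
    simp only at ha hb' e1 e2
    have hafix : z * QDiv μ₂ (z * QDiv μ₁ a) = a := by rw [← e1, ← e2]
    have : a = w := fixed_unique_s15 hz1 hF hb (by simpa [unitDisk] using ha)
      (by simpa using hw) hafix hfix
    subst this
    rw [e1]
end
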